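/- arXiv:2409.08819 — 7 statements merged into one kernel-verified Lean document; each statement's English description precedes it below -/
import Mathlib

section
/- Let X and Y be disjoint finite sets, and fix a blue/red coloring of the Boolean lattice Q(X ∪ Y) that contains no blue copy of the Λ-shaped poset 𝚲. Then exactly one of the following two statements holds: (i) there is a red X-good copy of Q(X) in Q(X ∪ Y); (ii) there is a blue Y-shrub in Q(X ∪ Y). -/
open Finset

/-- The Λ-shaped poset `𝚲`: a top element above two incomparable elements. -/
inductive LPoset : Type
  | top | left | right
  deriving DecidableEq

instance : PartialOrder LPoset where
  le a b := a = b ∨ b = LPoset.top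
  le_refl a := Or.inl rfl
  le_trans a b c h₁ h₂ := by
    rcases h₂ with rfl | h₂
    · exact h₁
    · exact Or.inr h₂
  le_antisymm a b h₁ h₂ := by
    rcases h₁ with rfl | h₁
    · rfl
    · rcases h₂ with rfl | h₂
      · rfl
      · exact h₂.trans h₁.symm

/-- The factorial tree `O(Y)`: the poset of all ordered subsets of `Y` (sequences of
distinct elements of `Y`), partially ordered by the prefix relation. -/
def FactorialTree {α : Type*} (Y : Finset α) : Type _ :=
  {l : List α // l.Nodup ∧ ∀ x ∈ l, x ∈ Y}

instance {α : Type*} (Y : Finset α) : PartialOrder (FactorialTree Y) where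
  le l₁ l₂ := l₁.val <+: l₂.val
  le_refl l := List.prefix_refl _
  le_trans _ _ _ h₁ h₂ := List.IsPrefix.trans h₁ h₂
  le_antisymm l₁ l₂ h₁ h₂ :=
    Subtype.ext (List.Sublist.antisymm (List.IsPrefix.sublist h₁) (List.IsPrefix.sublist h₂))

/-- The blue subsets of `W` are pairwise comparable. -/
def BlueChainBelow {α : Type*} (c : Finset α → Bool) (W : Finset α) : Prop :=
  ∀ B₁ ⊆ W, ∀ B₂ ⊆ W, c B₁ = true → c B₂ = true → B₁ ⊆ B₂ ∨ B₂ ⊆ B₁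

theorem BlueChainBelow.mono {α : Type*} {c : Finset α → Bool} {V W : Finset α}
    (h : BlueChainBelow c W) (hVW : V ⊆ W) : BlueChainBelow c V :=
  fun B₁ h₁ B₂ h₂ ↦ h B₁ (h₁.trans hVW) B₂ (h₂.trans hVW)

/-- In a coloring without a blue `𝚲`, the blue sets below a blue set form a chain. -/
theorem blueChainBelow_of_no_blue_lambda {α : Type*} {c : Finset α → Bool}
    (hnoblue : ¬ ∃ e : LPoset ↪o Finset α, ∀ v, c (e v) = true) {W : Finset α}
    (hW : c W = true) : BlueChainBelow c W := by
  intro B₁ h₁ B₂ h₂ hc₁ hc₂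
  by_contra! hne
  obtain ⟨h12, h21⟩ := hne
  have hW₁ : ¬ W ⊆ B₁ := fun h ↦ h21 (h₂.trans h)
  have hW₂ : ¬ W ⊆ B₂ := fun h ↦ h12 (h₁.trans h)
  let e : LPoset → Finset α
    | .top => W
    | .left => B₁
    | .right => B₂
  have he : ∀ a b, e a ≤ e b ↔ a ≤ b := by
    intro a b
    change e a ⊆ e b ↔ (a = b ∨ b = LPoset.top)
    cases a <;> cases b <;> simp [e, h₁, h₂, h12, h21, hW₁, hW₂]
  refine hnoblue ⟨OrderEmbedding.ofMapLEIff e he, fun v ↦ ?_⟩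
  cases v <;> simpa [e]

/-- `ShrubRoot Y c B` says that `B` can serve as the image of a vertex of a blue `Y`-shrub: it is
blue, and for each remaining element `y` of `Y` there is a set above `B` that adds exactly `y` to
the `Y`-part and again has this property. -/
inductive ShrubRoot {α : Type*} [DecidableEq α] (Y : Finset α) (c : Finset α → Bool) :
    Finset α → Prop
  | mk (B : Finset α) (next : α → Finset α) (blue : c B = true)
      (next_spec : ∀ y ∈ Y, y ∉ B → B ⊆ next y ∧ next y ∩ Y = insert y (B ∩ Y))
      (root_next : ∀ y ∈ Y, y ∉ B → ShrubRoot Y c (next y)) : ShrubRoot Y c B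

section

variable {α : Type*} [DecidableEq α] {Y : Finset α} {c : Finset α → Bool}

theorem ShrubRoot.blue {B : Finset α} (h : ShrubRoot Y c B) : c B = true := by
  cases h; assumption

theorem ShrubRoot.exists_next {B : Finset α} (h : ShrubRoot Y c B) {y : α} (hy : y ∈ Y)
    (hyB : y ∉ B) :
    ∃ B', B ⊆ B' ∧ B' ∩ Y = insert y (B ∩ Y) ∧ ShrubRoot Y c B' := by
  obtain ⟨_, next, _, hs, hr⟩ := h
  exact ⟨next y, (hs y hy hyB).1, (hs y hy hyB).2, hr y hy hyB⟩

theorem exists_of_not_shrubRoot {B : Finset α} (hB : c B = true) (h : ¬ ShrubRoot Y c B) :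
    ∃ y ∈ Y, y ∉ B ∧ ∀ B', B ⊆ B' → B' ∩ Y = insert y (B ∩ Y) → ¬ ShrubRoot Y c B' := by
  by_contra! hcon
  choose! next h₁ h₂ h₃ using hcon
  exact h (.mk B next hB (fun y hy hyB ↦ ⟨h₁ y hy hyB, h₂ y hy hyB⟩) h₃)

theorem exists_isLeast_of_blueChainBelow {W U : Finset α} (hW : BlueChainBelow c W)
    {B : Finset α} (hB : B ⊆ W ∧ c B = true ∧ B ∩ Y = U) :
    ∃ m, IsLeast {B | B ⊆ W ∧ c B = true ∧ B ∩ Y = U} m := by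
  have hfin : {B | B ⊆ W ∧ c B = true ∧ B ∩ Y = U}.Finite :=
    (W.powerset.finite_toSet).subset fun B hB ↦ by simpa using hB.1
  obtain ⟨m, hm⟩ := hfin.exists_minimal ⟨B, hB⟩
  refine ⟨m, hm.prop, fun B' hB' ↦ ?_⟩
  rcases hW m hm.prop.1 B' hB'.1 hm.prop.2.1 hB'.2.1 with h | h
  · exact h
  · exact hm.le_of_le hB' h

/-- A monotone map that sends `A` to a set `f A ⊆ Y` with `A ∪ f A` red, provided that no blue set
below `A ∪ U` with `Y`-part `U` is the root of a partial shrub. -/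
theorem exists_monotone_red {X : Finset α} (hdisj : Disjoint X Y)
    (hchain : ∀ W, c W = true → BlueChainBelow c W) (U : Finset α) (hU : U ⊆ Y) :
    ∃ f : Finset α → Finset α, Monotone f ∧ (∀ A, U ⊆ f A ∧ f A ⊆ Y) ∧
      ∀ A ⊆ X, (BlueChainBelow c (A ∪ U) →
        ∀ B ⊆ A ∪ U, c B = true → B ∩ Y = U → ¬ ShrubRoot Y c B) → c (A ∪ f A) = false := by
  classical
  induction hn : (Y \ U).card using Nat.strong_induction_on generalizing U with
  | _ n ih =>
  subst hn
  have hstep : ∀ m : Finset α, ∃ f : Finset α → Finset α, Monotone f ∧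
      (∀ A, U ⊆ f A ∧ f A ⊆ Y) ∧ (c m = true → m ∩ Y = U → ¬ ShrubRoot Y c m →
        ∀ A ⊆ X, m ⊆ A ∪ U → c (A ∪ f A) = false) := by
    intro m
    by_cases hm : c m = true ∧ m ∩ Y = U ∧ ¬ ShrubRoot Y c m
    · obtain ⟨hcm, hmU, hroot⟩ := hm
      obtain ⟨y, hy, hym, hbad⟩ := exists_of_not_shrubRoot hcm hroot
      have hyU : y ∉ U := fun h ↦ hym (mem_of_mem_inter_left (hmU ▸ h))
      obtain ⟨f, hf, hfU, hred⟩ := ih _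
        (card_lt_card (Finset.ssubset_iff_subset_ne.2
          ⟨sdiff_subset_sdiff Subset.rfl (subset_insert y U), fun h ↦ by
            simpa [hy, hyU] using congrArg (y ∈ ·) h⟩)) (insert y U)
        (insert_subset hy hU) rfl
      refine ⟨f, hf, fun A ↦ ⟨(subset_insert y U).trans (hfU A).1, (hfU A).2⟩,
        fun _ _ _ A hA hmA ↦ hred A hA fun hch B hB hcB hBY ↦ ?_⟩
      have hyB : y ∈ B := mem_of_mem_inter_left (hBY ▸ mem_insert_self y U)
      rcases hch m (hmA.trans (union_subset_union_right (subset_insert y U))) B hB hcm hcB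
        with h | h
      · exact hbad B h (by rw [hBY, hmU])
      · exact absurd (h hyB) hym
    · exact ⟨fun _ ↦ U, monotone_const, fun _ ↦ ⟨Subset.rfl, hU⟩,
        fun h₁ h₂ h₃ ↦ (hm ⟨h₁, h₂, h₃⟩).elim⟩
  choose F hFmono hFU hFred using hstep
  let S : Finset α → Set (Finset α) := fun A ↦ {B | B ⊆ A ∪ U ∧ c B = true ∧ B ∩ Y = U}
  let f : Finset α → Finset α := fun A ↦
    if BlueChainBelow c (A ∪ U) then
      if h : ∃ m, IsLeast (S A) m then F h.choose A else U
    else Y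
  have hfF : ∀ A m, BlueChainBelow c (A ∪ U) → IsLeast (S A) m → f A = F m A := by
    intro A m hA hm
    have h : ∃ m, IsLeast (S A) m := ⟨m, hm⟩
    simp only [f, if_pos hA, dif_pos h, h.choose_spec.unique hm]
  have hf0 : ∀ A, BlueChainBelow c (A ∪ U) → (¬ ∃ m, IsLeast (S A) m) → f A = U := by
    intro A hA h
    simp only [f, if_pos hA, dif_neg h]
  have hfY : ∀ A, ¬ BlueChainBelow c (A ∪ U) → f A = Y := fun A hA ↦ by
    simp only [f, if_neg hA]
  have hfU : ∀ A, U ⊆ f A ∧ f A ⊆ Y := by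
    intro A
    by_cases hA : BlueChainBelow c (A ∪ U)
    · by_cases h : ∃ m, IsLeast (S A) m
      · obtain ⟨m, hm⟩ := h
        rw [hfF A m hA hm]
        exact hFU m A
      · rw [hf0 A hA h]
        exact ⟨Subset.rfl, hU⟩
    · rw [hfY A hA]
      exact ⟨hU, Subset.rfl⟩
  refine ⟨f, fun A A' hAA' ↦ ?_, hfU, fun A hAX hA ↦ ?_⟩
  · by_cases hA' : BlueChainBelow c (A' ∪ U)
    · have hsub : A ∪ U ⊆ A' ∪ U := union_subset_union_left hAA'
      have hA := hA'.mono hsub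
      by_cases h : ∃ m, IsLeast (S A) m
      · obtain ⟨m, hm⟩ := h
        obtain ⟨m', hm'⟩ := exists_isLeast_of_blueChainBelow hA'
          ⟨hm.1.1.trans hsub, hm.1.2⟩
        have hle : m' ≤ m := hm'.2 ⟨hm.1.1.trans hsub, hm.1.2⟩
        have hmm : m' = m := le_antisymm hle (hm.2 ⟨le_trans hle hm.1.1, hm'.1.2⟩)
        subst hmm
        rw [hfF A _ hA hm, hfF A' _ hA' hm']
        exact hFmono _ hAA'
      · rw [hf0 A hA h]
        exact (hfU A').1
    · rw [hfY A' hA']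
      exact (hfU A).2
  · by_cases hch : BlueChainBelow c (A ∪ U)
    · by_cases h : ∃ m, IsLeast (S A) m
      · obtain ⟨m, hm⟩ := h
        rw [hfF A m hch hm]
        exact hFred m hm.1.2.1 hm.1.2.2 (hA hch m hm.1.1 hm.1.2.1 hm.1.2.2) A hAX hm.1.1
      · rw [hf0 A hch h, Bool.eq_false_iff]
        refine fun hc ↦ h (exists_isLeast_of_blueChainBelow hch ⟨Subset.rfl, hc, ?_⟩)
        rw [union_inter_distrib_right, disjoint_iff_inter_eq_empty.1 (hdisj.mono_left hAX),
          empty_union, inter_eq_left.2 hU]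
    · rw [hfY A hch, Bool.eq_false_iff]
      exact fun hc ↦ hch ((hchain _ hc).mono (union_subset_union_right hU))

/-- A root whose `Y`-part is empty extends to a blue `Y`-shrub. -/
theorem ShrubRoot.exists_shrub (hchain : ∀ W, c W = true → BlueChainBelow c W) {B₀ : Finset α}
    (hB₀ : ShrubRoot Y c B₀) (hB₀Y : B₀ ∩ Y = ∅) :
    ∃ ξ : FactorialTree Y ↪o Finset α,
      (∀ S : FactorialTree Y, ξ S ∩ Y = S.val.toFinset) ∧
      (∀ S : FactorialTree Y, c (ξ S) = true) := by
  have hex : ∀ (B : Finset α) (y : α), ∃ B', B ⊆ B' ∧ (ShrubRoot Y c B → y ∈ Y → y ∉ B →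
      B' ∩ Y = insert y (B ∩ Y) ∧ ShrubRoot Y c B') := by
    intro B y
    by_cases h : ShrubRoot Y c B ∧ y ∈ Y ∧ y ∉ B
    · obtain ⟨B', h₁, h₂⟩ := h.1.exists_next h.2.1 h.2.2
      exact ⟨B', h₁, fun _ _ _ ↦ h₂⟩
    · exact ⟨B, Subset.rfl, fun h₁ h₂ h₃ ↦ (h ⟨h₁, h₂, h₃⟩).elim⟩
  choose next hsub hnext using hex
  let g : List α → Finset α := fun l ↦ l.foldl next B₀
  have hg_append : ∀ l l', g l ⊆ g (l ++ l') := by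
    intro l l'
    induction l' using List.reverseRecOn with
    | nil => simp
    | append_singleton l' a ih =>
      refine ih.trans ?_
      rw [← List.append_assoc]
      simpa [g] using hsub _ a
  have hg : ∀ l : List α, l.Nodup → (∀ x ∈ l, x ∈ Y) →
      g l ∩ Y = l.toFinset ∧ ShrubRoot Y c (g l) := by
    intro l
    induction l using List.reverseRecOn with
    | nil => exact fun _ _ ↦ ⟨by simpa [g] using hB₀Y, hB₀⟩
    | append_singleton l a ih =>
      intro hnd hY
      obtain ⟨h₁, h₂⟩ := ih hnd.of_append_left fun x hx ↦ hY x (by simp [hx])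
      have haY : a ∈ Y := hY a (by simp)
      have hal : a ∉ l := by
        have := List.nodup_append.1 hnd
        exact fun h ↦ this.2.2 a h a (by simp) rfl
      have hag : a ∉ g l := fun h ↦ hal (by
        simpa [h₁] using (mem_inter.2 ⟨h, haY⟩ : a ∈ g l ∩ Y))
      have hga : g (l ++ [a]) = next (g l) a := by simp [g]
      obtain ⟨h₃, h₄⟩ := hnext (g l) a h₂ haY hag
      rw [hga]
      exact ⟨by rw [h₃, h₁]; ext; simp, h₄⟩
  have hmem : ∀ l : List α, l.Nodup → (∀ x ∈ l, x ∈ Y) → ∀ y ∈ Y, y ∈ g l → y ∈ l :=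
    fun l h₁ h₂ y hy hyl ↦ by
      simpa [(hg l h₁ h₂).1] using (mem_inter.2 ⟨hyl, hy⟩ : y ∈ g l ∩ Y)
  have hmem' : ∀ l : List α, l.Nodup → (∀ x ∈ l, x ∈ Y) → ∀ y ∈ l, y ∈ g l := fun l h₁ h₂ y hy ↦
    mem_of_mem_inter_left ((hg l h₁ h₂).1 ▸ List.mem_toFinset.2 hy)
  have hprefix : ∀ t : List α, t.Nodup → (∀ x ∈ t, x ∈ Y) → ∀ s : List α, s.Nodup →
      (∀ x ∈ s, x ∈ Y) → g s ⊆ g t → s <+: t := by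
    intro t ht htY s
    induction s using List.reverseRecOn with
    | nil => exact fun _ _ _ ↦ List.nil_prefix
    | append_singleton s a ih =>
      intro hs hsY hst
      obtain ⟨r, rfl⟩ := ih hs.of_append_left (fun x hx ↦ hsY x (by simp [hx]))
        ((hg_append s [a]).trans hst)
      have has : a ∉ s := fun h ↦ (List.nodup_append.1 hs).2.2 a h a (by simp) rfl
      have hat : a ∈ s ++ r := hmem _ ht htY a (hsY a (by simp))
        (hst (hmem' _ hs hsY a (by simp)))
      cases r with
      | nil => simp [has] at hat
      | cons b r =>
        have hsplit : s ++ b :: r = (s ++ [b]) ++ r := by simp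
        rw [hsplit] at ht htY hst ⊢
        have hsb : (s ++ [b]).Nodup := ht.of_append_left
        have hsbY : ∀ x ∈ s ++ [b], x ∈ Y := fun x hx ↦
          htY x (List.mem_append_left r hx)
        have hbs : b ∉ s := fun h ↦ (List.nodup_append.1 hsb).2.2 b h b (by simp) rfl
        suffices hab : a = b by subst hab; exact List.prefix_append _ _
        rcases hchain _ (hg _ ht htY).2.blue _ hst _ (hg_append _ r) (hg _ hs hsY).2.blue
          (hg _ hsb hsbY).2.blue with h | h
        · have := hmem _ hsb hsbY a (hsY a (by simp)) (h (hmem' _ hs hsY a (by simp)))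
          simpa [has] using this
        · have := hmem _ hs hsY b (hsbY b (by simp)) (h (hmem' _ hsb hsbY b (by simp)))
          simpa [hbs, eq_comm] using this
  refine ⟨OrderEmbedding.ofMapLEIff (fun S : FactorialTree Y ↦ g S.val) fun S T ↦
    ⟨fun h ↦ hprefix _ T.2.1 T.2.2 _ S.2.1 S.2.2 h, ?_⟩,
    fun S ↦ (hg _ S.2.1 S.2.2).1, fun S ↦ (hg _ S.2.1 S.2.2).2.blue⟩
  rintro ⟨r, hr⟩
  rw [← hr]
  exact hg_append _ r

/-- A red `X`-good copy of `Q(X)` and a blue `Y`-shrub share an element, so they cannot coexist. -/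
theorem not_red_copy_and_blue_shrub {X : Finset α} (hcover : ∀ a, a ∈ X ∨ a ∈ Y)
    (φ : {S : Finset α // S ⊆ X} ↪o Finset α) (hφ : ∀ A, φ A ∩ X = A.val)
    (hφc : ∀ A, c (φ A) = false) (ξ : FactorialTree Y ↪o Finset α)
    (hξ : ∀ S, ξ S ∩ Y = S.val.toFinset) (hξc : ∀ S, c (ξ S) = true) : False := by
  let p : FactorialTree Y → {S : Finset α // S ⊆ X} := fun S ↦ ⟨ξ S ∩ X, inter_subset_right⟩
  have hφX : ∀ S, φ (p S) ∩ X = ξ S ∩ X := fun S ↦ hφ _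
  -- A vertex `S` whose underlying set lies in `φ (p S)` can be extended indefinitely.
  have hstep : ∀ n : ℕ, ∃ S : FactorialTree Y, n ≤ S.val.length ∧ ξ S ∩ Y ⊆ φ (p S) := by
    intro n
    induction n with
    | zero =>
      let S : FactorialTree Y := ⟨[], by simp⟩
      refine ⟨S, Nat.zero_le _, ?_⟩
      rw [hξ S]
      simp [S]
    | succ n ih =>
      obtain ⟨S, hn, hS⟩ := ih
      have hne : ¬ φ (p S) ∩ Y ⊆ ξ S := by
        intro h
        have : φ (p S) = ξ S := by
          ext a
          rcases hcover a with ha | ha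
          · have := congrArg (a ∈ ·) (hφX S)
            simpa [ha] using this
          · exact ⟨fun h' ↦ h (mem_inter.2 ⟨h', ha⟩), fun h' ↦ hS (mem_inter.2 ⟨h', ha⟩)⟩
        have h₁ := hφc (p S)
        rw [this, hξc] at h₁
        cases h₁
      obtain ⟨y, hy, hyS⟩ := not_subset.1 hne
      obtain ⟨hyφ, hyY⟩ := mem_inter.1 hy
      have hyl : y ∉ S.val := fun h ↦ hyS (mem_of_mem_inter_left
        ((hξ S).symm ▸ List.mem_toFinset.2 h : y ∈ ξ S ∩ Y))
      let T : FactorialTree Y := ⟨S.val ++ [y], by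
        refine List.nodup_append.2 ⟨S.2.1, by simp, ?_⟩
        rintro a ha b hb rfl
        simp only [List.mem_singleton] at hb
        exact hyl (hb ▸ ha), by
        intro x hx
        rcases List.mem_append.1 hx with hx | hx
        · exact S.2.2 x hx
        · rw [List.mem_singleton.1 hx]
          exact hyY⟩
      have hST : S ≤ T := List.prefix_append _ _
      have hle : φ (p S) ⊆ φ (p T) := φ.monotone
        (inter_subset_inter_right (ξ.monotone hST) : ξ S ∩ X ⊆ ξ T ∩ X)
      refine ⟨T, by simp [T]; omega, fun x hx ↦ hle ?_⟩
      rw [hξ T, List.mem_toFinset] at hx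
      rcases List.mem_append.1 hx with hx | hx
      · exact hS ((hξ S).symm ▸ List.mem_toFinset.2 hx)
      · rw [List.mem_singleton.1 hx]
        exact hyφ
  obtain ⟨S, hn, -⟩ := hstep (Y.card + 1)
  have : S.val.toFinset.card ≤ Y.card :=
    card_le_card fun x hx ↦ S.2.2 x (List.mem_toFinset.1 hx)
  rw [List.toFinset_card_of_nodup S.2.1] at this
  omega

end

/-- Let `X` and `Y` be disjoint finite sets (with `X ∪ Y` the ground set of
the host Boolean lattice `Q(X ∪ Y)`), and fix a blue/red coloring with no blue copy of `𝚲`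
(`true` = blue, `false` = red). Then exactly one of the following holds:
(i) there is a red `X`-good copy of `Q(X)` (an order embedding `φ` of the subsets of `X` with
`φ(A) ∩ X = A`, all images red); (ii) there is a blue `Y`-shrub (an order embedding `ξ` of the
factorial tree `O(Y)` with `ξ(S) ∩ Y` the underlying set of `S`, all images blue). -/
theorem lambda_free_duality {α : Type*} [Fintype α] [DecidableEq α]
    (X Y : Finset α) (hdisj : Disjoint X Y) (hcover : X ∪ Y = Finset.univ)
    (c : Finset α → Bool)
    (hnoblue : ¬ ∃ e : LPoset ↪o Finset α, ∀ v, c (e v) = true) :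
    Xor'
      (∃ φ : {S : Finset α // S ⊆ X} ↪o Finset α,
        (∀ A : {S : Finset α // S ⊆ X}, φ A ∩ X = A.val) ∧
        (∀ A : {S : Finset α // S ⊆ X}, c (φ A) = false))
      (∃ ξ : FactorialTree Y ↪o Finset α,
        (∀ S : FactorialTree Y, ξ S ∩ Y = S.val.toFinset) ∧
        (∀ S : FactorialTree Y, c (ξ S) = true)) := by
  have hchain : ∀ W, c W = true → BlueChainBelow c W := fun W ↦
    blueChainBelow_of_no_blue_lambda hnoblue
  have hnot : ¬ ((∃ φ : {S : Finset α // S ⊆ X} ↪o Finset α,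
      (∀ A, φ A ∩ X = A.val) ∧ ∀ A, c (φ A) = false) ∧
      ∃ ξ : FactorialTree Y ↪o Finset α,
        (∀ S, ξ S ∩ Y = S.val.toFinset) ∧ ∀ S, c (ξ S) = true) := by
    rintro ⟨⟨φ, hφ, hφc⟩, ξ, hξ, hξc⟩
    exact not_red_copy_and_blue_shrub
      (fun a ↦ mem_union.1 (hcover ▸ mem_univ a)) φ hφ hφc ξ hξ hξc
  by_cases hroot : ∃ B, ShrubRoot Y c B ∧ B ∩ Y = ∅
  · obtain ⟨B, hB, hBY⟩ := hroot
    have hshrub := hB.exists_shrub hchain hBY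
    exact Or.inr ⟨hshrub, fun h ↦ hnot ⟨h, hshrub⟩⟩
  · obtain ⟨f, hf, hfY, hred⟩ := exists_monotone_red hdisj hchain ∅ (empty_subset Y)
    have hinter : ∀ A ⊆ X, (A ∪ f A) ∩ X = A := fun A hA ↦ by
      rw [union_inter_distrib_right, inter_eq_left.2 hA,
        disjoint_iff_inter_eq_empty.1 (hdisj.symm.mono_left (hfY A).2), union_empty]
    have hcopy : ∃ φ : {S : Finset α // S ⊆ X} ↪o Finset α,
        (∀ A, φ A ∩ X = A.val) ∧ ∀ A, c (φ A) = false := by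
      refine ⟨OrderEmbedding.ofMapLEIff (fun A ↦ A.val ∪ f A.val) fun A B ↦
        ⟨fun h ↦ ?_, fun h ↦ union_subset_union h (hf h)⟩, fun A ↦ hinter A.1 A.2,
        fun A ↦ hred A.1 A.2 fun _ B _ _ hBY hB ↦ hroot ⟨B, hB, hBY⟩⟩
      change A.val ⊆ B.val
      rw [← hinter A.1 A.2, ← hinter B.1 B.2]
      exact inter_subset_inter_right h
    exact Or.inl ⟨hcopy, fun h ↦ hnot ⟨hcopy, h⟩⟩
end

section
/- Let Y be a non-empty subset of a finite set Z. A subposet F of the Boolean lattice Q(Z) is a Y-blocker if and only if every homomorphism ψ : F → Q(Y) is Y-hitting. -/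
open Finset


/-- Let `Y` be a non-empty subset of a finite ground set (here `Finset.univ`),
and let `X = Yᶜ` be its complement. A subposet `F` of the Boolean lattice is a `Y`-blocker
(contains a vertex of every `X`-good copy of `Q(X)`) if and only if every homomorphism
(monotone map) `ψ : F → Q(Y)` is `Y`-hitting, i.e. satisfies `ψ(S) = S ∩ Y` for some `S ∈ F`. -/
theorem blocker_iff_hitting {α : Type*} [Fintype α] [DecidableEq α]
    (Y : Finset α) (hY : Y.Nonempty) (F : Set (Finset α)) :
    (∀ φ : {S : Finset α // S ⊆ Yᶜ} ↪o Finset α,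
        (∀ A : {S : Finset α // S ⊆ Yᶜ}, φ A ∩ Yᶜ = A.val) →
        ∃ A : {S : Finset α // S ⊆ Yᶜ}, φ A ∈ F) ↔
    (∀ ψ : F → {T : Finset α // T ⊆ Y}, Monotone ψ →
        ∃ S : F, (ψ S).val = (S : Finset α) ∩ Y) := by
  classical
  constructor
  · intro h ψ hψ
    by_contra! havoid
    -- `y A` is the least `B` such that `ψ T ⊆ B` for every `T ∈ F` with `T ⊆ A ∪ B`
    let y : Finset α → Finset α := fun A =>
      Y.filter fun a => ∀ B : Finset α,
        (∀ T : F, (T : Finset α) ⊆ A ∪ B → (ψ T).val ⊆ B) → a ∈ B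
    have y_subset : ∀ A, y A ⊆ Y := fun A => Finset.filter_subset _ _
    have y_subset_of_closed : ∀ A B : Finset α,
        (∀ T : F, (T : Finset α) ⊆ A ∪ B → (ψ T).val ⊆ B) → y A ⊆ B :=
      fun A B hB a ha => (Finset.mem_filter.1 ha).2 B hB
    have y_closed : ∀ (A : Finset α) (T : F), (T : Finset α) ⊆ A ∪ y A → (ψ T).val ⊆ y A :=
      fun A T hT a ha => Finset.mem_filter.2 ⟨(ψ T).2 ha, fun B hB =>
        hB T (hT.trans (Finset.union_subset_union_right (y_subset_of_closed A B hB))) ha⟩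
    have y_mono : ∀ A A' : Finset α, A ⊆ A' → y A ⊆ y A' := fun A A' hA =>
      y_subset_of_closed A _ fun T hT =>
        y_closed A' T (hT.trans (Finset.union_subset_union_left hA))
    have inter_compl : ∀ A : Finset α, A ⊆ Yᶜ → (A ∪ y A) ∩ Yᶜ = A := by
      intro A hA
      ext a
      have h₁ := @hA a
      have h₂ := @y_subset A a
      simp only [Finset.mem_inter, Finset.mem_union, Finset.mem_compl] at *
      tauto
    have inter_self : ∀ A : Finset α, A ⊆ Yᶜ → (A ∪ y A) ∩ Y = y A := by
      intro A hA
      ext a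
      have h₁ := @hA a
      have h₂ := @y_subset A a
      simp only [Finset.mem_inter, Finset.mem_union, Finset.mem_compl] at *
      tauto
    let φ : {S : Finset α // S ⊆ Yᶜ} ↪o Finset α :=
      OrderEmbedding.ofMapLEIff (fun A => A.val ∪ y A.val) fun A B =>
        ⟨fun hAB => by
          have hle := Finset.inter_subset_inter_right (u := Yᶜ) hAB
          rwa [inter_compl A A.2, inter_compl B B.2] at hle,
        fun hAB => Finset.union_subset_union hAB (y_mono _ _ hAB)⟩
    obtain ⟨A, hA⟩ := h φ fun A => inter_compl A A.2
    have hA' : A.val ∪ y A.val ∈ F := hA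
    have hle : (ψ ⟨_, hA'⟩).val ⊆ y A.val := y_closed _ _ subset_rfl
    refine havoid ⟨_, hA'⟩ ?_
    rw [inter_self A A.2]
    refine hle.antisymm (y_subset_of_closed _ _ fun T hT => ?_)
    exact hψ (show T ≤ ⟨_, hA'⟩ from hT.trans (Finset.union_subset_union_right hle))
  · intro h φ hφ
    obtain ⟨S, hS⟩ := h
      (fun S => ⟨φ ⟨S.val ∩ Yᶜ, Finset.inter_subset_right⟩ ∩ Y, Finset.inter_subset_right⟩)
      fun S T hST => Finset.inter_subset_inter_right
        (φ.monotone (Finset.inter_subset_inter_right hST))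
    refine ⟨⟨S.val ∩ Yᶜ, Finset.inter_subset_right⟩, ?_⟩
    have hX := hφ ⟨S.val ∩ Yᶜ, Finset.inter_subset_right⟩
    have hEq : φ ⟨S.val ∩ Yᶜ, Finset.inter_subset_right⟩ = S.val := by
      ext a
      have h₁ := Finset.ext_iff.1 hX a
      have h₂ := Finset.ext_iff.1 hS a
      simp only [Finset.mem_inter, Finset.mem_compl] at h₁ h₂
      tauto
    rw [hEq]
    exact S.2
end

section
/- For all integers n and t with 3 ≤ t ≤ log log n, R(A_t, Q_n) = n + 3. -/
open Finset

/-- The poset Ramsey number `R(P,Q)`: the least `N` such that every blue/red coloring of the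
Boolean lattice `Q_N` (subsets of `Fin N` ordered by inclusion, colors as `Bool` with
`true` = blue, `false` = red) contains a blue induced copy of `P` or a red induced copy of `Q`,
where an induced copy is the image of an order embedding. -/
noncomputable def posetRamsey (P : Type*) (Q : Type*) [PartialOrder P] [PartialOrder Q] : ℕ :=
  sInf {N : ℕ | ∀ c : Finset (Fin N) → Bool,
    (∃ e : P ↪o Finset (Fin N), ∀ p, c (e p) = true) ∨
    (∃ e : Q ↪o Finset (Fin N), ∀ q, c (e q) = false)}

/-- The antichain `A_t`: `t` pairwise incomparable elements. -/
def AntichainP (t : ℕ) : Type := Fin t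

instance (t : ℕ) : PartialOrder (AntichainP t) where
  le a b := a = b
  le_refl _ := rfl
  le_trans _ _ _ h₁ h₂ := Eq.trans h₁ h₂
  le_antisymm _ _ h _ := h

/-- **Dilworth's theorem**: a finite set of a partial order without antichain of more than `k`
elements can be partitioned into `k` chains. -/
theorem exists_chain_coloring {α : Type*} [PartialOrder α] [DecidableEq α] (s : Finset α) :
    ∀ k : ℕ, (∀ t ⊆ s, IsAntichain (· ≤ ·) (t : Set α) → #t ≤ k) →
      ∃ f : α → ℕ, (∀ x ∈ s, f x < k) ∧
        ∀ x ∈ s, ∀ y ∈ s, f x = f y → x ≤ y ∨ y ≤ x := by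
  classical
  induction s using Finset.strongInduction with
  | H s ih =>
  intro k hk
  rcases s.eq_empty_or_nonempty with rfl | hne
  · exact ⟨fun _ => 0, by simp, by simp⟩
  -- it suffices to remove a nonempty chain that meets every antichain of size `k`
  have remove : ∀ K ⊆ s, K.Nonempty → (∀ x ∈ K, ∀ y ∈ K, x ≤ y ∨ y ≤ x) →
      (∀ t ⊆ s \ K, IsAntichain (· ≤ ·) (t : Set α) → #t ≠ k) →
      ∃ f : α → ℕ, (∀ x ∈ s, f x < k) ∧
        ∀ x ∈ s, ∀ y ∈ s, f x = f y → x ≤ y ∨ y ≤ x := by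
    intro K hKs hKne hK hanti
    have hpos : 0 < k := Nat.pos_of_ne_zero fun h => hanti ∅ (by simp) (by simp) (by simp [h])
    obtain ⟨g, hg, hg'⟩ := ih (s \ K) (sdiff_ssubset hKs hKne) (k - 1) (fun t ht hta => by
      have h1 := hk t (ht.trans sdiff_subset) hta
      have h2 := hanti t ht hta
      omega)
    refine ⟨fun x => if x ∈ K then k - 1 else g x, fun x hx => ?_, fun x hx y hy hxy => ?_⟩
    · by_cases h : x ∈ K
      · simp [h, hpos]
      · have := hg x (by simp [hx, h])
        simp only [h, if_false]
        omega
    · by_cases h : x ∈ K <;> by_cases h' : y ∈ K <;> simp only [h, h', if_true, if_false] at hxy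
      · exact hK x h y h'
      · have := hg y (by simp [hy, h'])
        omega
      · have := hg x (by simp [hx, h])
        omega
      · exact hg' x (by simp [hx, h]) y (by simp [hy, h']) hxy
  obtain ⟨a, ha, hamax⟩ := s.exists_maximal hne
  by_cases hex : ∃ t ⊆ s.erase a, IsAntichain (· ≤ ·) (t : Set α) ∧ #t = k
  swap
  · push Not at hex
    refine remove {a} (by simpa using ha) (by simp) (by simp) fun t ht => hex t ?_
    rwa [sdiff_singleton_eq_erase] at ht
  obtain ⟨t₀, ht₀, hat₀, hct₀⟩ := hex
  obtain ⟨f, hf, hf'⟩ := ih (s.erase a) (erase_ssubset ha) k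
    (fun t ht => hk t (ht.trans (erase_subset _ _)))
  have hit : ∀ t ⊆ s.erase a, IsAntichain (· ≤ ·) (t : Set α) → #t = k →
      ∀ i < k, ∃ z ∈ t, f z = i := by
    intro t ht hta htc i hi
    have hinj : Set.InjOn f t := by
      intro x hx y hy hxy
      rcases hf' x (ht hx) y (ht hy) hxy with h | h
      · exact hta.eq hx hy h
      · exact (hta.eq hy hx h).symm
    have himg : t.image f = range k := by
      refine eq_of_subset_of_card_le (fun j hj => ?_) ?_
      · obtain ⟨z, hz, rfl⟩ := mem_image.1 hj
        exact mem_range.2 (hf z (ht hz))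
      · rw [card_image_of_injOn hinj, htc, card_range]
    exact mem_image.1 (himg ▸ mem_range.2 hi)
  have top : ∀ i : ℕ, ∃ x : α, i < k →
      (x ∈ s.erase a ∧ f x = i ∧
        (∃ t ⊆ s.erase a, IsAntichain (· ≤ ·) (t : Set α) ∧ #t = k ∧ x ∈ t)) ∧
      ∀ t ⊆ s.erase a, IsAntichain (· ≤ ·) (t : Set α) → #t = k →
        ∀ z ∈ t, f z = i → z ≤ x := by
    intro i
    by_cases hi : i < k
    swap
    · exact ⟨a, fun h => absurd h hi⟩
    obtain ⟨z₀, hz₀, hfz₀⟩ := hit t₀ ht₀ hat₀ hct₀ i hi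
    obtain ⟨x, hx, hxmax⟩ := ((s.erase a).filter fun x => f x = i ∧
      ∃ t ⊆ s.erase a, IsAntichain (· ≤ ·) (t : Set α) ∧ #t = k ∧ x ∈ t).exists_maximal
        ⟨z₀, mem_filter.2 ⟨ht₀ hz₀, hfz₀, t₀, ht₀, hat₀, hct₀, hz₀⟩⟩
    have hx' := mem_filter.1 hx
    refine ⟨x, fun _ => ⟨hx', fun t ht hta htc z hz hfz => ?_⟩⟩
    rcases hf' z (ht hz) x hx'.1 (hfz.trans hx'.2.1.symm) with h | h
    · exact h
    · exact hxmax (mem_filter.2 ⟨ht hz, hfz, t, ht, hta, htc, hz⟩) h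
  choose x hx using top
  have hanti : ∀ i < k, ∀ j < k, x i ≤ x j → i = j := by
    intro i hi j hj hij
    obtain ⟨⟨-, hfj, t, ht, hta, htc, hxt⟩, -⟩ := hx j hj
    obtain ⟨y, hy, hfy⟩ := hit t ht hta htc i hi
    have hyx := (hx i hi).2 t ht hta htc y hy hfy
    have := hta.eq hy hxt (hyx.trans hij)
    rw [← hfy, this, hfj]
  have hbelow : ∃ i < k, x i ≤ a := by
    by_contra! hcon
    have hsub : insert a ((range k).image x) ⊆ s := by
      intro z hz
      rcases mem_insert.1 hz with rfl | hz
      · exact ha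
      · obtain ⟨i, hi, rfl⟩ := mem_image.1 hz
        exact mem_of_mem_erase (hx i (mem_range.1 hi)).1.1
    have hna : a ∉ (range k).image x := by
      intro hz
      obtain ⟨i, hi, hia⟩ := mem_image.1 hz
      exact hcon i (mem_range.1 hi) hia.le
    have hcard := hk _ hsub (by
      rw [coe_insert]
      refine IsAntichain.insert ?_ ?_ ?_
      · intro u hu v hv huv hle
        obtain ⟨i, hi, rfl⟩ := mem_image.1 (mem_coe.1 hu)
        obtain ⟨j, hj, rfl⟩ := mem_image.1 (mem_coe.1 hv)
        exact huv (congrArg x (hanti i (mem_range.1 hi) j (mem_range.1 hj) hle))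
      · intro u hu _ hle
        obtain ⟨i, hi, rfl⟩ := mem_image.1 (mem_coe.1 hu)
        exact hcon i (mem_range.1 hi) hle
      · intro u hu _ hle
        obtain ⟨i, hi, rfl⟩ := mem_image.1 (mem_coe.1 hu)
        exact hcon i (mem_range.1 hi)
          (hamax (mem_of_mem_erase (hx i (mem_range.1 hi)).1.1) hle))
    rw [card_insert_of_notMem hna, card_image_of_injOn, card_range] at hcard
    · omega
    · intro i hi j hj hij
      exact hanti i (by simpa using hi) j (by simpa using hj) hij.le
  obtain ⟨i, hi, hia⟩ := hbelow
  refine remove (insert a ((s.erase a).filter fun z => f z = i ∧ z ≤ x i)) ?_ (by simp) ?_ ?_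
  · exact insert_subset ha ((filter_subset _ _).trans (erase_subset _ _))
  · intro u hu v hv
    rcases mem_insert.1 hu with rfl | hu <;> rcases mem_insert.1 hv with rfl | hv
    · exact Or.inl le_rfl
    · exact Or.inr ((mem_filter.1 hv).2.2.trans hia)
    · exact Or.inl ((mem_filter.1 hu).2.2.trans hia)
    · obtain ⟨hu, hfu, -⟩ := mem_filter.1 hu
      obtain ⟨hv, hfv, -⟩ := mem_filter.1 hv
      exact hf' u hu v hv (hfu.trans hfv.symm)
  · intro t ht hta htc
    have hts : t ⊆ s.erase a := fun z hz => by
      have := mem_sdiff.1 (ht hz)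
      exact mem_erase.2 ⟨fun h => this.2 (h ▸ mem_insert_self _ _), this.1⟩
    obtain ⟨z, hz, hfz⟩ := hit t hts hta htc i hi
    exact (mem_sdiff.1 (ht hz)).2 (mem_insert_of_mem
      (mem_filter.2 ⟨hts hz, hfz, (hx i hi).2 t hts hta htc z hz hfz⟩))

/-- **Erdős–Szekeres theorem**, for weakly monotone functions. -/
theorem exists_monotoneOn_or_antitoneOn {α β : Type*} [LinearOrder α] [LinearOrder β]
    (f : α → β) (s : Finset α) (m : ℕ) (hs : m * m < #s) :
    ∃ t ⊆ s, m < #t ∧ (MonotoneOn f t ∨ AntitoneOn f t) := by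
  classical
  have hinj : Function.Injective fun x => (x, f x) := fun x y h => congrArg Prod.fst h
  by_cases h : ∀ u ⊆ s.image (fun x => (x, f x)), IsAntichain (· ≤ ·) (u : Set (α × β)) → #u ≤ m
  · obtain ⟨g, hg, hg'⟩ := exists_chain_coloring _ m h
    obtain ⟨i, -, hi⟩ := exists_lt_card_fiber_of_mul_lt_card_of_maps_to
      (s := s) (t := range m) (f := fun x => g (x, f x)) (n := m)
      (fun x hx => mem_coe.2 (mem_range.2 (hg _ (mem_image_of_mem _ hx)))) (by simpa using hs)
    refine ⟨_, filter_subset _ _, hi, Or.inl fun x hx y hy hxy => ?_⟩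
    obtain ⟨hx, hgx⟩ := mem_filter.1 (mem_coe.1 hx)
    obtain ⟨hy, hgy⟩ := mem_filter.1 (mem_coe.1 hy)
    rcases hg' _ (mem_image_of_mem _ hx) _ (mem_image_of_mem _ hy) (hgx.trans hgy.symm) with h | h
    · exact h.2
    · obtain rfl : x = y := le_antisymm hxy h.1
      exact le_rfl
  · push Not at h
    obtain ⟨u, hu, hanti, hcard⟩ := h
    refine ⟨s.filter fun x => (x, f x) ∈ u, filter_subset _ _, ?_, Or.inr fun x hx y hy hxy => ?_⟩
    · have : u = (s.filter fun x => (x, f x) ∈ u).image fun x => (x, f x) := by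
        ext p
        constructor
        · intro hp
          obtain ⟨x, hx, rfl⟩ := mem_image.1 (hu hp)
          exact mem_image_of_mem _ (mem_filter.2 ⟨hx, hp⟩)
        · intro hp
          obtain ⟨x, hx, rfl⟩ := mem_image.1 hp
          exact (mem_filter.1 hx).2
      rwa [this, card_image_of_injective _ hinj] at hcard
    · by_contra! hlt
      have := hanti.eq (mem_filter.1 (mem_coe.1 hx)).2 (mem_filter.1 (mem_coe.1 hy)).2
        (Prod.mk_le_mk.2 ⟨hxy, hlt.le⟩)
      exact hlt.ne (congrArg Prod.snd this)

/-- Iterated Erdős–Szekeres: among more than `2 ^ 2 ^ k` points there are three on which each of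
`k` given functions is monotone or antitone. -/
theorem exists_two_lt_card_forall_monotoneOn_or_antitoneOn {α β : Type*} [LinearOrder α]
    [LinearOrder β] (f : ℕ → α → β) (k : ℕ) :
    ∀ s : Finset α, 2 ^ 2 ^ k < #s →
      ∃ t ⊆ s, 2 < #t ∧ ∀ j < k, MonotoneOn (f j) t ∨ AntitoneOn (f j) t := by
  induction k with
  | zero => exact fun s hs => ⟨s, Subset.rfl, by simpa using hs, by simp⟩
  | succ k ih =>
    intro s hs
    rw [pow_succ, mul_two, pow_add] at hs
    obtain ⟨u, hus, hu, hmono⟩ := exists_monotoneOn_or_antitoneOn (f k) s _ hs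
    obtain ⟨t, htu, ht, hall⟩ := ih u hu
    refine ⟨t, htu.trans hus, ht, fun j hj => ?_⟩
    rcases Nat.lt_succ_iff_lt_or_eq.1 hj with hj | rfl
    · exact hall j hj
    · exact hmono.imp (fun h => h.mono (coe_subset.2 htu)) (fun h => h.mono (coe_subset.2 htu))

/-- If a set family has no antichain of more than `k` members and the ground set is large, then
three points have a trace `{a, c}` that no member of the family has. -/
theorem exists_missing_trace {N k : ℕ} (B : Finset (Finset (Fin N)))
    (hB : ∀ t ⊆ B, IsAntichain (· ≤ ·) (t : Set (Finset (Fin N))) → #t ≤ k)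
    (hN : 2 ^ 2 ^ k < N) :
    ∃ a b c : Fin N, a < b ∧ b < c ∧ ∀ Z ∈ B, a ∈ Z → c ∈ Z → b ∈ Z := by
  obtain ⟨g, hg, hg'⟩ := exists_chain_coloring B k hB
  obtain ⟨t, -, ht, hmono⟩ := exists_two_lt_card_forall_monotoneOn_or_antitoneOn
    (fun j (x : Fin N) => #{Z ∈ B | g Z = j ∧ x ∈ Z}) k univ (by simpa using hN)
  have hlt : ∀ Z ∈ B, ∀ x ∈ Z, ∀ b ∉ Z,
      #{W ∈ B | g W = g Z ∧ b ∈ W} < #{W ∈ B | g W = g Z ∧ x ∈ W} := by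
    intro Z hZ x hx b hb
    refine card_lt_card ((ssubset_iff_of_subset fun W hW => ?_).2 ⟨Z, ?_, ?_⟩)
    · obtain ⟨hWB, hgW, hbW⟩ := mem_filter.1 hW
      refine mem_filter.2 ⟨hWB, hgW, ?_⟩
      rcases hg' W hWB Z hZ hgW with h | h
      · exact absurd (h hbW) hb
      · exact h hx
    · simp [hZ, hx]
    · simp [hb]
  let e := t.orderEmbOfCardLe ht
  have he : ∀ i, e i ∈ (t : Set (Fin N)) := fun i => t.orderEmbOfCardLe_mem ht i
  have h01 : e 0 < e 1 := e.strictMono (by decide)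
  have h12 : e 1 < e 2 := e.strictMono (by decide)
  refine ⟨e 0, e 1, e 2, h01, h12, fun Z hZ h0 h2 => ?_⟩
  by_contra h1
  rcases hmono (g Z) (hg Z hZ) with h | h
  · exact (hlt Z hZ _ h0 _ h1).not_ge (h (he 0) (he 1) h01.le)
  · exact (hlt Z hZ _ h2 _ h1).not_ge (h (he 1) (he 2) h12.le)

/-- A trace on three points determines a copy of `Q_n` in `Q_{n+3}`. -/
theorem exists_orderEmbedding_of_trace {n : ℕ} {a b c : Fin (n + 3)} (hab : a < b) (hbc : b < c) :
    ∃ e : Finset (Fin n) ↪o Finset (Fin (n + 3)), ∀ A, a ∈ e A ∧ b ∉ e A ∧ c ∈ e A := by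
  have hcard : #(({a, b, c} : Finset (Fin (n + 3)))ᶜ) = n := by
    rw [card_compl, Fintype.card_fin, card_eq_three.2 ⟨a, b, c, hab.ne, (hab.trans hbc).ne,
      hbc.ne, rfl⟩]
    omega
  let g := (({a, b, c} : Finset (Fin (n + 3)))ᶜ).orderEmbOfFin hcard
  have hg : ∀ i, g i ≠ a ∧ g i ≠ b ∧ g i ≠ c := fun i => by
    have h : g i ∈ ({a, b, c} : Finset (Fin (n + 3)))ᶜ := orderEmbOfFin_mem _ hcard i
    simpa only [mem_compl, mem_insert, mem_singleton, not_or] using h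
  refine ⟨OrderEmbedding.ofMapLEIff (fun A => A.map g.toEmbedding ∪ {a, c}) fun A A' => ?_,
    fun A => ?_⟩
  · constructor
    · intro h i hi
      have := h (mem_union_left _ (mem_map_of_mem g.toEmbedding hi))
      have hgi := hg i
      simpa [hgi.1, hgi.2.2] using this
    · intro h
      exact union_subset_union (map_subset_map.2 h) Subset.rfl
  · simp [hab.ne', hbc.ne, fun i => (hg i).2.1]

/-- An antichain with at least `t` elements contains a copy of `A_t`. -/
theorem exists_antichain_embedding {α : Type*} [PartialOrder α] {t : ℕ} {u : Finset α}
    (hu : IsAntichain (· ≤ ·) (u : Set α)) (ht : t ≤ #u) :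
    ∃ e : AntichainP t ↪o α, ∀ p, e p ∈ u := by
  obtain ⟨v, hvu, hv⟩ := exists_subset_card_eq ht
  let g : Fin t ≃ v := (v.equivFinOfCardEq hv).symm
  refine ⟨OrderEmbedding.ofMapLEIff (fun p : AntichainP t => (g p : α)) fun p q => ?_,
    fun p => hvu (g p).2⟩
  constructor
  · intro h
    exact g.injective (Subtype.ext (hu.eq (hvu (g p).2) (hvu (g q).2) h))
  · intro h
    obtain rfl : p = q := h
    exact le_rfl

/-- The upper bound `R(A_{k+1}, Q_n) ≤ n + 3` in terms of colorings. -/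
theorem blue_antichain_or_red_cube {n k : ℕ} (hn : 2 ^ 2 ^ k < n + 3)
    (c : Finset (Fin (n + 3)) → Bool) :
    (∃ e : AntichainP (k + 1) ↪o Finset (Fin (n + 3)), ∀ p, c (e p) = true) ∨
      ∃ e : Finset (Fin n) ↪o Finset (Fin (n + 3)), ∀ q, c (e q) = false := by
  by_cases h : ∀ u ⊆ ({Z | c Z = true} : Finset (Finset (Fin (n + 3)))),
      IsAntichain (· ≤ ·) (u : Set (Finset (Fin (n + 3)))) → #u ≤ k
  · obtain ⟨x, y, z, hxy, hyz, hmiss⟩ := exists_missing_trace _ h hn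
    obtain ⟨e, he⟩ := exists_orderEmbedding_of_trace hxy hyz
    refine Or.inr ⟨e, fun A => ?_⟩
    obtain ⟨hx, hy, hz⟩ := he A
    by_contra hA
    exact hy (hmiss (e A) (by simpa using hA) hx hz)
  · push Not at h
    obtain ⟨u, hu, hanti, hcard⟩ := h
    obtain ⟨e, he⟩ := exists_antichain_embedding hanti hcard
    exact Or.inl ⟨e, fun p => by simpa using hu (he p)⟩

/-- A copy of `Q_n` has distinguished points of the ground set whose traces form `Q_n`. -/
theorem exists_trace_points {n : ℕ} {α : Type*} (e : Finset (Fin n) ↪o Finset α) :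
    ∃ x : Fin n ↪ α, ∀ A i, x i ∈ e A ↔ i ∈ A := by
  have hex : ∀ i : Fin n, ∃ y, y ∈ e {i} ∧ y ∉ e {i}ᶜ := fun i => by
    by_contra! hcon
    have h : ({i} : Finset (Fin n)) ≤ {i}ᶜ := e.le_iff_le.1 hcon
    simpa using h (mem_singleton_self i)
  choose x hx hx' using hex
  have hiff : ∀ A i, x i ∈ e A ↔ i ∈ A := fun A i => by
    constructor
    · intro h
      by_contra hi
      exact hx' i (e.monotone (show A ≤ {i}ᶜ from fun j hj => by
        rw [mem_compl, mem_singleton]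
        rintro rfl
        exact hi hj) h)
    · intro h
      exact e.monotone (show {i} ≤ A from singleton_subset_iff.2 h) (hx i)
  refine ⟨⟨x, fun i j hij => ?_⟩, hiff⟩
  have := (hiff {j} i).1 (hij ▸ hx j)
  simpa using this

/-- Every copy of `Q_n` in `Q_{n+2}` contains an initial or a final segment. -/
theorem exists_mem_eq_segment {n : ℕ} (e : Finset (Fin n) ↪o Finset (Fin (n + 2))) :
    ∃ A, IsLowerSet (e A : Set (Fin (n + 2))) ∨ IsUpperSet (e A : Set (Fin (n + 2))) := by
  obtain ⟨x, hx⟩ := exists_trace_points e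
  have hcard : #((univ.map x)ᶜ) = 2 := by simp [card_compl]
  obtain ⟨a, b, hab, hY⟩ : ∃ a b : Fin (n + 2), a < b ∧ (univ.map x)ᶜ = {a, b} := by
    obtain ⟨a, b, hab, hY⟩ := card_eq_two.1 hcard
    rcases lt_or_gt_of_ne hab with h | h
    · exact ⟨a, b, h, hY⟩
    · exact ⟨b, a, h, by rw [hY, pair_comm]⟩
  have hcases : ∀ y, y = a ∨ y = b ∨ ∃ i, x i = y := fun y => by
    by_cases h : y ∈ univ.map x
    · exact Or.inr (Or.inr (by simpa using h))
    · have : y ∈ ({a, b} : Finset (Fin (n + 2))) := hY ▸ mem_compl.2 h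
      simpa [or_assoc] using Or.inl (b := ∃ i, x i = y) this
  have hxa : ∀ i, x i ≠ a ∧ x i ≠ b := fun i => by
    have h : x i ∉ ({a, b} : Finset (Fin (n + 2))) := by
      rw [← hY]
      simp
    simpa using h
  by_cases ha : a ∈ e ∅
  · refine ⟨univ.filter fun i => x i < b, Or.inl ?_⟩
    have hmem : ∀ y < b, y ∈ e (univ.filter fun i => x i < b) := fun y hy => by
      rcases hcases y with rfl | rfl | ⟨i, rfl⟩
      · exact e.monotone (empty_subset _) ha
      · exact absurd hy (lt_irrefl _)
      · simpa [hx] using hy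
    intro y z hzy hy
    rcases hzy.eq_or_lt with rfl | hzy
    · exact hy
    refine hmem z (hzy.trans_le ?_)
    rcases hcases y with rfl | rfl | ⟨i, rfl⟩
    · exact hab.le
    · exact le_rfl
    · have : x i < b := by simpa [hx] using hy
      exact this.le
  by_cases hb : b ∈ e ∅
  · refine ⟨univ.filter fun i => a < x i, Or.inr ?_⟩
    have hmem : ∀ y > a, y ∈ e (univ.filter fun i => a < x i) := fun y hy => by
      rcases hcases y with rfl | rfl | ⟨i, rfl⟩
      · exact absurd hy (lt_irrefl _)
      · exact e.monotone (empty_subset _) hb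
      · simpa [hx] using hy
    intro y z hyz hy
    rcases hyz.eq_or_lt with rfl | hyz
    · exact hy
    refine hmem z (lt_of_le_of_lt ?_ hyz)
    rcases hcases y with rfl | rfl | ⟨i, rfl⟩
    · exact le_rfl
    · exact hab.le
    · have : a < x i := by simpa [hx] using hy
      exact this.le
  · refine ⟨∅, Or.inl fun y z _ hy => ?_⟩
    rcases hcases y with rfl | rfl | ⟨i, rfl⟩
    · exact absurd hy ha
    · exact absurd hy hb
    · simp [hx] at hy

/-- Among three lower or upper sets of a linear order, two are comparable. -/
theorem not_antichain_of_segments {α : Type*} [LinearOrder α] {t : ℕ} (ht : 3 ≤ t)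
    (e : AntichainP t ↪o Finset α)
    (he : ∀ p, IsLowerSet (e p : Set α) ∨ IsUpperSet (e p : Set α)) : False := by
  have hne : ∀ p q : AntichainP t, p ≠ q → ¬(e p : Set α) ⊆ e q := fun p q hpq h =>
    hpq (e.le_iff_le.1 (coe_subset.1 h))
  have hlow : ∀ p q : AntichainP t, p ≠ q → IsLowerSet (e p : Set α) →
      ¬IsLowerSet (e q : Set α) := fun p q hpq hp hq =>
    (hp.total hq).elim (hne p q hpq) (hne q p hpq.symm)
  have hupp : ∀ p q : AntichainP t, p ≠ q → IsUpperSet (e p : Set α) →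
      ¬IsUpperSet (e q : Set α) := fun p q hpq hp hq =>
    (hp.total hq).elim (hne p q hpq) (hne q p hpq.symm)
  let p (i : Fin 3) : AntichainP t := Fin.castLE ht i
  have hp : Function.Injective p := Fin.castLE_injective ht
  have h01 : p 0 ≠ p 1 := hp.ne (by decide)
  have h02 : p 0 ≠ p 2 := hp.ne (by decide)
  have h12 : p 1 ≠ p 2 := hp.ne (by decide)
  rcases he (p 0) with h0 | h0 <;> rcases he (p 1) with h1 | h1 <;> rcases he (p 2) with h2 | h2
  · exact hlow _ _ h01 h0 h1
  · exact hlow _ _ h01 h0 h1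
  · exact hlow _ _ h02 h0 h2
  · exact hupp _ _ h12 h1 h2
  · exact hlow _ _ h12 h1 h2
  · exact hupp _ _ h02 h0 h2
  · exact hupp _ _ h01 h0 h1
  · exact hupp _ _ h01 h0 h1

/-- The double logarithmic hypothesis in terms of natural numbers. -/
theorem two_pow_two_pow_le_of_le_logb_logb {n t : ℕ} (ht0 : 0 < t)
    (ht : (t : ℝ) ≤ Real.logb 2 (Real.logb 2 (n : ℝ))) : 2 ^ 2 ^ t ≤ n := by
  have hn : 1 < n := by
    by_contra! h
    interval_cases n <;> simp at ht <;> omega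
  have hn' : (1 : ℝ) < n := by exact_mod_cast hn
  rw [Real.le_logb_iff_rpow_le one_lt_two (Real.logb_pos one_lt_two hn'),
    Real.le_logb_iff_rpow_le one_lt_two (by linarith), Real.rpow_natCast] at ht
  have h2 : ((2 : ℝ) ^ t) = ((2 ^ t : ℕ) : ℝ) := by push_cast; rfl
  rw [h2, Real.rpow_natCast] at ht
  exact_mod_cast ht

/-- For all integers `n` and `t` with `3 ≤ t ≤ log log n` (log base 2),
`R(A_t, Q_n) = n + 3`. -/
theorem antichain_ramsey (n t : ℕ) (h3 : 3 ≤ t)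
    (ht : (t : ℝ) ≤ Real.logb 2 (Real.logb 2 (n : ℝ))) :
    posetRamsey (AntichainP t) (Finset (Fin n)) = n + 3 := by
  obtain ⟨k, rfl⟩ : ∃ k, t = k + 1 := ⟨t - 1, by omega⟩
  have h1 : 2 ^ 2 ^ (k + 1) ≤ n := two_pow_two_pow_le_of_le_logb_logb k.succ_pos ht
  have h2 : 2 ^ 2 ^ k ≤ 2 ^ 2 ^ (k + 1) :=
    Nat.pow_le_pow_right two_pos (Nat.pow_le_pow_right two_pos k.le_succ)
  have hupper := fun c => blue_antichain_or_red_cube (n := n) (k := k) (by omega) c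
  refine le_antisymm (Nat.sInf_le hupper) (le_csInf ⟨n + 3, hupper⟩ ?_)
  intro N hN
  by_contra! hlt
  classical
  have hle : N ≤ n + 2 := by omega
  let ι : Finset (Fin N) ↪o Finset (Fin (n + 2)) := mapEmbedding (Fin.castLEEmb hle)
  rcases hN fun Z => decide (IsLowerSet (ι Z : Set (Fin (n + 2))) ∨
    IsUpperSet (ι Z : Set (Fin (n + 2)))) with ⟨e, he⟩ | ⟨e, he⟩
  · exact not_antichain_of_segments h3 (e.trans ι) fun p => by simpa using he p
  · obtain ⟨A, hA⟩ := exists_mem_eq_segment (e.trans ι)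
    exact of_decide_eq_false (he A) hA
end

section
/- Let n, t_1, t_2 be positive integers with t_1 ≥ t_2. Then R(C_{t_1,t_2}, Q_n) = n + t_1 + 1. -/
open Finset

/-- Given a coloring of `α × ℕ`, either some monotone `l : α → ℕ` bounded by `k` has a red graph,
or there is a monotone sequence `X` in `α` such that `(X i, i)` is blue for all `i ≤ k`. -/
theorem exists_monotone_red_or_blue {α : Type*} [Preorder α] (c : α → ℕ → Bool) (k : ℕ) :
    (∃ l : α → ℕ, Monotone l ∧ ∀ S, l S ≤ k ∧ c S (l S) = false) ∨
    (∃ X : ℕ → α, Monotone X ∧ ∀ i ≤ k, c (X i) i = true) := by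
  classical
  let reach (S : α) (m : ℕ) : Prop := ∃ X : ℕ → α, Monotone X ∧ ∀ i < m, X i ≤ S ∧ c (X i) i = true
  have reach_zero (S : α) : reach S 0 := ⟨fun _ => S, monotone_const, by simp⟩
  by_cases hk : ∃ S, reach S (k + 1)
  · obtain ⟨S, X, hX, hc⟩ := hk
    exact Or.inr ⟨X, hX, fun i hi => (hc i (by omega)).2⟩
  push Not at hk
  have hl (S : α) : reach S (Nat.findGreatest (reach S) k) :=
    Nat.findGreatest_spec (Nat.zero_le k) (reach_zero S)
  refine Or.inl ⟨fun S => Nat.findGreatest (reach S) k, fun S T hST => ?_, fun S =>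
    ⟨Nat.findGreatest_le k, ?_⟩⟩
  · refine Nat.le_findGreatest (Nat.findGreatest_le k) ?_
    obtain ⟨X, hX, hc⟩ := hl S
    exact ⟨X, hX, fun i hi => ⟨(hc i hi).1.trans hST, (hc i hi).2⟩⟩
  · by_contra hblue
    rw [Bool.not_eq_false] at hblue
    obtain ⟨X, hX, hc⟩ := hl S
    dsimp only at hblue
    generalize hm : Nat.findGreatest (reach S) k = m at *
    have hmk : m ≤ k := hm ▸ Nat.findGreatest_le k
    have hsucc : reach S (m + 1) := by
      refine ⟨fun i => if i < m then X i else S, fun i j hij => ?_, fun i hi => ?_⟩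
      · dsimp only
        split_ifs with h₁ h₂ h₂
        · exact hX hij
        · exact (hc i h₁).1
        · omega
        · exact le_rfl
      · dsimp only
        split_ifs with h₁
        · exact hc i h₁
        · obtain rfl : i = m := by omega
          exact ⟨le_rfl, hblue⟩
    rcases hmk.lt_or_eq with hlt | rfl
    · have := Nat.le_findGreatest (P := reach S) hlt hsucc
      omega
    · exact hk S hsucc

/-- The union of a subset of the first `n` and a subset of the last `k` elements of `Fin (n + k)`. -/
def joinFinset {n k : ℕ} (S : Finset (Fin n)) (T : Finset (Fin k)) : Finset (Fin (n + k)) :=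
  (S.disjSum T).map finSumFinEquiv.toEmbedding

theorem joinFinset_le_iff {n k : ℕ} {S S' : Finset (Fin n)} {T T' : Finset (Fin k)} :
    joinFinset S T ≤ joinFinset S' T' ↔ S ≤ S' ∧ T ≤ T' := by
  simp only [joinFinset, Finset.map_subset_map]
  simp [Finset.subset_iff]

/-- For every increasing sequence `Y` of subsets of the last `k` coordinates, a coloring without a
red copy of `Q_n` has a blue chain whose traces on these coordinates are `Y 0, …, Y k`. -/
theorem exists_red_copy_or_blue_chain {n k : ℕ} (c : Finset (Fin (n + k)) → Bool)
    {Y : ℕ → Finset (Fin k)} (hY : Monotone Y) :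
    (∃ e : Finset (Fin n) ↪o Finset (Fin (n + k)), ∀ q, c (e q) = false) ∨
    (∃ X : ℕ → Finset (Fin n), Monotone X ∧ ∀ i ≤ k, c (joinFinset (X i) (Y i)) = true) := by
  refine (exists_monotone_red_or_blue (fun S i => c (joinFinset S (Y i))) k).imp_left ?_
  rintro ⟨l, hl, hc⟩
  refine ⟨OrderEmbedding.ofMapLEIff (fun S => joinFinset S (Y (l S))) fun S T => ?_,
    fun S => (hc S).2⟩
  rw [joinFinset_le_iff]
  exact ⟨And.left, fun hST => ⟨hST, hY (hl hST)⟩⟩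

theorem le_sub_of_strictMono_card_mem_Ico {m N a b : ℕ} {f : Fin m → Finset (Fin N)}
    (hf : StrictMono f) (hab : ∀ i, #(f i) ∈ Finset.Ico a b) : m ≤ b - a := by
  have hcard : StrictMono fun i => #(f i) := fun i j hij => Finset.card_lt_card (hf hij)
  simpa using Finset.card_le_card_of_injOn (s := Finset.univ) (t := Finset.Ico a b)
    (fun i => #(f i)) (fun i _ => hab i) hcard.injective.injOn

/-- Every coloring of `Q_{n+t₁+1}` has a blue `C_{t₁,t₂}` or a red `Q_n`. -/
theorem exists_blue_chain_pair_or_red_copy {n t₁ t₂ : ℕ} (h : t₂ ≤ t₁)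
    (c : Finset (Fin (n + (t₁ + 1))) → Bool) :
    (∃ e : Fin t₁ ⊕ Fin t₂ ↪o Finset (Fin (n + (t₁ + 1))), ∀ p, c (e p) = true) ∨
    (∃ e : Finset (Fin n) ↪o Finset (Fin (n + (t₁ + 1))), ∀ q, c (e q) = false) := by
  let low (i : ℕ) : Finset (Fin (t₁ + 1)) := Finset.univ.filter fun y => y.val < i
  let high (i : ℕ) : Finset (Fin (t₁ + 1)) := Finset.univ.filter fun y => t₁ + 1 ≤ i + y.val
  have mem_low (i : ℕ) (y) : y ∈ low i ↔ y.val < i := by simp [low]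
  have mem_high (i : ℕ) (y) : y ∈ high i ↔ t₁ + 1 ≤ i + y.val := by simp [high]
  have hlow : Monotone low := fun i j hij y hy => by rw [mem_low] at *; omega
  have hhigh : Monotone high := fun i j hij y hy => by rw [mem_high] at *; omega
  rcases exists_red_copy_or_blue_chain c hlow with hred | ⟨A, hA, hAc⟩
  · exact Or.inr hred
  rcases exists_red_copy_or_blue_chain c hhigh with hred | ⟨B, hB, hBc⟩
  · exact Or.inr hred
  left
  refine ⟨OrderEmbedding.ofMapLEIff
    (Sum.elim (fun i => joinFinset (A (i + 1)) (low (i + 1)))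
      fun j => joinFinset (B (j + 1)) (high (j + 1))) ?_, ?_⟩
  · rintro (i | i) (j | j)
    · simp only [Sum.elim_inl, joinFinset_le_iff, Sum.inl_le_inl_iff]
      refine ⟨fun hij => ?_, fun hij => ⟨hA (by simpa using hij), hlow (by simpa using hij)⟩⟩
      have := hij.2 ((mem_low _ ⟨i, by omega⟩).2 (Nat.lt_succ_self _))
      rw [mem_low] at this
      exact Fin.le_def.2 (Nat.lt_succ_iff.1 this)
    · simp only [Sum.elim_inl, Sum.elim_inr, joinFinset_le_iff, Sum.not_inl_le_inr, iff_false]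
      intro hij
      have := hij.2 ((mem_low _ ⟨0, by omega⟩).2 (Nat.succ_pos _))
      rw [mem_high] at this
      simp only at this
      omega
    · simp only [Sum.elim_inl, Sum.elim_inr, joinFinset_le_iff, Sum.not_inr_le_inl, iff_false]
      intro hij
      have := hij.2 ((mem_high _ ⟨t₁, by omega⟩).2 (by simp only; omega))
      rw [mem_low] at this
      simp only at this
      omega
    · simp only [Sum.elim_inr, joinFinset_le_iff, Sum.inr_le_inr_iff]
      refine ⟨fun hij => ?_, fun hij => ⟨hB (by simpa using hij), hhigh (by simpa using hij)⟩⟩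
      have := hij.2 ((mem_high _ ⟨t₁ - i, by omega⟩).2 (by simp only; omega))
      rw [mem_high] at this
      simp only at this
      exact Fin.le_def.2 (by omega)
  · rintro (i | j)
    · exact hAc _ (by omega)
    · exact hBc _ (by omega)

/-- If `N ≤ n + t₁`, coloring `univ` and the sets of size less than `t₁` blue avoids a blue
`C_{t₁,t₂}` and a red `Q_n`. -/
theorem exists_coloring_avoiding {n t₁ t₂ N : ℕ} (ht₂ : 0 < t₂) (h : t₂ ≤ t₁) (hN : N ≤ n + t₁) :
    ∃ c : Finset (Fin N) → Bool,
      (¬∃ e : Fin t₁ ⊕ Fin t₂ ↪o Finset (Fin N), ∀ p, c (e p) = true) ∧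
      ¬∃ e : Finset (Fin n) ↪o Finset (Fin N), ∀ q, c (e q) = false := by
  refine ⟨fun S => decide (#S < t₁ ∨ S = Finset.univ), ?_, ?_⟩
  · rintro ⟨e, he⟩
    have hmono : StrictMono fun i => e (Sum.inl i) := fun i j hij =>
      e.strictMono (Sum.inl_lt_inl_iff.2 hij)
    have := le_sub_of_strictMono_card_mem_Ico (a := 1) (b := t₁) hmono fun i => by
      have hle : ¬e (Sum.inl i) ≤ e (Sum.inr ⟨0, ht₂⟩) := by simp
      have hge : ¬e (Sum.inr ⟨0, ht₂⟩) ≤ e (Sum.inl i) := by simp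
      have hne : (e (Sum.inl i)).Nonempty := by
        rw [Finset.nonempty_iff_ne_empty]
        intro h₀
        exact hle (h₀ ▸ Finset.empty_subset _)
      have hi := of_decide_eq_true (he (Sum.inl i))
      rw [Finset.mem_Ico]
      exact ⟨hne.card_pos, hi.resolve_right fun h₁ => hge (h₁ ▸ Finset.subset_univ _)⟩
    omega
  · rintro ⟨e, he⟩
    let low (i : Fin (n + 1)) : Finset (Fin n) := Finset.univ.filter fun y => y.val < i.val
    have hlow : StrictMono low := by
      intro i j hij
      rw [Fin.lt_def] at hij
      refine Finset.ssubset_iff_of_subset (fun y hy => ?_) |>.2 ⟨⟨i, by omega⟩, ?_, ?_⟩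
      · simp only [low, Finset.mem_filter_univ] at *
        omega
      · simpa [low] using hij
      · simp [low]
    have := le_sub_of_strictMono_card_mem_Ico (a := t₁) (b := N) (e.strictMono.comp hlow)
      fun i => by
        have hi := of_decide_eq_false (he (low i))
        push Not at hi
        rw [Finset.mem_Ico]
        refine ⟨hi.1, ?_⟩
        simpa using Finset.card_lt_univ_of_notMem
          (Classical.choose_spec (not_forall.1 (mt Finset.eq_univ_iff_forall.2 hi.2)))
    omega


/-- For positive integers `n, t₁, t₂` with `t₁ ≥ t₂`,
`R(C_{t₁,t₂}, Q_n) = n + t₁ + 1`, where `C_{t₁,t₂}` is the parallel composition of two chains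
(modelled as `Fin t₁ ⊕ Fin t₂` with the disjoint-sum order). -/
theorem chain_pair_ramsey (n t₁ t₂ : ℕ) (hn : 0 < n) (ht₂ : 0 < t₂) (h : t₂ ≤ t₁) :
    posetRamsey (Fin t₁ ⊕ Fin t₂) (Finset (Fin n)) = n + t₁ + 1 := by
  have hmem : n + t₁ + 1 ∈ {N : ℕ | ∀ c : Finset (Fin N) → Bool,
      (∃ e : Fin t₁ ⊕ Fin t₂ ↪o Finset (Fin N), ∀ p, c (e p) = true) ∨
      (∃ e : Finset (Fin n) ↪o Finset (Fin N), ∀ q, c (e q) = false)} :=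
    exists_blue_chain_pair_or_red_copy h
  refine le_antisymm (Nat.sInf_le hmem) (le_csInf ⟨_, hmem⟩ fun N hN => ?_)
  by_contra! hlt
  obtain ⟨c, hblue, hred⟩ := exists_coloring_avoiding (n := n) ht₂ h (N := N) (by omega)
  exact (hN c).elim hblue hred
end

section
/- Let n, t_1, t_2, t_3 be positive integers with t_1 ≥ t_2 ≥ t_3. Then R(C_{t_1,t_2,t_3}, Q_n) = n + t_1 + 1 if t_1 > t_2 + 1, and R(C_{t_1,t_2,t_3}, Q_n) = n + t_1 + 2 if t_1 ≤ t_2 + 1. -/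
open Finset

/-- The property defining `posetRamsey`: every coloring of the Boolean lattice of dimension `N`
contains a blue copy of `P` or a red copy of `Q`. -/
def IsRamseyDim (P Q : Type*) [PartialOrder P] [PartialOrder Q] (N : ℕ) : Prop :=
  ∀ c : Finset (Fin N) → Bool,
    (∃ e : P ↪o Finset (Fin N), ∀ p, c (e p) = true) ∨
    (∃ e : Q ↪o Finset (Fin N), ∀ q, c (e q) = false)

section General

variable {P Q : Type*} [PartialOrder P] [PartialOrder Q]

theorem IsRamseyDim.mono {M N : ℕ} (h : IsRamseyDim P Q M) (hMN : M ≤ N) :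
    IsRamseyDim P Q N := by
  intro c
  let g : Finset (Fin M) ↪o Finset (Fin N) := Finset.mapEmbedding (Fin.castLEEmb hMN)
  rcases h (fun A => c (g A)) with ⟨e, he⟩ | ⟨e, he⟩
  · exact Or.inl ⟨e.trans g, he⟩
  · exact Or.inr ⟨e.trans g, he⟩

theorem posetRamsey_eq_succ {N : ℕ} (h : IsRamseyDim P Q (N + 1)) (h' : ¬ IsRamseyDim P Q N) :
    posetRamsey P Q = N + 1 := by
  apply le_antisymm
  · exact Nat.sInf_le h
  · refine le_csInf ⟨N + 1, h⟩ fun M hM => ?_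
    by_contra! hlt
    exact h' (IsRamseyDim.mono (M := M) hM (by omega))

end General

section ChainLemma

/-- Either some weakly increasing choice of levels avoids the blue pairs, or there is a weakly
increasing sequence of sets that is blue at every level up to `k`. -/
theorem exists_monotone_avoiding_or_chain {α : Type*} (d : Finset α → ℕ → Prop) (k : ℕ) :
    (∃ f : Finset α → ℕ, Monotone f ∧ ∀ A, ¬ d A (f A)) ∨
    (∃ X : ℕ → Finset α, Monotone X ∧ ∀ i ≤ k, d (X i) i) := by
  classical
  by_cases hX : ∃ X : ℕ → Finset α, Monotone X ∧ ∀ i ≤ k, d (X i) i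
  · exact Or.inr hX
  left
  let R : Finset α → ℕ → Prop := fun A i =>
    ¬ ∃ X : ℕ → Finset α, Monotone X ∧ ∀ j ≤ i, X j ⊆ A ∧ d (X j) j
  have hR : ∀ A, ∃ i, R A i := fun A =>
    ⟨k, fun ⟨X, hm, h⟩ => hX ⟨X, hm, fun i hi => (h i hi).2⟩⟩
  refine ⟨fun A => Nat.find (hR A), ?_, ?_⟩
  · intro A B hAB
    refine Nat.find_min' _ ?_
    rintro ⟨X, hm, h⟩
    exact Nat.find_spec (hR B) ⟨X, hm, fun j hj => ⟨(h j hj).1.trans hAB, (h j hj).2⟩⟩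
  · intro A hd
    change d A (Nat.find (hR A)) at hd
    have hspec := Nat.find_spec (hR A)
    have hmin := fun m => Nat.find_min (hR A) (m := m)
    generalize Nat.find (hR A) = i at hd hspec hmin
    apply hspec
    rcases i with _ | i
    · refine ⟨fun _ => A, monotone_const, fun j hj => ?_⟩
      obtain rfl : j = 0 := by omega
      exact ⟨subset_rfl, hd⟩
    · obtain ⟨X, hm, h⟩ := not_not.mp (hmin i (by omega))
      refine ⟨fun j => if j ≤ i then X j else A, ?_, ?_⟩
      · intro a b hab
        by_cases hb : b ≤ i
        · simpa [hb, hab.trans hb] using hm hab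
        · by_cases ha : a ≤ i
          · simpa [hb, ha] using (h a ha).1
          · simp [hb, ha]
      · intro j hj
        by_cases hji : j ≤ i
        · simpa [hji] using h j hji
        · obtain rfl : j = i + 1 := by omega
          simpa using hd

variable {n k : ℕ}

/-- The set `A` of the first `n` points together with those of the last `k` points whose
position is less than `i`. -/
def levelSet (p : Fin k → ℕ) (A : Finset (Fin n)) (i : ℕ) : Finset (Fin (n + k)) :=
  univ.filter fun x => Sum.elim (fun a => decide (a ∈ A)) (fun j => decide (p j < i)) (finSumFinEquiv.symm x)

@[simp]
theorem castAdd_mem_levelSet {p : Fin k → ℕ} {A : Finset (Fin n)} {i : ℕ} {a : Fin n} :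
    Fin.castAdd k a ∈ levelSet p A i ↔ a ∈ A := by
  simp [levelSet]

@[simp]
theorem natAdd_mem_levelSet {p : Fin k → ℕ} {A : Finset (Fin n)} {i : ℕ} {j : Fin k} :
    Fin.natAdd n j ∈ levelSet p A i ↔ p j < i := by
  simp [levelSet]

theorem levelSet_mono {p : Fin k → ℕ} {A B : Finset (Fin n)} {i j : ℕ}
    (hAB : A ⊆ B) (hij : i ≤ j) : levelSet p A i ⊆ levelSet p B j := by
  intro x
  refine Fin.addCases (fun a => ?_) (fun b => ?_) x
  · simpa using @hAB a
  · simpa using fun h => lt_of_lt_of_le h hij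

/-- A coloring without a red copy of the Boolean lattice of dimension `n` has, for each ordering
of the last `k` points, a blue chain collecting these points in that order. -/
theorem exists_blue_chain (c : Finset (Fin (n + k)) → Bool)
    (hc : ¬ ∃ e : Finset (Fin n) ↪o Finset (Fin (n + k)), ∀ q, c (e q) = false)
    (σ : Equiv.Perm (Fin k)) :
    ∃ B : ℕ → Finset (Fin (n + k)), StrictMonoOn B (Set.Iic k) ∧ (∀ i ≤ k, c (B i) = true) ∧
      ∀ i j, Fin.natAdd n j ∈ B i ↔ (σ j : ℕ) < i := by
  let p : Fin k → ℕ := fun j => σ j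
  rcases exists_monotone_avoiding_or_chain (fun A i => c (levelSet p A i) = true) k with
    ⟨f, hf, hred⟩ | ⟨X, hX, hblue⟩
  · refine absurd ⟨OrderEmbedding.ofMapLEIff (fun A => levelSet p A (f A)) fun A B => ?_, ?_⟩ hc
    · refine ⟨fun h a ha => ?_, fun h => levelSet_mono h (hf h)⟩
      simpa using h (castAdd_mem_levelSet.2 ha)
    · intro q
      simpa using hred q
  · refine ⟨fun i => levelSet p (X i) i, ?_, hblue, fun i j => natAdd_mem_levelSet⟩
    intro i hi j hj hij
    refine lt_of_le_of_ne (levelSet_mono (hX hij.le) hij.le) fun h => ?_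
    have hik : i < k := lt_of_lt_of_le hij hj
    have h' : Fin.natAdd n (σ.symm ⟨i, hik⟩) ∈ levelSet p (X j) j := by simpa [p] using hij
    have h'' : Fin.natAdd n (σ.symm ⟨i, hik⟩) ∈ levelSet p (X i) i := by
      simpa only [← h] using h'
    simp [p] at h''

end ChainLemma

section Upper

theorem exists_triple_embedding {α : Type*} {t₁ t₂ t₃ : ℕ} (c : Finset α → Bool)
    (f₁ : Fin t₁ → Finset α) (f₂ : Fin t₂ → Finset α) (f₃ : Fin t₃ → Finset α)
    (h₁ : StrictMono f₁) (h₂ : StrictMono f₂) (h₃ : StrictMono f₃)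
    (c₁ : ∀ i, c (f₁ i) = true) (c₂ : ∀ i, c (f₂ i) = true) (c₃ : ∀ i, c (f₃ i) = true)
    (h₁₂ : ∀ i j, ¬ f₁ i ⊆ f₂ j) (h₂₁ : ∀ i j, ¬ f₂ i ⊆ f₁ j)
    (h₁₃ : ∀ i j, ¬ f₁ i ⊆ f₃ j) (h₃₁ : ∀ i j, ¬ f₃ i ⊆ f₁ j)
    (h₂₃ : ∀ i j, ¬ f₂ i ⊆ f₃ j) (h₃₂ : ∀ i j, ¬ f₃ i ⊆ f₂ j) :
    ∃ e : Fin t₁ ⊕ Fin t₂ ⊕ Fin t₃ ↪o Finset α, ∀ p, c (e p) = true := by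
  refine ⟨OrderEmbedding.ofMapLEIff (Sum.elim f₁ (Sum.elim f₂ f₃)) ?_, ?_⟩
  · rintro (i | i | i) (j | j | j) <;>
      simp [h₁.le_iff_le, h₂.le_iff_le, h₃.le_iff_le, *]
  · rintro (i | i | i) <;> simp [*]

theorem isRamseyDim_add_two {n t₁ t₂ t₃ : ℕ} (h₁ : 0 < t₁) (h₂ : t₂ ≤ t₁) (h₃ : t₃ ≤ t₁) :
    IsRamseyDim (Fin t₁ ⊕ Fin t₂ ⊕ Fin t₃) (Finset (Fin n)) (n + (t₁ + 2)) := by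
  intro c
  refine or_iff_not_imp_right.2 fun hc => ?_
  let x : Fin (t₁ + 2) := ⟨0, by omega⟩
  let y : Fin (t₁ + 2) := ⟨t₁, by omega⟩
  let z : Fin (t₁ + 2) := ⟨t₁ + 1, by omega⟩
  have hxy : x ≠ y := by simp [x, y, Fin.ext_iff]; omega
  have hxz : x ≠ z := by simp [x, z, Fin.ext_iff]
  have hyz : y ≠ z := by simp [y, z, Fin.ext_iff]
  obtain ⟨A, hA, cA, mA⟩ := exists_blue_chain c hc (Equiv.refl _)
  obtain ⟨B, hB, cB, mB⟩ := exists_blue_chain c hc (Equiv.swap x y)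
  obtain ⟨C, hC, cC, mC⟩ := exists_blue_chain c hc (Equiv.swap x z)
  have sep : ∀ (w : Fin (t₁ + 2)) {S T : Finset (Fin (n + (t₁ + 2)))},
      Fin.natAdd n w ∈ S → Fin.natAdd n w ∉ T → ¬ S ⊆ T := fun w S T hS hT h => hT (h hS)
  refine exists_triple_embedding c (fun i => A (i + 1)) (fun i => B (i + 1)) (fun i => C (i + 1))
    ?_ ?_ ?_ ?_ ?_ ?_ ?_ ?_ ?_ ?_ ?_ ?_
  · exact fun i j h => hA (by simp; omega) (by simp; omega) (by simpa using h)
  · exact fun i j h => hB (by simp; omega) (by simp; omega) (by simpa using h)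
  · exact fun i j h => hC (by simp; omega) (by simp; omega) (by simpa using h)
  · exact fun i => cA _ (by omega)
  · exact fun i => cB _ (by omega)
  · exact fun i => cC _ (by omega)
  · exact fun i j => sep x (by rw [mA]; simp [x]) (by rw [mB]; simp [y]; omega)
  · exact fun i j => sep y (by rw [mB]; simp [x]) (by rw [mA]; simp [y])
  · exact fun i j => sep x (by rw [mA]; simp [x]) (by rw [mC]; simp [z]; omega)
  · exact fun i j => sep z (by rw [mC]; simp [x]) (by rw [mA]; simp [z])
  · exact fun i j => sep y (by rw [mB]; simp [x])
      (by rw [mC]; simp [Equiv.swap_apply_of_ne_of_ne hxy.symm hyz, y]; omega)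
  · exact fun i j => sep z (by rw [mC]; simp [x])
      (by rw [mB]; simp [Equiv.swap_apply_of_ne_of_ne hxz.symm hyz.symm, z]; omega)

theorem isRamseyDim_add_one {n t₁ t₂ t₃ : ℕ} (h₁ : 3 ≤ t₁) (h₂ : t₂ + 2 ≤ t₁)
    (h₃ : t₃ + 2 ≤ t₁) :
    IsRamseyDim (Fin t₁ ⊕ Fin t₂ ⊕ Fin t₃) (Finset (Fin n)) (n + (t₁ + 1)) := by
  intro c
  refine or_iff_not_imp_right.2 fun hc => ?_
  let x : Fin (t₁ + 1) := ⟨0, by omega⟩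
  let z : Fin (t₁ + 1) := ⟨t₁, by omega⟩
  let a : Fin (t₁ + 1) := ⟨1, by omega⟩
  let b : Fin (t₁ + 1) := ⟨t₁ - 1, by omega⟩
  have hax : a ≠ x := by simp [a, x, Fin.ext_iff]
  have haz : a ≠ z := by simp [a, z, Fin.ext_iff]; omega
  have hbx : b ≠ x := by simp [b, x, Fin.ext_iff]; omega
  have hbz : b ≠ z := by simp [b, z, Fin.ext_iff]; omega
  have hx : Equiv.swap a b x = x := Equiv.swap_apply_of_ne_of_ne hax.symm hbx.symm
  have hz : Equiv.swap a b z = z := Equiv.swap_apply_of_ne_of_ne haz.symm hbz.symm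
  have ha : Equiv.swap x z a = a := Equiv.swap_apply_of_ne_of_ne hax haz
  have hb : Equiv.swap x z b = b := Equiv.swap_apply_of_ne_of_ne hbx hbz
  obtain ⟨A, hA, cA, mA⟩ := exists_blue_chain c hc (Equiv.refl _)
  obtain ⟨B, hB, cB, mB⟩ := exists_blue_chain c hc (Equiv.swap x z)
  obtain ⟨C, hC, cC, mC⟩ := exists_blue_chain c hc (Equiv.swap x z * Equiv.swap a b)
  have sep : ∀ (w : Fin (t₁ + 1)) {S T : Finset (Fin (n + (t₁ + 1)))},
      Fin.natAdd n w ∈ S → Fin.natAdd n w ∉ T → ¬ S ⊆ T := fun w S T hS hT h => hT (h hS)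
  refine exists_triple_embedding c (fun i => A (i + 1)) (fun i => B (i + 2)) (fun i => C (i + 2))
    ?_ ?_ ?_ ?_ ?_ ?_ ?_ ?_ ?_ ?_ ?_ ?_
  · exact fun i j h => hA (by simp) (by simp) (by simpa using h)
  · exact fun i j h => hB (by simp; omega) (by simp; omega) (by simpa using h)
  · exact fun i j h => hC (by simp; omega) (by simp; omega) (by simpa using h)
  · exact fun i => cA _ (by omega)
  · exact fun i => cB _ (by omega)
  · exact fun i => cC _ (by omega)
  · exact fun i j => sep x (by rw [mA]; simp [x]) (by rw [mB]; simp [z]; omega)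
  · exact fun i j => sep z (by rw [mB]; simp [x]) (by rw [mA]; simp [z])
  · exact fun i j => sep x (by rw [mA]; simp [x]) (by rw [mC]; simp [hx, z]; omega)
  · exact fun i j => sep z (by rw [mC]; simp [hz, x]) (by rw [mA]; simp [z])
  · exact fun i j => sep a (by rw [mB]; simp [ha, a]) (by rw [mC]; simp [hb, b]; omega)
  · exact fun i j => sep b (by rw [mC]; simp [ha, a]) (by rw [mB]; simp [hb, b]; omega)

end Upper

section Lower

/-- A strictly increasing sequence of `t` sets with sizes in `S` requires `t ≤ #S`. -/
theorem le_card_of_strictMono {α : Type*} {t : ℕ} {f : Fin t → Finset α} (hf : StrictMono f)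
    (S : Finset ℕ) (hS : ∀ i, #(f i) ∈ S) : t ≤ #S := by
  have h := Finset.card_le_card_of_injOn (s := univ) (t := S) (fun i => #(f i))
    (fun i _ => hS i) ((Finset.card_strictMono.comp hf).injective.injOn)
  simpa using h

/-- A copy of the Boolean lattice of dimension `n` cannot have its sizes in `n` values. -/
theorem lt_card_of_embedding {α : Type*} {n : ℕ} (e : Finset (Fin n) ↪o Finset α)
    (S : Finset ℕ) (hS : ∀ A, #(e A) ∈ S) : n < #S := by
  let g : Fin (n + 1) → Finset (Fin n) := fun i => univ.filter fun a => (a : ℕ) < i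
  have hg : StrictMono g := by
    intro i j hij
    refine Finset.ssubset_iff_subset_ne.2 ⟨fun a => ?_, fun h => ?_⟩
    · simp only [g, mem_filter_univ]
      exact fun h => h.trans hij
    · have hi : (i : ℕ) < n := by have := j.isLt; have : (i : ℕ) < j := hij; omega
      have : (⟨i, hi⟩ : Fin n) ∈ g j := by simpa [g] using hij
      rw [← h] at this
      simp [g] at this
  exact le_card_of_strictMono (e.strictMono.comp hg) S fun i => hS _

theorem subset_of_not_subset_coatom {α : Type*} [Fintype α] [DecidableEq α] {B P R : Finset α}
    (hB : #B + 1 = Fintype.card α) (hP : #P = 1) (hPB : ¬ P ⊆ B) (hRB : ¬ R ⊆ B) : P ⊆ R := by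
  obtain ⟨p, rfl⟩ := Finset.card_eq_one.1 hP
  have hc : #Bᶜ = 1 := by rw [Finset.card_compl]; omega
  obtain ⟨z, hz⟩ := Finset.card_eq_one.1 hc
  have mem : ∀ a, a ∉ B → a = z := fun a ha => by
    have := Finset.mem_compl.2 ha
    rwa [hz, Finset.mem_singleton] at this
  obtain ⟨r, hr, hrB⟩ := Finset.not_subset.1 hRB
  rw [Finset.singleton_subset_iff] at hPB ⊢
  rwa [mem p hPB, ← mem r hrB]

section Triple

variable {n t₁ t₂ t₃ N : ℕ} (e : Fin t₁ ⊕ Fin t₂ ⊕ Fin t₃ ↪o Finset (Fin N))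

theorem strictMono_first : StrictMono fun i => e (Sum.inl i) :=
  e.strictMono.comp Sum.inl_strictMono

theorem strictMono_second : StrictMono fun i => e (Sum.inr (Sum.inl i)) :=
  e.strictMono.comp (Sum.inr_strictMono.comp Sum.inl_strictMono)

theorem card_lt_of_incomparable {A B : Finset (Fin N)} (h : ¬ A ⊆ B) (h' : ¬ B ⊆ A) :
    0 < #A ∧ #A < N := by
  refine ⟨Finset.card_pos.2 ?_, ?_⟩
  · rw [Finset.nonempty_iff_ne_empty]
    rintro rfl
    simp at h
  · refine lt_of_le_of_ne (by simpa using Finset.card_le_univ A) fun hA => h' ?_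
    rw [(Finset.card_eq_iff_eq_univ A).1 (by simpa using hA)]
    exact Finset.subset_univ _

end Triple

theorem not_isRamseyDim_add {n t₁ t₂ t₃ : ℕ} (h₁ : 0 < t₁) (h₂ : 0 < t₂) :
    ¬ IsRamseyDim (Fin t₁ ⊕ Fin t₂ ⊕ Fin t₃) (Finset (Fin n)) (n + t₁) := by
  intro h
  rcases h fun A => decide (#A ∉ Finset.Ico t₁ (n + t₁)) with ⟨e, he⟩ | ⟨e, he⟩
  · have key := le_card_of_strictMono (strictMono_first e) (Finset.Ico 1 t₁) fun i => by
      have h_lt := card_lt_of_incomparable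
        (mt (e.le_iff_le (a := Sum.inl i) (b := Sum.inr (Sum.inl ⟨0, h₂⟩))).1 (by simp))
        (mt e.le_iff_le.1 (by simp))
      have h_blue := he (Sum.inl i)
      simp only [mem_Ico, decide_eq_true_eq] at h_blue ⊢
      omega
    simp at key
    omega
  · have key := lt_card_of_embedding e (Finset.Ico t₁ (n + t₁)) fun A => by simpa using he A
    simp at key

theorem not_isRamseyDim_add_one {n t₁ t₂ t₃ : ℕ} (hn : 0 < n) (h₁ : 2 ≤ t₁) (h₂ : t₁ ≤ t₂ + 1)
    (h₃ : 0 < t₃) :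
    ¬ IsRamseyDim (Fin t₁ ⊕ Fin t₂ ⊕ Fin t₃) (Finset (Fin n)) (n + t₁ + 1) := by
  intro h
  rcases h fun A => decide (#A ∉ Finset.Ico t₁ (n + t₁)) with ⟨e, he⟩ | ⟨e, he⟩
  · have hcard : ∀ p q, ¬ p ≤ q → ¬ q ≤ p → #(e p) ∈ insert (n + t₁) (Finset.Ico 1 t₁) := by
      intro p q hpq hqp
      have h_lt := card_lt_of_incomparable (mt e.le_iff_le.1 hpq) (mt e.le_iff_le.1 hqp)
      have h_blue := he p
      simp only [mem_insert, mem_Ico, decide_eq_true_eq] at h_blue ⊢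
      omega
    let r : Fin t₁ ⊕ Fin t₂ ⊕ Fin t₃ := Sum.inr (Sum.inr ⟨0, h₃⟩)
    have hfirst : ∀ i, #(e (Sum.inl i)) ∈ insert (n + t₁) (Finset.Ico 1 t₁) := fun i =>
      hcard _ r (by simp [r]) (by simp [r])
    have hsecond : ∀ i, #(e (Sum.inr (Sum.inl i))) ∈ insert (n + t₁) (Finset.Ico 1 t₁) :=
      fun i => hcard _ r (by simp [r]) (by simp [r])
    obtain ⟨i, hi⟩ : ∃ i, #(e (Sum.inl i)) = 1 := by
      by_contra! hne
      have key := le_card_of_strictMono (strictMono_first e) (insert (n + t₁) (Finset.Ico 2 t₁))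
        fun i => by
          have h_mem := hfirst i
          have h_ne := hne i
          simp only [mem_insert, mem_Ico] at h_mem ⊢
          omega
      have := key.trans (Finset.card_insert_le _ _)
      simp at this
      omega
    obtain ⟨j, hj⟩ : ∃ j, #(e (Sum.inl j)) = n + t₁ := by
      by_contra! hne
      have key := le_card_of_strictMono (strictMono_first e) (Finset.Ico 1 t₁)
        fun i => by
          have h_mem := hfirst i
          have h_ne := hne i
          simp only [mem_insert, mem_Ico] at h_mem ⊢
          omega
      simp at key
      omega
    obtain ⟨l, hl⟩ : ∃ l, #(e (Sum.inr (Sum.inl l))) = 1 ∨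
        #(e (Sum.inr (Sum.inl l))) = n + t₁ := by
      by_contra! hne
      have key := le_card_of_strictMono (strictMono_second e) (Finset.Ico 2 t₁)
        fun i => by
          have h_mem := hsecond i
          have h_ne := hne i
          simp only [mem_insert, mem_Ico] at h_mem ⊢
          omega
      simp at key
      omega
    rcases hl with hl | hl
    · have := subset_of_not_subset_coatom (B := e (Sum.inl j)) (R := e r) (by simp [hj]) hl
        (mt e.le_iff_le.1 (by simp)) (mt e.le_iff_le.1 (by simp [r]))
      simpa [r] using e.le_iff_le.1 this
    · have := subset_of_not_subset_coatom (B := (e (Sum.inl i))ᶜ)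
        (P := (e (Sum.inr (Sum.inl l)))ᶜ) (R := (e r)ᶜ)
        (by rw [Finset.card_compl, hi]; simp) (by rw [Finset.card_compl, hl]; simp)
        (by rw [Finset.compl_subset_compl]; exact mt e.le_iff_le.1 (by simp))
        (by rw [Finset.compl_subset_compl]; exact mt e.le_iff_le.1 (by simp [r]))
      rw [Finset.compl_subset_compl] at this
      simpa [r] using e.le_iff_le.1 this
  · have key := lt_card_of_embedding e (Finset.Ico t₁ (n + t₁)) fun A => by simpa using he A
    simp at key

/-- A copy of the Boolean lattice of dimension `n` in that of dimension `n + 2` which avoids the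
empty set and the full set is an interval between an atom and a coatom. -/
theorem exists_range_eq_Icc {n : ℕ} (e : Finset (Fin n) ↪o Finset (Fin (n + 2)))
    (h₀ : ∀ A, e A ≠ ∅) (h₁ : ∀ A, e A ≠ univ) :
    ∃ s z : Fin (n + 2), s ≠ z ∧ ∀ B, s ∈ B → z ∉ B → ∃ A, e A = B := by
  have hlt : ∀ A, 0 < #(e A) ∧ #(e A) < n + 2 := fun A =>
    ⟨Finset.card_pos.2 (Finset.nonempty_iff_ne_empty.2 (h₀ A)), by
      simpa using (Finset.card_lt_iff_ne_univ _).2 (h₁ A)⟩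
  have hbot : #(e ∅) = 1 := by
    by_contra hne
    have key := lt_card_of_embedding e (Finset.Ico 2 (n + 2)) fun A => by
      have := Finset.card_le_card (e.monotone (Finset.empty_subset A))
      have := hlt A
      have := hlt ∅
      rw [mem_Ico]
      omega
    simp at key
  have htop : #(e univ) = n + 1 := by
    by_contra hne
    have key := lt_card_of_embedding e (Finset.Ico 1 (n + 1)) fun A => by
      have := Finset.card_le_card (e.monotone (Finset.subset_univ A))
      have := hlt A
      have := hlt univ
      rw [mem_Ico]
      omega
    simp at key
  have hsub : e ∅ ⊆ e univ := e.monotone (Finset.subset_univ ∅)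
  have himage : univ.image e = Finset.Icc (e ∅) (e univ) := by
    refine Finset.eq_of_subset_of_card_le ?_ ?_
    · intro B hB
      obtain ⟨A, -, rfl⟩ := Finset.mem_image.1 hB
      exact Finset.mem_Icc.2
        ⟨e.monotone (Finset.empty_subset A), e.monotone (Finset.subset_univ A)⟩
    · rw [Finset.card_Icc_finset hsub, Finset.card_image_of_injective _ e.injective, hbot, htop]
      simp
  obtain ⟨s, hs⟩ := Finset.card_eq_one.1 hbot
  have hc : #(e univ)ᶜ = 1 := by rw [Finset.card_compl, htop]; simp
  obtain ⟨z, hz⟩ := Finset.card_eq_one.1 hc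
  have hz' : z ∉ e univ := by
    rw [← Finset.mem_compl, hz]
    exact Finset.mem_singleton_self z
  refine ⟨s, z, ?_, fun B hsB hzB => ?_⟩
  · rintro rfl
    exact hz' (hsub (by simp [hs]))
  · have hB : B ∈ univ.image e := by
      rw [himage, Finset.mem_Icc, hs]
      refine ⟨Finset.singleton_subset_iff.2 hsB, ?_⟩
      rw [← Finset.compl_subset_compl, hz]
      simpa using hzB
    simpa using hB

theorem not_isRamseyDim_antichain {n : ℕ} :
    ¬ IsRamseyDim (Fin 1 ⊕ Fin 1 ⊕ Fin 1) (Finset (Fin n)) (n + 2) := by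
  classical
  intro h
  rcases h fun A => decide (IsLowerSet (A : Set (Fin (n + 2))) ∨
    IsUpperSet (A : Set (Fin (n + 2)))) with ⟨e, he⟩ | ⟨e, he⟩
  · simp only [decide_eq_true_eq] at he
    have low : ∀ p q, ¬ p ≤ q → ¬ q ≤ p → IsLowerSet (e p : Set (Fin (n + 2))) →
        IsLowerSet (e q : Set (Fin (n + 2))) → False := fun p q hpq hqp hp hq => by
      rcases hp.total hq with h | h
      · exact hpq (e.le_iff_le.1 (Finset.coe_subset.1 h))
      · exact hqp (e.le_iff_le.1 (Finset.coe_subset.1 h))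
    have upp : ∀ p q, ¬ p ≤ q → ¬ q ≤ p → IsUpperSet (e p : Set (Fin (n + 2))) →
        IsUpperSet (e q : Set (Fin (n + 2))) → False := fun p q hpq hqp hp hq => by
      rcases hp.total hq with h | h
      · exact hpq (e.le_iff_le.1 (Finset.coe_subset.1 h))
      · exact hqp (e.le_iff_le.1 (Finset.coe_subset.1 h))
    let a : Fin 1 ⊕ Fin 1 ⊕ Fin 1 := Sum.inl 0
    let b : Fin 1 ⊕ Fin 1 ⊕ Fin 1 := Sum.inr (Sum.inl 0)
    let d : Fin 1 ⊕ Fin 1 ⊕ Fin 1 := Sum.inr (Sum.inr 0)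
    have lab := low a b (by simp [a, b]) (by simp [a, b])
    have lad := low a d (by simp [a, d]) (by simp [a, d])
    have lbd := low b d (by simp [b, d]) (by simp [b, d])
    have uab := upp a b (by simp [a, b]) (by simp [a, b])
    have uad := upp a d (by simp [a, d]) (by simp [a, d])
    have ubd := upp b d (by simp [b, d]) (by simp [b, d])
    have := he a
    have := he b
    have := he d
    tauto
  · simp only [decide_eq_false_iff_not, not_or] at he
    obtain ⟨s, z, hsz, hB⟩ := exists_range_eq_Icc e
      (fun A hA => (he A).1 (by simpa [hA] using isLowerSet_empty))
      (fun A hA => (he A).1 (by simpa [hA] using isLowerSet_univ))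
    rcases lt_or_gt_of_ne hsz with hlt | hlt
    · obtain ⟨A, hA⟩ := hB (Finset.Iic s) (by simp) (by simpa using hlt)
      exact (he A).1 (by simpa [hA] using isLowerSet_Iic s)
    · obtain ⟨A, hA⟩ := hB (Finset.Ici s) (by simp) (by simpa using hlt)
      exact (he A).2 (by simpa [hA] using isUpperSet_Ici s)

end Lower

/-- For positive integers `n, t₁, t₂, t₃` with `t₁ ≥ t₂ ≥ t₃`,
`R(C_{t₁,t₂,t₃}, Q_n) = n + t₁ + 1` if `t₁ > t₂ + 1`, and `= n + t₁ + 2` if `t₁ ≤ t₂ + 1`;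
here `C_{t₁,t₂,t₃}` is the parallel composition of three chains
(modelled as `Fin t₁ ⊕ Fin t₂ ⊕ Fin t₃` with the disjoint-sum order). -/
theorem chain_triple_ramsey (n t₁ t₂ t₃ : ℕ) (hn : 0 < n) (ht₃ : 0 < t₃)
    (h₂₁ : t₂ ≤ t₁) (h₃₂ : t₃ ≤ t₂) :
    (t₂ + 1 < t₁ →
      posetRamsey (Fin t₁ ⊕ Fin t₂ ⊕ Fin t₃) (Finset (Fin n)) = n + t₁ + 1) ∧
    (t₁ ≤ t₂ + 1 →
      posetRamsey (Fin t₁ ⊕ Fin t₂ ⊕ Fin t₃) (Finset (Fin n)) = n + t₁ + 2) := by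
  refine ⟨fun h => ?_, fun h => ?_⟩
  · exact posetRamsey_eq_succ (N := n + t₁) (isRamseyDim_add_one (by omega) (by omega) (by omega))
      (not_isRamseyDim_add (by omega) (by omega))
  · refine posetRamsey_eq_succ (N := n + t₁ + 1) (isRamseyDim_add_two (by omega) (by omega) (by omega)) ?_
    rcases Nat.lt_or_ge t₁ 2 with h₁ | h₁
    · obtain rfl : t₁ = 1 := by omega
      obtain rfl : t₂ = 1 := by omega
      obtain rfl : t₃ = 1 := by omega
      exact not_isRamseyDim_antichain
    · exact not_isRamseyDim_add_one hn h₁ h ht₃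
end

section
/- Let Ȧ be a colored antichain on at least 2 vertices that is not monochromatic. If Ȧ contains no three vertices of the same color, then for all sufficiently large n, R̃(Ȧ, Q_n) = n + 2; otherwise, for all sufficiently large n, R̃(Ȧ, Q_n) = n + 3. -/
open Finset

/-- The poset Erdős–Hajnal number `R̃(Ṗ, Q_n)` of a colored poset `(P, κ)`
(colors as `Bool`, `true` = blue, `false` = red): the least `N` such that every blue/red
coloring of the Boolean lattice `Q_N` contains a colored copy of `(P, κ)` or a
monochromatic copy of `Q_n`. -/
noncomputable def posetEH {P : Type*} [PartialOrder P] (κ : P → Bool) (n : ℕ) : ℕ :=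
  sInf {N : ℕ | ∀ c : Finset (Fin N) → Bool,
    (∃ e : P ↪o Finset (Fin N), ∀ p, c (e p) = κ p) ∨
    (∃ b : Bool, ∃ e : Finset (Fin n) ↪o Finset (Fin N), ∀ q, c (e q) = b)}

/-- **Dilworth's theorem** for finite sets: a finite set without antichains of more than `k`
elements is a union of `k` chains. -/
theorem exists_chain_cover {α : Type*} [PartialOrder α] (s : Finset α) (k : ℕ)
    (hs : ∀ A ⊆ s, IsAntichain (· ≤ ·) (A : Set α) → #A ≤ k) :
    ∃ f : α → ℕ, (∀ x ∈ s, f x < k) ∧ ∀ x ∈ s, ∀ y ∈ s, f x = f y → x ≤ y ∨ y ≤ x := by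
  classical
  induction hn : #s using Nat.strong_induction_on generalizing s k with
  | _ n ih =>
  subst hn
  rcases s.eq_empty_or_nonempty with rfl | hne
  · exact ⟨fun _ => 0, by simp, by simp⟩
  obtain ⟨m, hm⟩ := s.exists_maximal hne
  have hms : m ∈ s := hm.1
  have hk : 1 ≤ k := by
    have := hs {m} (by simpa using hms) (by simp)
    simpa using this
  -- a chain whose removal lowers the width completes the cover
  have extend : ∀ K ⊆ s, m ∈ K → (∀ x ∈ K, ∀ y ∈ K, x ≤ y ∨ y ≤ x) →
      (∀ B ⊆ s \ K, IsAntichain (· ≤ ·) (B : Set α) → #B ≠ k) →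
      ∃ f : α → ℕ, (∀ x ∈ s, f x < k) ∧ ∀ x ∈ s, ∀ y ∈ s, f x = f y → x ≤ y ∨ y ≤ x := by
    intro K hKs hmK hK hB
    obtain ⟨f, hf1, hf2⟩ := ih #(s \ K)
      (Finset.card_lt_card (Finset.sdiff_ssubset hKs ⟨m, hmK⟩)) (s \ K) (k - 1) (by
        intro A hA hanti
        by_contra! hlt
        obtain ⟨B, hBA, hBk⟩ := Finset.exists_subset_card_eq (show k ≤ #A by omega)
        exact hB B (hBA.trans hA) (hanti.subset (by exact_mod_cast hBA)) hBk) rfl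
    refine ⟨fun z => if z ∈ K then k - 1 else f z, ?_, ?_⟩
    · intro x hx
      by_cases hxK : x ∈ K
      · simp only [hxK, if_true]; omega
      · have := hf1 x (by simp [hx, hxK])
        simp only [hxK, if_false]; omega
    · intro x hx y hy hxy
      by_cases hxK : x ∈ K <;> by_cases hyK : y ∈ K <;>
        simp only [hxK, hyK, if_true, if_false] at hxy
      · exact hK x hxK y hyK
      · have := hf1 y (by simp [hy, hyK])
        omega
      · have := hf1 x (by simp [hx, hxK])
        omega
      · exact hf2 x (by simp [hx, hxK]) y (by simp [hy, hyK]) hxy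
  by_cases hex : ∃ B ⊆ s.erase m, IsAntichain (· ≤ ·) (B : Set α) ∧ #B = k
  · obtain ⟨B₀, hB₀, hB₀a, hB₀k⟩ := hex
    obtain ⟨f, hf1, hf2⟩ := ih #(s.erase m) (Finset.card_erase_lt_of_mem hms) (s.erase m) k
      (fun A hA => hs A (hA.trans (Finset.erase_subset _ _))) rfl
    have hit : ∀ B ⊆ s.erase m, IsAntichain (· ≤ ·) (B : Set α) → #B = k →
        ∀ i < k, ∃ b ∈ B, f b = i := by
      intro B hB hBa hBk i hi
      have hinj : Set.InjOn f B := by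
        intro x hx y hy hxy
        rcases hf2 x (hB hx) y (hB hy) hxy with h | h
        · exact hBa.eq hx hy h
        · exact (hBa.eq hy hx h).symm
      have himg : B.image f = Finset.range k := by
        apply Finset.eq_of_subset_of_card_le
        · intro j hj
          obtain ⟨b, hb, rfl⟩ := Finset.mem_image.1 hj
          exact Finset.mem_range.2 (hf1 b (hB hb))
        · rw [Finset.card_image_of_injOn hinj, Finset.card_range, hBk]
      have : i ∈ B.image f := by rw [himg]; exact Finset.mem_range.2 hi
      simpa using this
    let T : Finset α := {z ∈ s.erase m | ∃ B ⊆ s.erase m, IsAntichain (· ≤ ·) (B : Set α) ∧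
      #B = k ∧ z ∈ B}
    have hT : ∀ B ⊆ s.erase m, IsAntichain (· ≤ ·) (B : Set α) → #B = k → ∀ b ∈ B, b ∈ T :=
      fun B hB hBa hBk b hb => Finset.mem_filter.2 ⟨hB hb, B, hB, hBa, hBk, hb⟩
    have htop : ∀ i : Fin k, ∃ x ∈ T, f x = i ∧ ∀ y ∈ T, f y = i → y ≤ x := by
      intro i
      obtain ⟨b, hb, hbi⟩ := hit B₀ hB₀ hB₀a hB₀k i i.2
      obtain ⟨x, hx⟩ := (T.filter (f · = i)).exists_maximal
        ⟨b, Finset.mem_filter.2 ⟨hT B₀ hB₀ hB₀a hB₀k b hb, hbi⟩⟩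
      have hxT := Finset.mem_filter.1 hx.1
      refine ⟨x, hxT.1, hxT.2, fun y hy hyi => ?_⟩
      rcases hf2 x (Finset.mem_filter.1 hxT.1).1 y (Finset.mem_filter.1 hy).1
        (hxT.2.trans hyi.symm) with h | h
      · exact hx.2 (Finset.mem_filter.2 ⟨hy, hyi⟩) h
      · exact h
    choose x hxT hxf hxmax using htop
    have hxs : ∀ i, x i ∈ s.erase m := fun i => (Finset.mem_filter.1 (hxT i)).1
    have hxanti : ∀ i j, x i ≤ x j → i = j := by
      intro i j hij
      obtain ⟨-, B, hB, hBa, hBk, hjB⟩ := Finset.mem_filter.1 (hxT j)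
      obtain ⟨y, hyB, hyi⟩ := hit B hB hBa hBk i i.2
      have hyj : y = x j :=
        hBa.eq hyB hjB ((hxmax i y (hT B hB hBa hBk y hyB) hyi).trans hij)
      apply Fin.ext
      rw [← hyi, hyj, hxf j]
    have hbelow : ∃ i, x i ≤ m := by
      by_contra! hno
      have hno' : ∀ i, ¬ m ≤ x i := fun i h =>
        hno i (hm.2 (Finset.mem_of_mem_erase (hxs i)) h)
      have hmem : m ∉ Finset.univ.image x := by
        simp only [Finset.mem_image, not_exists, not_and]
        intro i _ h
        exact hno i h.le
      have hcard := hs (insert m (Finset.univ.image x)) (by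
        intro z hz
        rcases Finset.mem_insert.1 hz with rfl | hz
        · exact hms
        · obtain ⟨i, -, rfl⟩ := Finset.mem_image.1 hz
          exact Finset.mem_of_mem_erase (hxs i)) (by
        intro u hu v hv huv hle
        simp only [Finset.coe_insert, Finset.coe_image, Finset.coe_univ, Set.image_univ,
          Set.mem_insert_iff, Set.mem_range] at hu hv
        rcases hu with rfl | ⟨i, rfl⟩ <;> rcases hv with rfl | ⟨j, rfl⟩
        · exact huv rfl
        · exact hno' j hle
        · exact hno i hle
        · exact huv (congrArg x (hxanti i j hle)))
      rw [Finset.card_insert_of_notMem hmem,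
        Finset.card_image_of_injective _ (fun i j h => hxanti i j h.le)] at hcard
      simp at hcard
    obtain ⟨i, him⟩ := hbelow
    refine extend {z ∈ s | z = m ∨ z ∈ s.erase m ∧ f z = i ∧ z ≤ x i} (Finset.filter_subset _ _)
      (by simp [hms]) ?_ ?_
    · intro u hu v hv
      rcases (Finset.mem_filter.1 hu).2 with rfl | ⟨hus, hui, hux⟩ <;>
        rcases (Finset.mem_filter.1 hv).2 with rfl | ⟨hvs, hvi, hvx⟩
      · exact Or.inl le_rfl
      · exact Or.inr (hvx.trans him)
      · exact Or.inl (hux.trans him)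
      · exact hf2 u hus v hvs (hui.trans hvi.symm)
    · intro B hB hBa hBk
      have hBs : B ⊆ s.erase m := by
        intro b hb
        have := hB hb
        simp only [Finset.mem_sdiff, Finset.mem_filter, not_and, not_or] at this
        exact Finset.mem_erase.2 ⟨(this.2 this.1).1, this.1⟩
      obtain ⟨b, hbB, hbi⟩ := hit B hBs hBa hBk i i.2
      have := hB hbB
      simp only [Finset.mem_sdiff, Finset.mem_filter, not_and, not_or] at this
      exact (this.2 this.1).2 (hBs hbB) hbi (hxmax i b (hT B hBs hBa hBk b hbB) hbi)
  · push Not at hex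
    refine extend {m} (by simpa using hms) (by simp) (by simp) fun B hB hBa => hex B ?_ hBa
    rwa [Finset.erase_eq]

/-- An order embedding of Boolean lattices raises cardinality at least as fast as its argument. -/
theorem card_add_card_le_of_orderEmbedding {n N : ℕ} (e : Finset (Fin n) ↪o Finset (Fin N))
    (S : Finset (Fin n)) : #(e ∅) + #S ≤ #(e S) := by
  induction S using Finset.induction with
  | empty => simp
  | insert x S hx ih =>
    have hlt : e S < e (insert x S) := e.strictMono (Finset.ssubset_insert hx)
    have := Finset.card_lt_card hlt
    rw [Finset.card_insert_of_notMem hx]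
    omega

/-- Prefixing a point to the subsets of the range of an injection avoiding it embeds a Boolean
lattice. -/
theorem exists_orderEmbedding_insert {n N : ℕ} (ι : Fin n ↪ Fin N) (p : Fin N)
    (hp : ∀ i, ι i ≠ p) :
    ∃ e : Finset (Fin n) ↪o Finset (Fin N), ∀ S, e S = insert p (S.map ι) := by
  refine ⟨OrderEmbedding.ofMapLEIff (fun S => insert p (S.map ι)) fun S T => ?_, fun S => rfl⟩
  constructor
  · intro h x hx
    have := h (Finset.mem_insert_of_mem (Finset.mem_map_of_mem ι hx))
    rcases Finset.mem_insert.1 this with h | h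
    · exact absurd h (hp x)
    · simpa using h
  · intro h
    exact Finset.insert_subset_insert _ (Finset.map_subset_map.2 h)

/-- If every set that contains `p` and misses `B` has color `b`, there is a copy of `Q_n` of
color `b` whenever `n` points remain. -/
theorem exists_mono_of_forall {n N : ℕ} (c : Finset (Fin N) → Bool) (b : Bool) (p : Fin N)
    (B : Finset (Fin N)) (hpB : p ∉ B) (hB : #B + 1 + n ≤ N)
    (h : ∀ R, p ∈ R → Disjoint R B → c R = b) :
    ∃ e : Finset (Fin n) ↪o Finset (Fin N), ∀ q, c (e q) = b := by
  have hcard : Fintype.card (Fin n) ≤ #(insert p B)ᶜ := by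
    rw [Finset.card_compl, Finset.card_insert_of_notMem hpB, Fintype.card_fin, Fintype.card_fin]
    omega
  obtain ⟨g⟩ := Function.Embedding.nonempty_of_card_le
    (α := Fin n) (β := ((insert p B)ᶜ : Finset (Fin N))) (by
      rw [Fintype.card_coe]
      exact hcard)
  have hg : ∀ i, (g i : Fin N) ≠ p ∧ (g i : Fin N) ∉ B := fun i => by
    simpa [not_or] using (g i).2
  obtain ⟨e, he⟩ := exists_orderEmbedding_insert (g.trans (Function.Embedding.subtype _)) p
    (fun i => (hg i).1)
  refine ⟨e, fun S => h _ (by simp [he]) ?_⟩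
  rw [he, Finset.disjoint_insert_left]
  refine ⟨hpB, Finset.disjoint_left.2 fun x hx => ?_⟩
  obtain ⟨i, -, rfl⟩ := Finset.mem_map.1 hx
  exact (hg i).2

instance (a : ℕ) : Fintype (AntichainP a) := inferInstanceAs (Fintype (Fin a))

theorem card_antichainP (a : ℕ) : Fintype.card (AntichainP a) = a := Fintype.card_fin a

/-- The color `β` is a majority color of `c`: sets of the other color that are separated by few
points cannot realize all vertices of the color `!β` in `κ`. -/
def IsMajorityColor {a N : ℕ} (κ : AntichainP a → Bool) (c : Finset (Fin N) → Bool)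
    (β : Bool) : Prop :=
  ∀ (R : AntichainP a → Finset (Fin N)) (X Y : Finset (Fin N)),
    Disjoint X Y → #X ≤ a → #Y ≤ a →
    (∀ i j, κ i ≠ β → κ j ≠ β → R i ⊆ R j → i = j) →
    (∀ i, κ i ≠ β → c (R i) ≠ β ∧ (∃ x ∈ X, x ∈ R i) ∧ ∃ y ∈ Y, y ∉ R i) → False

theorem exists_isMajorityColor {a N : ℕ} (κ : AntichainP a → Bool) (c : Finset (Fin N) → Bool)
    (hN : 6 * a ≤ N) (hno : ¬ ∃ e : AntichainP a ↪o Finset (Fin N), ∀ p, c (e p) = κ p) :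
    ∃ β : Bool, IsMajorityColor κ c β := by
  have hcopy : ∀ e : AntichainP a → Finset (Fin N), (∀ i j, e i ⊆ e j → i = j) →
      (∀ i, c (e i) = κ i) → False := by
    intro e he hc
    refine hno ⟨OrderEmbedding.ofMapLEIff e fun i j => ⟨fun h => he i j h, ?_⟩, hc⟩
    rintro (rfl : i = j)
    exact le_rfl
  have hinto : ∀ s : Finset (Fin N), a ≤ #s → ∃ w : AntichainP a → Fin N,
      Function.Injective w ∧ ∀ i, w i ∈ s := by
    intro s hs
    obtain ⟨g⟩ := Function.Embedding.nonempty_of_card_le (α := Fin a) (β := s) (by simpa using hs)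
    exact ⟨fun i => (g i : Fin N), fun i j h => g.injective (Subtype.ext h), fun i => (g i).2⟩
  let F : Bool → Finset (Fin N) → Finset (Fin N) := fun b Y => {w | w ∉ Y ∧ c (insert w Y) = b}
  have hF : ∀ b Y w, w ∈ F b Y ↔ w ∉ Y ∧ c (insert w Y) = b := by simp [F]
  have hmaj : ∃ β : Bool, ∀ Y : Finset (Fin N), #Y ≤ a → #(F (!β) Y) < 3 * a := by
    by_contra! hcon
    obtain ⟨Y, hY, hYF⟩ := hcon true
    obtain ⟨Z, hZ, hZF⟩ := hcon false
    obtain ⟨u, hu, hus⟩ := hinto (F false Y \ Z) (by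
      have := Finset.le_card_sdiff Z (F false Y)
      simp only [Bool.not_true] at hYF
      omega)
    obtain ⟨v, hv, hvs⟩ := hinto ((F true Z \ Y) \ Finset.univ.image u) (by
      have h1 := Finset.le_card_sdiff Y (F true Z)
      have h2 := Finset.le_card_sdiff (Finset.univ.image u) (F true Z \ Y)
      have h3 : #(Finset.univ.image u) ≤ a :=
        Finset.card_image_le.trans (by simp [card_antichainP])
      simp only [Bool.not_false] at hZF
      omega)
    have hu1 : ∀ i, u i ∉ Y ∧ c (insert (u i) Y) = false ∧ u i ∉ Z := fun i => by
      have := hus i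
      rw [Finset.mem_sdiff, hF] at this
      exact ⟨this.1.1, this.1.2, this.2⟩
    have hv1 : ∀ i, v i ∉ Z ∧ c (insert (v i) Z) = true ∧ v i ∉ Y ∧ ∀ j, u j ≠ v i := fun i => by
      have := hvs i
      rw [Finset.mem_sdiff, Finset.mem_sdiff, hF] at this
      exact ⟨this.1.1.1, this.1.1.2, this.1.2, fun j h =>
        this.2 (Finset.mem_image.2 ⟨j, Finset.mem_univ _, h⟩)⟩
    refine hcopy (fun i => if κ i = true then insert (v i) Z else insert (u i) Y) ?_ ?_
    · intro i j h
      by_cases hi : κ i = true <;> by_cases hj : κ j = true <;>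
        simp only [hi, hj, if_true, if_false, Bool.false_eq_true] at h
      · rcases Finset.mem_insert.1 (h (Finset.mem_insert_self _ _)) with h | h
        · exact hv h
        · exact absurd h (hv1 i).1
      · rcases Finset.mem_insert.1 (h (Finset.mem_insert_self _ _)) with h | h
        · exact absurd h.symm ((hv1 i).2.2.2 j)
        · exact absurd h (hv1 i).2.2.1
      · rcases Finset.mem_insert.1 (h (Finset.mem_insert_self _ _)) with h | h
        · exact absurd h ((hv1 j).2.2.2 i)
        · exact absurd h (hu1 i).2.2
      · rcases Finset.mem_insert.1 (h (Finset.mem_insert_self _ _)) with h | h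
        · exact hu h
        · exact absurd h (hu1 i).1
    · intro i
      by_cases hi : κ i = true
      · simp only [hi, if_true]
        exact (hv1 i).2.1
      · simp only [hi, if_false, Bool.false_eq_true]
        exact (hu1 i).2.1
  obtain ⟨β, hβ⟩ := hmaj
  refine ⟨β, fun R X Y hXY hX hY hanti hsep => ?_⟩
  obtain ⟨w, hw, hws⟩ := hinto (((Finset.univ \ X) \ Y) \ F (!β) Y) (by
    have h1 := Finset.le_card_sdiff X (Finset.univ : Finset (Fin N))
    have h2 := Finset.le_card_sdiff Y (Finset.univ \ X)
    have h3 := Finset.le_card_sdiff (F (!β) Y) ((Finset.univ \ X) \ Y)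
    have h4 := hβ Y hY
    rw [Finset.card_univ, Fintype.card_fin] at h1
    omega)
  have hw1 : ∀ i, w i ∉ X ∧ w i ∉ Y ∧ c (insert (w i) Y) = β := fun i => by
    have := hws i
    simp only [Finset.mem_sdiff, Finset.mem_univ, true_and, hF, not_and] at this
    refine ⟨this.1.1, this.1.2, ?_⟩
    simpa using this.2 this.1.2
  refine hcopy (fun i => if κ i = β then insert (w i) Y else R i) ?_ ?_
  · intro i j h
    by_cases hi : κ i = β <;> by_cases hj : κ j = β <;>
      simp only [hi, hj, if_true, if_false] at h
    · rcases Finset.mem_insert.1 (h (Finset.mem_insert_self _ _)) with h | h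
      · exact hw h
      · exact absurd h (hw1 i).2.1
    · obtain ⟨-, -, y, hy, hyR⟩ := hsep j hj
      exact absurd (h (Finset.mem_insert_of_mem hy)) hyR
    · obtain ⟨-, ⟨x, hx, hxR⟩, -⟩ := hsep i hi
      rcases Finset.mem_insert.1 (h hxR) with rfl | h
      · exact absurd hx (hw1 j).1
      · exact absurd h (Finset.disjoint_left.1 hXY hx)
    · exact hanti i j hi hj h
  · intro i
    by_cases hi : κ i = β
    · simp only [hi, if_true]
      exact (hw1 i).2.2
    · simp only [hi, if_false]
      have := (hsep i hi).1
      revert this hi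
      cases κ i <;> cases β <;> simp

/-- Minority sets that can be separated by few points have bounded width. -/
theorem IsMajorityColor.card_le {a N : ℕ} {κ : AntichainP a → Bool} {c : Finset (Fin N) → Bool}
    {β : Bool} (hβ : IsMajorityColor κ c β) {A : Finset (Finset (Fin N))}
    (hA : IsAntichain (· ≤ ·) (A : Set (Finset (Fin N)))) (hc : ∀ R ∈ A, c R ≠ β)
    (hsep : ∀ R : AntichainP a → Finset (Fin N), (∀ i, R i ∈ A) → ∃ X Y : Finset (Fin N),
      Disjoint X Y ∧ #X ≤ a ∧ #Y ≤ a ∧ ∀ i, (∃ x ∈ X, x ∈ R i) ∧ ∃ y ∈ Y, y ∉ R i) :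
    #A ≤ a := by
  by_contra! hlt
  obtain ⟨g⟩ := Function.Embedding.nonempty_of_card_le (α := AntichainP a) (β := A) (by
    rw [Fintype.card_coe, card_antichainP]
    exact hlt.le)
  obtain ⟨X, Y, hXY, hX, hY, h⟩ := hsep (fun i => (g i : Finset (Fin N))) fun i => (g i).2
  exact hβ (fun i => (g i : Finset (Fin N))) X Y hXY hX hY
    (fun i j _ _ hij => g.injective (Subtype.ext (hA.eq (g i).2 (g j).2 hij)))
    (fun i _ => ⟨hc _ (g i).2, h i⟩)

/-- The nontrivial minority sets in each half of the lattice are covered by `a` chains. -/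
theorem IsMajorityColor.exists_chain_cover {a N : ℕ} {κ : AntichainP a → Bool}
    {c : Finset (Fin N) → Bool} {β : Bool} (hβ : IsMajorityColor κ c β) (hN : 2 * a < N) :
    ∃ f : Finset (Fin N) → Bool × Fin a,
      ∀ R S, c R ≠ β → c S ≠ β → R ≠ ∅ → S ≠ ∅ → R ≠ univ → S ≠ univ → f R = f S →
        R ⊆ S ∨ S ⊆ R := by
  classical
  have bound : ∀ Z : AntichainP a → Fin N, #(univ.image Z) ≤ a := fun Z =>
    Finset.card_image_le.trans (by simp [card_antichainP])
  obtain ⟨f, hf1, hf2⟩ := _root_.exists_chain_cover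
    ({R | c R ≠ β ∧ R ≠ ∅ ∧ 2 * #R ≤ N} : Finset (Finset (Fin N))) a (by
      intro A hA hanti
      have hA' : ∀ R ∈ A, c R ≠ β ∧ R ≠ ∅ ∧ 2 * #R ≤ N := fun R hR => by
        simpa using hA hR
      refine hβ.card_le hanti (fun R hR => (hA' R hR).1) fun R hR => ?_
      have hx : ∀ i, ∃ x, x ∈ R i := fun i =>
        Finset.nonempty_iff_ne_empty.2 (hA' _ (hR i)).2.1
      choose x hx using hx
      have hy : ∀ i, ∃ y, y ∉ R i ∪ univ.image x := fun i => by
        by_contra! hall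
        have h1 := Finset.card_union_le (R i) (univ.image x)
        rw [Finset.eq_univ_iff_forall.2 hall, Finset.card_univ, Fintype.card_fin] at h1
        have := bound x
        have := (hA' _ (hR i)).2.2
        omega
      choose y hy using hy
      refine ⟨univ.image x, univ.image y, ?_, bound x, bound y, fun i =>
        ⟨⟨x i, by simp, hx i⟩, y i, by simp, fun h => hy i (Finset.mem_union_left _ h)⟩⟩
      rw [Finset.disjoint_right]
      intro z hz
      obtain ⟨i, -, rfl⟩ := Finset.mem_image.1 hz
      exact fun h => hy i (Finset.mem_union_right _ h))
  obtain ⟨g, hg1, hg2⟩ := _root_.exists_chain_cover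
    ({R | c R ≠ β ∧ R ≠ univ ∧ N < 2 * #R} : Finset (Finset (Fin N))) a (by
      intro A hA hanti
      have hA' : ∀ R ∈ A, c R ≠ β ∧ R ≠ univ ∧ N < 2 * #R := fun R hR => by
        simpa using hA hR
      refine hβ.card_le hanti (fun R hR => (hA' R hR).1) fun R hR => ?_
      have hy : ∀ i, ∃ y, y ∉ R i := fun i => by
        by_contra! hall
        exact (hA' _ (hR i)).2.1 (Finset.eq_univ_iff_forall.2 hall)
      choose y hy using hy
      have hx : ∀ i, ∃ x ∈ R i, x ∉ univ.image y := fun i => by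
        by_contra! hall
        have h1 := Finset.card_le_card hall
        have := bound y
        have := (hA' _ (hR i)).2.2
        omega
      choose x hx hxy using hx
      refine ⟨univ.image x, univ.image y, ?_, bound x, bound y, fun i =>
        ⟨⟨x i, by simp, hx i⟩, y i, by simp, hy i⟩⟩
      rw [Finset.disjoint_left]
      intro z hz
      obtain ⟨i, -, rfl⟩ := Finset.mem_image.1 hz
      exact hxy i)
  by_cases hempty : ∀ R : Finset (Fin N), c R ≠ β → R ≠ ∅ → R ≠ univ → False
  · by_cases ha : a = 0
    · subst ha
      exact (hβ (fun _ => ∅) ∅ ∅ (by simp) (by simp) (by simp) (fun i => Fin.elim0 i)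
        (fun i => Fin.elim0 i)).elim
    · exact ⟨fun _ => (true, ⟨0, by omega⟩), fun R S hR _ hR' _ hR'' => (hempty R hR hR' hR'').elim⟩
  have ha : 0 < a := by
    push Not at hempty
    obtain ⟨R, h1, h2, h3, -⟩ := hempty
    rcases le_or_gt (2 * #R) N with h | h
    · have := hf1 R (by simp [h1, h2.ne_empty, h])
      omega
    · have := hg1 R (by simp [h1, h3, h])
      omega
  refine ⟨fun R => if 2 * #R ≤ N then (true, ⟨f R % a, Nat.mod_lt _ ha⟩)
    else (false, ⟨g R % a, Nat.mod_lt _ ha⟩), ?_⟩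
  intro R S hR hS hR0 hS0 hR1 hS1 h
  by_cases hRc : 2 * #R ≤ N <;> by_cases hSc : 2 * #S ≤ N <;>
    simp only [hRc, hSc, if_true, if_false, Prod.mk.injEq, Fin.mk.injEq, true_and, false_and,
      reduceCtorEq] at h
  · have h1 : R ∈ ({R | c R ≠ β ∧ R ≠ ∅ ∧ 2 * #R ≤ N} : Finset (Finset (Fin N))) := by
      simp [hR, hR0, hRc]
    have h2 : S ∈ ({R | c R ≠ β ∧ R ≠ ∅ ∧ 2 * #R ≤ N} : Finset (Finset (Fin N))) := by
      simp [hS, hS0, hSc]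
    rw [Nat.mod_eq_of_lt (hf1 R h1), Nat.mod_eq_of_lt (hf1 S h2)] at h
    exact hf2 R h1 S h2 h
  · have h1 : R ∈ ({R | c R ≠ β ∧ R ≠ univ ∧ N < 2 * #R} : Finset (Finset (Fin N))) := by
      simp [hR, hR1]; omega
    have h2 : S ∈ ({R | c R ≠ β ∧ R ≠ univ ∧ N < 2 * #R} : Finset (Finset (Fin N))) := by
      simp [hS, hS1]; omega
    rw [Nat.mod_eq_of_lt (hg1 R h1), Nat.mod_eq_of_lt (hg1 S h2)] at h
    exact hg2 R h1 S h2 h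

/-- If a family of sets is covered by the chains `f ⁻¹ i`, and there are many points, then some
point `p` is separated from two further points `o`, `q` by no member of the family. -/
theorem exists_not_separated {ι : Type*} [Fintype ι] {N : ℕ} (P : Finset (Fin N) → Prop)
    (f : Finset (Fin N) → ι) (hf : ∀ R S, P R → P S → f R = f S → R ⊆ S ∨ S ⊆ R)
    (hN : 2 ^ 2 ^ Fintype.card ι < N) :
    ∃ o p q : Fin N, o < p ∧ p < q ∧ ∀ R, P R → p ∈ R → o ∉ R → q ∉ R → False := by
  classical
  let χ : Fin N → Fin N → Finset ι := fun p q => {i | ∃ R, P R ∧ f R = i ∧ q ∈ R ∧ p ∉ R}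
  let T : Fin N → Finset (Finset ι) := fun v => ({u | u < v} : Finset (Fin N)).image (χ · v)
  obtain ⟨p, q, hpq, hT⟩ : ∃ p q, p < q ∧ T p = T q := by
    obtain ⟨p, q, hne, hT⟩ := Fintype.exists_ne_map_eq_of_card_lt T (by simpa using hN)
    rcases lt_or_gt_of_ne hne with h | h
    · exact ⟨p, q, h, hT⟩
    · exact ⟨q, p, h, hT.symm⟩
  have hmem : χ p q ∈ T p := by
    rw [hT]
    exact Finset.mem_image.2 ⟨p, by simpa using hpq, rfl⟩
  obtain ⟨o, ho, hχ⟩ := Finset.mem_image.1 hmem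
  refine ⟨o, p, q, by simpa using ho, hpq, fun R hR hp ho hq => ?_⟩
  have h1 : f R ∈ χ o p := Finset.mem_filter.2 ⟨Finset.mem_univ _, R, hR, rfl, hp, ho⟩
  rw [hχ] at h1
  obtain ⟨-, S, hS, hfS, hqS, hpS⟩ := Finset.mem_filter.1 h1
  rcases hf R S hR hS hfS.symm with h | h
  · exact hpS (h hp)
  · exact hq (h hqS)

theorem exists_copy_add_three {a : ℕ} (κ : AntichainP a → Bool) {n : ℕ}
    (hn : 6 * a + 2 ^ 2 ^ (2 * a) ≤ n) (c : Finset (Fin (n + 3)) → Bool) :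
    (∃ e : AntichainP a ↪o Finset (Fin (n + 3)), ∀ p, c (e p) = κ p) ∨
    (∃ b : Bool, ∃ e : Finset (Fin n) ↪o Finset (Fin (n + 3)), ∀ q, c (e q) = b) := by
  by_contra! hcon
  have hn₁ : 6 * a ≤ n := le_of_add_le_left hn
  have hn₂ : 2 ^ 2 ^ (2 * a) ≤ n := le_of_add_le_right hn
  obtain ⟨β, hβ⟩ := exists_isMajorityColor κ c (by omega) (by
    push Not
    exact hcon.1)
  obtain ⟨f, hf⟩ := hβ.exists_chain_cover (by omega)
  obtain ⟨o, p, q, hop, hpq, h⟩ := exists_not_separated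
    (fun R => c R ≠ β ∧ R ≠ ∅ ∧ R ≠ univ) f
    (fun R S hR hS => hf R S hR.1 hS.1 hR.2.1 hS.2.1 hR.2.2 hS.2.2)
    (by simpa using hn₂.trans_lt (by omega))
  obtain ⟨e, he⟩ := exists_mono_of_forall (n := n) c β p {o, q}
    (by simp [hop.ne', hpq.ne]) (by
      rw [Finset.card_pair (hop.trans hpq).ne]
      omega) (by
      intro R hp hR
      rw [Finset.disjoint_insert_right, Finset.disjoint_singleton_right] at hR
      by_contra hc
      refine h R ⟨hc, ?_, ?_⟩ hp hR.1 hR.2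
      · rintro rfl
        simp at hp
      · rintro rfl
        simp at hR)
  obtain ⟨S, hS⟩ := hcon.2 β e
  exact hS (he S)

/-- When no color occurs three times in `κ`, the only incomparable pairs of minority sets are
complementary pairs of a singleton and a cosingleton. -/
theorem IsMajorityColor.eq_singleton_compl {a N : ℕ} {κ : AntichainP a → Bool}
    {c : Finset (Fin N) → Bool} {β : Bool} (hβ : IsMajorityColor κ c β) (ha : 2 ≤ a)
    (hκ : ¬ ∃ i j k : AntichainP a, i ≠ j ∧ i ≠ k ∧ j ≠ k ∧ κ i = κ j ∧ κ j = κ k)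
    {R S : Finset (Fin N)} (hR : c R ≠ β) (hS : c S ≠ β) (hRS : ¬ R ⊆ S) (hSR : ¬ S ⊆ R) :
    ∃ z, R = {z} ∧ S = {z}ᶜ ∨ S = {z} ∧ R = {z}ᶜ := by
  classical
  by_contra! hcon
  have key : ∀ R S : Finset (Fin N), ¬ R ⊆ S → (∀ z, R = {z} → S ≠ {z}ᶜ) →
      ∃ x ∈ R, ∃ y, y ∉ S ∧ x ≠ y := by
    intro R S hRS h
    obtain ⟨z, hz, hzS⟩ := Finset.not_subset.1 hRS
    by_contra! hall
    refine h z ?_ ?_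
    · ext x
      rw [Finset.mem_singleton]
      exact ⟨fun hx => hall x hx z hzS, fun hx => hx ▸ hz⟩
    · ext y
      rw [Finset.mem_compl, Finset.mem_singleton]
      refine ⟨fun hy hyz => hzS (hyz ▸ hy), fun hy => ?_⟩
      by_contra hyS
      exact hy (hall z hz y hyS).symm
  obtain ⟨x₁, hx₁, y₂, hy₂, hxy₁⟩ := key R S hRS fun z => (hcon z).1
  obtain ⟨x₂, hx₂, y₁, hy₁, hxy₂⟩ := key S R hSR fun z => (hcon z).2
  have h11 : x₁ ≠ y₁ := fun h => hy₁ (h ▸ hx₁)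
  have h22 : x₂ ≠ y₂ := fun h => hy₂ (h ▸ hx₂)
  by_cases hex : ∃ i, κ i ≠ β
  · obtain ⟨i₀, hi₀⟩ := hex
    refine hβ (fun i => if i = i₀ then R else S) {x₁, x₂} {y₁, y₂} ?_
      (Finset.card_le_two.trans ha) (Finset.card_le_two.trans ha) ?_ ?_
    · simp [h11.symm, h22.symm, hxy₁.symm, hxy₂.symm]
    · intro i j hi hj hij
      by_cases hi' : i = i₀ <;> by_cases hj' : j = i₀ <;>
        simp only [hi', hj', if_true, if_false] at hij
      · exact hi'.trans hj'.symm
      · exact absurd hij hRS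
      · exact absurd hij hSR
      · by_contra hne
        refine hκ ⟨i, j, i₀, hne, hi', hj', ?_, ?_⟩
        · exact (Bool.eq_not_of_ne hi).trans (Bool.eq_not_of_ne hj).symm
        · exact (Bool.eq_not_of_ne hj).trans (Bool.eq_not_of_ne hi₀).symm
    · intro i _
      by_cases hi' : i = i₀ <;> simp only [hi', if_true, if_false]
      · exact ⟨hR, ⟨x₁, by simp, hx₁⟩, y₁, by simp, hy₁⟩
      · exact ⟨hS, ⟨x₂, by simp, hx₂⟩, y₂, by simp, hy₂⟩
  · push Not at hex
    exact hβ (fun _ => ∅) ∅ ∅ (by simp) (by simp) (by simp)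
      (fun i _ hi => absurd (hex i) hi) (fun i hi => absurd (hex i) hi)

theorem exists_copy_add_two {a : ℕ} (ha : 2 ≤ a) (κ : AntichainP a → Bool)
    (hκ : ¬ ∃ i j k : AntichainP a, i ≠ j ∧ i ≠ k ∧ j ≠ k ∧ κ i = κ j ∧ κ j = κ k) {n : ℕ}
    (hn : 6 * a ≤ n) (c : Finset (Fin (n + 2)) → Bool) :
    (∃ e : AntichainP a ↪o Finset (Fin (n + 2)), ∀ p, c (e p) = κ p) ∨
    (∃ b : Bool, ∃ e : Finset (Fin n) ↪o Finset (Fin (n + 2)), ∀ q, c (e q) = b) := by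
  by_contra! hcon
  obtain ⟨β, hβ⟩ := exists_isMajorityColor κ c (by omega) (by
    push Not
    exact hcon.1)
  have hbad : ∀ x y : Fin (n + 2), x ≠ y → ∃ R, c R ≠ β ∧ x ∈ R ∧ y ∉ R := by
    intro x y hxy
    by_contra! hall
    obtain ⟨e, he⟩ := exists_mono_of_forall (n := n) c β x {y} (by simpa using hxy)
      (by simp; omega) (by
        intro R hx hR
        by_contra hc
        exact Finset.disjoint_singleton_right.1 hR (hall R hc hx))
    obtain ⟨S, hS⟩ := hcon.2 β e
    exact hS (he S)
  have hpair : ∀ x y : Fin (n + 2), x ≠ y → ∃ z, (z = x ∨ z = y) ∧ c {z} ≠ β := by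
    intro x y hxy
    obtain ⟨R, hR, hxR, hyR⟩ := hbad x y hxy
    obtain ⟨S, hS, hyS, hxS⟩ := hbad y x hxy.symm
    obtain ⟨z, ⟨rfl, -⟩ | ⟨rfl, -⟩⟩ := hβ.eq_singleton_compl ha hκ hR hS
      (fun h => hxS (h hxR)) (fun h => hyR (h hyS))
    · exact ⟨z, Or.inl (Finset.mem_singleton.1 hxR).symm, hR⟩
    · exact ⟨z, Or.inr (Finset.mem_singleton.1 hyS).symm, hS⟩
  have huniq : ∀ z w : Fin (n + 2), c {z} ≠ β → c {w} ≠ β → z = w := by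
    intro z w hz hw
    by_contra hne
    obtain ⟨u, ⟨h1, h2⟩ | ⟨h1, h2⟩⟩ := hβ.eq_singleton_compl ha hκ hz hw
      (by simpa using hne) (by simpa using Ne.symm hne)
    all_goals
      have := congrArg Finset.card h2
      rw [Finset.card_compl] at this
      simp at this
      omega
  obtain ⟨z, hz, hzc⟩ := hpair ⟨0, by omega⟩ ⟨1, by omega⟩ (by simp)
  obtain ⟨w, hw, hwc⟩ := hpair ⟨2, by omega⟩ ⟨3, by omega⟩ (by simp)
  have := congrArg Fin.val (huniq z w hzc hwc)
  rcases hz with rfl | rfl <;> rcases hw with rfl | rfl <;> simp at this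

/-- A coloring of `Q_M` without the forbidden copies bounds the Erdős–Hajnal number from below. -/
theorem posetEH_eq_add_one {P : Type*} [PartialOrder P] (κ : P → Bool) {n M : ℕ}
    (hup : ∀ c : Finset (Fin (M + 1)) → Bool,
      (∃ e : P ↪o Finset (Fin (M + 1)), ∀ p, c (e p) = κ p) ∨
      (∃ b : Bool, ∃ e : Finset (Fin n) ↪o Finset (Fin (M + 1)), ∀ q, c (e q) = b))
    (hlow : ∃ c : Finset (Fin M) → Bool,
      (∀ e : P ↪o Finset (Fin M), ¬ ∀ p, c (e p) = κ p) ∧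
      ∀ (b : Bool) (e : Finset (Fin n) ↪o Finset (Fin M)), ¬ ∀ q, c (e q) = b) :
    posetEH κ n = M + 1 := by
  have hmem' : M + 1 ∈ {N : ℕ | ∀ c : Finset (Fin N) → Bool,
      (∃ e : P ↪o Finset (Fin N), ∀ p, c (e p) = κ p) ∨
      (∃ b : Bool, ∃ e : Finset (Fin n) ↪o Finset (Fin N), ∀ q, c (e q) = b)} := hup
  apply le_antisymm (Nat.sInf_le hmem')
  by_contra! hlt
  have hmem := Nat.sInf_mem ⟨M + 1, hmem'⟩
  obtain ⟨c, hc₁, hc₂⟩ := hlow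
  let ι := Finset.mapEmbedding (Fin.castLEEmb (Nat.le_of_lt_succ hlt))
  rcases hmem (fun S => c (ι S)) with ⟨e, he⟩ | ⟨b, e, he⟩
  · exact hc₁ (e.trans ι) he
  · exact hc₂ b (e.trans ι) he

theorem antichainP_eq_of_map_le {a N : ℕ} (e : AntichainP a ↪o Finset (Fin N))
    {i j : AntichainP a} (h : e i ⊆ e j) : i = j :=
  e.le_iff_le.1 h

theorem map_ne_of_map_ne {n N : ℕ} (c : Finset (Fin N) → Bool) {b : Bool} {T : Finset (Fin N)}
    (hT : c T ≠ b) (e : Finset (Fin n) ↪o Finset (Fin N)) (he : ∀ q, c (e q) = b)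
    (S : Finset (Fin n)) : e S ≠ T :=
  fun h => hT (h ▸ he S)

/-- In `Q_{n+1}`, distinguishing only the top and the bottom avoids every nonmonochromatic
antichain and every monochromatic `Q_n`. -/
theorem exists_coloring_add_one {a : ℕ} (κ : AntichainP a → Bool)
    (hnm : ∃ i j : AntichainP a, κ i ≠ κ j) {n : ℕ} (hn : 2 ≤ n) :
    ∃ c : Finset (Fin (n + 1)) → Bool,
      (∀ e : AntichainP a ↪o Finset (Fin (n + 1)), ¬ ∀ p, c (e p) = κ p) ∧
      ∀ (b : Bool) (e : Finset (Fin n) ↪o Finset (Fin (n + 1))), ¬ ∀ q, c (e q) = b := by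
  refine ⟨fun S => decide (S = ∅ ∨ S = univ), fun e he => ?_, fun b e he => ?_⟩
  · obtain ⟨i, j, hij, hi⟩ : ∃ i j, i ≠ j ∧ κ i = true := by
      obtain ⟨i, j, hij⟩ := hnm
      by_cases hi : κ i = true
      · exact ⟨i, j, fun h => hij (congrArg κ h), hi⟩
      · refine ⟨j, i, fun h => hij (congrArg κ h.symm), ?_⟩
        revert hij hi
        cases κ i <;> cases κ j <;> simp
    have := he i
    rw [hi, decide_eq_true_eq] at this
    rcases this with h | h
    · exact hij (antichainP_eq_of_map_le e (by simp [h]))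
    · exact hij (antichainP_eq_of_map_le e (j := i) (i := j) (by simp [h])).symm
  · cases b with
    | true =>
      have h0 : ¬ e {⟨0, by omega⟩} ≤ e {⟨1, by omega⟩} := by simp
      have h1 : ¬ e {⟨1, by omega⟩} ≤ e {⟨0, by omega⟩} := by simp
      have := he {⟨0, by omega⟩}
      rw [decide_eq_true_eq] at this
      rcases this with h | h
      · exact h0 (by simp [h])
      · exact h1 (by simp [h])
    | false =>
      have h : ∀ S, e S ≠ ∅ ∧ e S ≠ univ := fun S => by simpa using he S
      have h0 := Finset.card_pos.2 (Finset.nonempty_iff_ne_empty.2 (h ∅).1)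
      have h1 := (Finset.card_lt_iff_ne_univ _).2 (h univ).2
      have := card_add_card_le_of_orderEmbedding e univ
      simp at this h1
      omega

/-- In `Q_{n+2}`, distinguishing the prefixes and the suffixes of a linear order of the points
avoids every antichain with three vertices of the distinguished color and every
monochromatic `Q_n`. -/
theorem exists_coloring_add_two {a : ℕ} (κ : AntichainP a → Bool)
    (h₃ : ∃ i j k : AntichainP a, i ≠ j ∧ i ≠ k ∧ j ≠ k ∧ κ i = κ j ∧ κ j = κ k) {n : ℕ}
    (hn : 3 ≤ n) :
    ∃ c : Finset (Fin (n + 2)) → Bool,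
      (∀ e : AntichainP a ↪o Finset (Fin (n + 2)), ¬ ∀ p, c (e p) = κ p) ∧
      ∀ (b : Bool) (e : Finset (Fin n) ↪o Finset (Fin (n + 2))), ¬ ∀ q, c (e q) = b := by
  classical
  obtain ⟨i, j, k, hij, hik, hjk, hκij, hκjk⟩ := h₃
  let L : Finset (Fin (n + 2)) → Prop := fun S =>
    IsLowerSet (S : Set (Fin (n + 2))) ∨ IsUpperSet (S : Set (Fin (n + 2)))
  let c : Finset (Fin (n + 2)) → Bool := fun S => if L S then κ i else !κ i
  have hcL : ∀ S, c S = κ i → L S := by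
    intro S hS
    by_contra h
    simp [c, h] at hS
  have hcL' : ∀ S, L S → c S ≠ !κ i := by
    intro S hS
    simp [c, hS]
  have hlow : ∀ S T : Finset (Fin (n + 2)), IsLowerSet (S : Set (Fin (n + 2))) →
      IsLowerSet (T : Set (Fin (n + 2))) → S ⊆ T ∨ T ⊆ S := fun S T hS hT => by
    simpa using hS.total hT
  have hupp : ∀ S T : Finset (Fin (n + 2)), IsUpperSet (S : Set (Fin (n + 2))) →
      IsUpperSet (T : Set (Fin (n + 2))) → S ⊆ T ∨ T ⊆ S := fun S T hS hT => by
    simpa using hS.total hT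
  have hthree : ∀ S T U, L S → L T → L U →
      (S ⊆ T ∨ T ⊆ S) ∨ (S ⊆ U ∨ U ⊆ S) ∨ (T ⊆ U ∨ U ⊆ T) := by
    rintro S T U (hS | hS) (hT | hT) (hU | hU)
    · exact Or.inl (hlow _ _ hS hT)
    · exact Or.inl (hlow _ _ hS hT)
    · exact Or.inr (Or.inl (hlow _ _ hS hU))
    · exact Or.inr (Or.inr (hupp _ _ hT hU))
    · exact Or.inr (Or.inr (hlow _ _ hT hU))
    · exact Or.inr (Or.inl (hupp _ _ hS hU))
    · exact Or.inl (hupp _ _ hS hT)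
    · exact Or.inl (hupp _ _ hS hT)
  refine ⟨c, fun e he => ?_, fun b e he => ?_⟩
  · rcases hthree _ _ _ (hcL _ (he i)) (hcL _ ((he j).trans hκij.symm))
      (hcL _ ((he k).trans (hκij.trans hκjk).symm)) with (h | h) | (h | h) | (h | h)
    · exact hij (antichainP_eq_of_map_le e h)
    · exact hij (antichainP_eq_of_map_le e h).symm
    · exact hik (antichainP_eq_of_map_le e h)
    · exact hik (antichainP_eq_of_map_le e h).symm
    · exact hjk (antichainP_eq_of_map_le e h)
    · exact hjk (antichainP_eq_of_map_le e h).symm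
  · by_cases hb : b = κ i
    · subst hb
      have hinj : ∀ x y : Fin n, e {x} ⊆ e {y} → x = y := fun x y h => by
        simpa using e.le_iff_le.1 h
      rcases hthree _ _ _ (hcL _ (he {⟨0, by omega⟩})) (hcL _ (he {⟨1, by omega⟩}))
        (hcL _ (he {⟨2, by omega⟩})) with (h | h) | (h | h) | (h | h) <;>
        simpa using hinj _ _ h
    · obtain rfl : b = !κ i := Bool.eq_not_of_ne hb
      have hne : ∀ T, L T → ∀ S, e S ≠ T := fun T hT =>
        map_ne_of_map_ne c (hcL' T hT) e he
      have h0 := Finset.card_pos.2 (Finset.nonempty_iff_ne_empty.2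
        (hne ∅ (Or.inl (by simpa using isLowerSet_empty)) ∅))
      have h1 : 0 < #(e univ)ᶜ := Finset.card_pos.2 (Finset.nonempty_iff_ne_empty.2
        (mt (Finset.compl_eq_empty_iff _).1
          (hne univ (Or.inl (by simpa using isLowerSet_univ)) univ)))
      have h2 := card_add_card_le_of_orderEmbedding e univ
      have h3 := Finset.card_compl_add_card (e univ)
      rw [Fintype.card_fin] at h3
      rw [Finset.card_univ, Fintype.card_fin] at h2
      obtain ⟨x, hx⟩ := Finset.card_eq_one.1 (show #(e ∅) = 1 by omega)
      obtain ⟨y, hy⟩ := Finset.card_eq_one.1 (show #(e univ)ᶜ = 1 by omega)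
      have hyT : e univ = {y}ᶜ := by rw [← hy, compl_compl]
      have hsub : e ∅ ⊆ e univ := e.monotone (Finset.empty_subset _)
      have hxy : x ≠ y := by
        rw [hx, hyT] at hsub
        simpa [eq_comm] using hsub
      have himg : univ.image e = Finset.Icc (e ∅) (e univ) := by
        apply Finset.eq_of_subset_of_card_le
        · intro T hT
          obtain ⟨S, -, rfl⟩ := Finset.mem_image.1 hT
          exact Finset.mem_Icc.2
            ⟨e.monotone (Finset.empty_subset _), e.monotone (Finset.subset_univ _)⟩
        · rw [Finset.card_Icc_finset hsub, Finset.card_image_of_injective _ e.injective,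
            Finset.card_univ, Fintype.card_finset, Fintype.card_fin]
          exact Nat.pow_le_pow_right (by norm_num) (by omega)
      have hsurj : ∀ T : Finset (Fin (n + 2)), x ∈ T → y ∉ T → ¬ L T := by
        intro T hxT hyT' hLT
        have hT : T ∈ univ.image e := by
          rw [himg, Finset.mem_Icc, hx, hyT]
          exact ⟨by simpa using hxT, by simpa [Finset.subset_compl_comm] using hyT'⟩
        obtain ⟨S, -, hS⟩ := Finset.mem_image.1 hT
        exact hne T hLT S hS
      rcases lt_or_gt_of_ne hxy with h | h
      · exact hsurj (Finset.Iic x) (by simp) (by simpa using h)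
          (Or.inl (by simpa using isLowerSet_Iic x))
      · exact hsurj (Finset.Ici x) (by simp) (by simpa using h)
          (Or.inr (by simpa using isUpperSet_Ici x))

/-- Let `Ȧ` be a colored antichain on `a ≥ 2` vertices (coloring
`κ : A_a → Bool`) that is not monochromatic. If `Ȧ` has no three vertices of the same color,
then `R̃(Ȧ, Q_n) = n + 2` for all sufficiently large `n`; otherwise `R̃(Ȧ, Q_n) = n + 3`
for all sufficiently large `n`. -/
theorem colored_antichain_EH (a : ℕ) (ha : 2 ≤ a) (κ : AntichainP a → Bool)
    (hnm : ∃ i j : AntichainP a, κ i ≠ κ j) :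
    ((¬ ∃ i j k : AntichainP a, i ≠ j ∧ i ≠ k ∧ j ≠ k ∧ κ i = κ j ∧ κ j = κ k) →
      ∃ n₀ : ℕ, ∀ n : ℕ, n₀ ≤ n → posetEH κ n = n + 2) ∧
    ((∃ i j k : AntichainP a, i ≠ j ∧ i ≠ k ∧ j ≠ k ∧ κ i = κ j ∧ κ j = κ k) →
      ∃ n₀ : ℕ, ∀ n : ℕ, n₀ ≤ n → posetEH κ n = n + 3) := by
  refine ⟨fun h => ⟨6 * a, fun n hn => ?_⟩,
    fun h => ⟨6 * a + 2 ^ 2 ^ (2 * a), fun n hn => ?_⟩⟩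
  · exact posetEH_eq_add_one κ (exists_copy_add_two ha κ h hn)
      (exists_coloring_add_one κ hnm (by omega))
  · exact posetEH_eq_add_one κ (exists_copy_add_three κ hn)
      (exists_coloring_add_two κ h (by have := le_of_add_le_left hn; omega))
end

section
/- For every n ∈ ℕ, R̃(Ċ_2^{(rbr)}, Q_n) = R̃(Ċ_3^{(rbr)}, Q_n) = 2n. Moreover, for every integer t ≥ 4 there exists n_0 such that for all n ≥ n_0, 2.02·n < R̃(Ċ_t^{(rbr)}, Q_n) ≤ (t − 1)·n. -/
open Finset

/-- The red-alternating chain `Ċ_t^{(rbr)}`: the chain `C_t = Fin t` colored alternatingly,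
with the minimal element red (`false` = red, `true` = blue). -/
def rbrColor (t : ℕ) : Fin t → Bool := fun i => decide (i.val % 2 = 1)


/-- A monotone map into a Boolean lattice whose values trace the identity on the range of `ψ`
is an order embedding. -/
def traceEmbedding {n N : ℕ} (h : Finset (Fin n) → Finset (Fin N)) (ψ : Fin n → Fin N)
    (hmono : ∀ A B, A ⊆ B → h A ⊆ h B) (htrace : ∀ A i, ψ i ∈ h A ↔ i ∈ A) :
    Finset (Fin n) ↪o Finset (Fin N) :=
  OrderEmbedding.ofMapLEIff h fun A B =>
    ⟨fun hAB i hi => (htrace B i).1 (hAB ((htrace A i).2 hi)), hmono A B⟩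

/-- Every order embedding of Boolean lattices traces the identity on some `n`-subset. -/
theorem exists_trace {n N : ℕ} (φ : Finset (Fin n) ↪o Finset (Fin N)) :
    ∃ ψ : Fin n ↪ Fin N, ∀ A i, ψ i ∈ φ A ↔ i ∈ A := by
  have h : ∀ i : Fin n, ∃ x, x ∈ φ {i} ∧ x ∉ φ {i}ᶜ := by
    intro i
    by_contra! hc
    have : ({i} : Finset (Fin n)) ≤ {i}ᶜ := φ.le_iff_le.1 hc
    simpa using this (mem_singleton_self i)
  choose ψ h₁ h₂ using h
  have htrace : ∀ A i, ψ i ∈ φ A ↔ i ∈ A := by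
    intro A i
    refine ⟨fun hi => ?_, fun hi => ?_⟩
    · by_contra hA
      refine h₂ i (φ.monotone ?_ hi)
      intro j hj
      simp only [mem_compl, mem_singleton]
      rintro rfl
      exact hA hj
    · exact φ.monotone (singleton_subset_iff.2 hi) (h₁ i)
  refine ⟨⟨ψ, fun i j hij => ?_⟩, htrace⟩
  have := (htrace {i} j).1 (hij ▸ h₁ i)
  exact (mem_singleton.1 this).symm

/-- A coloring of `Q_N` with neither a colored copy of `(P, κ)` nor a monochromatic `Q_n`. -/
def Avoids {P : Type*} [PartialOrder P] (κ : P → Bool) (n : ℕ) {N : ℕ}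
    (c : Finset (Fin N) → Bool) : Prop :=
  (∀ e : P ↪o Finset (Fin N), ∃ p, c (e p) ≠ κ p) ∧
    ∀ (b : Bool) (e : Finset (Fin n) ↪o Finset (Fin N)), ∃ q, c (e q) ≠ b

theorem posetEH_le {P : Type*} [PartialOrder P] {κ : P → Bool} {n N : ℕ}
    (h : ∀ c : Finset (Fin N) → Bool, ¬ Avoids κ n c) : posetEH κ n ≤ N := by
  refine Nat.sInf_le fun c => ?_
  have := h c
  simp only [Avoids, not_and_or] at this
  push Not at this
  exact this

theorem lt_posetEH {P : Type*} [PartialOrder P] {κ : P → Bool} {n N N₁ : ℕ}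
    (h : ∀ N' ≤ N, ∃ c : Finset (Fin N') → Bool, Avoids κ n c)
    (h₁ : ∀ c : Finset (Fin N₁) → Bool, ¬ Avoids κ n c) : N < posetEH κ n := by
  have hne : {N : ℕ | ∀ c : Finset (Fin N) → Bool,
      (∃ e : P ↪o Finset (Fin N), ∀ p, c (e p) = κ p) ∨
      (∃ b : Bool, ∃ e : Finset (Fin n) ↪o Finset (Fin N), ∀ q, c (e q) = b)}.Nonempty := by
    refine ⟨N₁, fun c => ?_⟩
    have := h₁ c
    simp only [Avoids, not_and_or] at this
    push Not at this
    exact this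
  by_contra! hle
  obtain ⟨c, hc₁, hc₂⟩ := h _ hle
  rcases Nat.sInf_mem hne c with ⟨e, he⟩ | ⟨b, e, he⟩
  · obtain ⟨p, hp⟩ := hc₁ e
    exact hp (he p)
  · obtain ⟨q, hq⟩ := hc₂ b e
    exact hq (he q)

theorem Avoids.restrict {P : Type*} [PartialOrder P] {κ : P → Bool} {n N N' : ℕ} (hN : N' ≤ N)
    {c : Finset (Fin N) → Bool} (hc : Avoids κ n c) :
    Avoids κ n fun Z : Finset (Fin N') => c (Z.map (Fin.castLEEmb hN)) :=
  ⟨fun e => hc.1 (e.trans (mapEmbedding (Fin.castLEEmb hN))),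
    fun b e => hc.2 b (e.trans (mapEmbedding (Fin.castLEEmb hN)))⟩

/-! ### The upper bound -/

/-- There is a red-alternating chain of length `k` below `Z`. -/
def AltBelow {N : ℕ} (c : Finset (Fin N) → Bool) : ℕ → Finset (Fin N) → Prop
  | 0, _ => True
  | k + 1, Z => ∃ Y, Y ⊆ Z ∧ c Y = decide (k % 2 = 1) ∧ AltBelow c k Y

theorem AltBelow.mono {N : ℕ} {c : Finset (Fin N) → Bool} {k : ℕ} {Y Z : Finset (Fin N)}
    (hYZ : Y ⊆ Z) (h : AltBelow c k Y) : AltBelow c k Z := by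
  cases k with
  | zero => trivial
  | succ k =>
    obtain ⟨V, hV, h⟩ := h
    exact ⟨V, hV.trans hYZ, h⟩

theorem AltBelow.exists_strictMono {N : ℕ} {c : Finset (Fin N) → Bool} {k : ℕ}
    {Z : Finset (Fin N)} (h : AltBelow c k Z) :
    ∃ e : Fin k → Finset (Fin N),
      StrictMono e ∧ (∀ i, c (e i) = rbrColor k i) ∧ ∀ i, e i ⊆ Z := by
  induction k generalizing Z with
  | zero => exact ⟨Fin.elim0, fun i => i.elim0, fun i => i.elim0, fun i => i.elim0⟩
  | succ k ih =>
    obtain ⟨Y, hYZ, hcY, hY⟩ := h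
    obtain ⟨e, he, hc, heY⟩ := ih hY
    refine ⟨Fin.snoc e Y, ?_, ?_, ?_⟩
    · have hlt : ∀ i, e i < Y := by
        intro i
        refine lt_of_le_of_ne (heY i) fun heq => ?_
        by_cases hi : i.val + 1 < k
        · have : e i < e ⟨i.val + 1, hi⟩ := he (Fin.lt_def.2 (Nat.lt_succ_self _))
          exact absurd (heY ⟨i.val + 1, hi⟩) (heq ▸ this).not_ge
        · have h1 := hc i
          rw [heq, hcY, rbrColor, decide_eq_decide] at h1
          omega
      intro i j
      refine Fin.lastCases ?_ (fun i' => ?_) i <;> refine Fin.lastCases ?_ (fun j' => ?_) j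
      · simp
      · intro hij
        exact absurd hij (Fin.castSucc_lt_last j').not_gt
      · intro _
        simpa using hlt i'
      · intro hij
        simpa using he (Fin.castSucc_lt_castSucc_iff.1 hij)
    · intro i
      refine Fin.lastCases ?_ (fun j => ?_) i
      · simpa [rbrColor] using hcY
      · simpa [rbrColor] using hc j
    · intro i
      refine Fin.lastCases ?_ (fun j => ?_) i
      · simpa using hYZ
      · simpa using (heY j).trans hYZ

open Classical in
/-- The length of a longest red-alternating chain below `Z`, capped at `t`. -/
noncomputable def altLevel {N : ℕ} (c : Finset (Fin N) → Bool) (t : ℕ) (Z : Finset (Fin N)) : ℕ :=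
  Nat.findGreatest (fun k => AltBelow c k Z) t

theorem altBelow_altLevel {N : ℕ} (c : Finset (Fin N) → Bool) (t : ℕ) (Z : Finset (Fin N)) :
    AltBelow c (altLevel c t Z) Z := by
  classical
  exact Nat.findGreatest_spec (P := fun k => AltBelow c k Z) (Nat.zero_le t) trivial

theorem altLevel_mono {N : ℕ} (c : Finset (Fin N) → Bool) (t : ℕ) {Y Z : Finset (Fin N)}
    (h : Y ⊆ Z) : altLevel c t Y ≤ altLevel c t Z := by
  classical
  exact Nat.findGreatest_mono_left (fun k hk => AltBelow.mono h hk) t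

theorem altLevel_lt {N : ℕ} {c : Finset (Fin N) → Bool} {t : ℕ}
    (h : ∀ e : Fin t ↪o Finset (Fin N), ∃ p, c (e p) ≠ rbrColor t p) (Z : Finset (Fin N)) :
    altLevel c t Z < t := by
  classical
  refine lt_of_le_of_ne (Nat.findGreatest_le t) fun heq => ?_
  have hs := altBelow_altLevel c t Z
  rw [heq] at hs
  obtain ⟨e, he, hc, -⟩ := hs.exists_strictMono
  obtain ⟨p, hp⟩ := h (OrderEmbedding.ofStrictMono e he)
  exact hp (hc p)

theorem color_eq_altLevel {N : ℕ} {c : Finset (Fin N) → Bool} {t : ℕ} {Z : Finset (Fin N)}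
    (h : altLevel c t Z < t) : c Z = decide (altLevel c t Z % 2 = 0) := by
  classical
  have hspec := altBelow_altLevel c t Z
  by_contra hne
  have : altLevel c t Z + 1 ≤ altLevel c t Z := by
    refine Nat.le_findGreatest (P := fun k => AltBelow c k Z) h ⟨Z, Subset.rfl, ?_, hspec⟩
    rcases Nat.mod_two_eq_zero_or_one (altLevel c t Z) with h2 | h2 <;> simp_all
  omega

theorem not_avoids_rbr {t : ℕ} (ht : 3 ≤ t) (n : ℕ) (c : Finset (Fin ((t - 1) * n)) → Bool) :
    ¬ Avoids (rbrColor t) n c := by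
  rintro ⟨h₁, h₂⟩
  have hlt := altLevel_lt h₁
  set f := altLevel c t with hf
  have hcol : ∀ Z, c Z = decide (f Z % 2 = 0) := fun Z => color_eq_altLevel (hlt Z)
  have hbd : ∀ j : ℕ, j < t - 1 → ∀ i : Fin n, j * n + i.val < (t - 1) * n := by
    intro j hj i
    have := Nat.mul_le_mul_right n (Nat.succ_le_of_lt hj)
    have hi := i.isLt
    rw [Nat.succ_mul] at this
    omega
  let ψ : ∀ j : ℕ, j < t - 1 → Fin n → Fin ((t - 1) * n) := fun j hj i =>
    ⟨j * n + i.val, hbd j hj i⟩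
  -- the sets obtained from `A` by adjoining the first `j` blocks of the complement
  let S : ℕ → Finset (Fin n) → Finset (Fin ((t - 1) * n)) := fun j A =>
    univ.filter fun x => (∃ i ∈ A, i.val = x.val) ∨ (n ≤ x.val ∧ x.val < (j + 1) * n)
  have hSmem : ∀ j A x, x ∈ S j A ↔
      ((∃ i ∈ A, i.val = x.val) ∨ (n ≤ x.val ∧ x.val < (j + 1) * n)) := by
    intro j A x; simp [S]
  have hSmono : ∀ j A B, A ⊆ B → S j A ⊆ S j B := by
    intro j A B hAB x hx
    rw [hSmem] at hx ⊢
    exact hx.imp (fun ⟨i, hi, h⟩ => ⟨i, hAB hi, h⟩) id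
  have hSstep : ∀ j A, S j A ⊆ S (j + 1) A := by
    intro j A x hx
    rw [hSmem] at hx ⊢
    refine hx.imp id fun ⟨h, h'⟩ => ⟨h, ?_⟩
    rw [Nat.succ_mul]
    omega
  have hStrace : ∀ j A i, ψ 0 (by omega) i ∈ S j A ↔ i ∈ A := by
    intro j A i
    rw [hSmem]
    have hi := i.isLt
    constructor
    · rintro (⟨k, hk, hki⟩ | ⟨h, -⟩)
      · have : k = i := Fin.ext (by simpa [ψ] using hki)
        exact this ▸ hk
      · simp only [ψ] at h
        omega
    · intro hA
      exact Or.inl ⟨i, hA, by simp [ψ]⟩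
  have hstrict : ∀ j, j + 2 < t → ∀ A, f (S j A) < f (S (j + 1) A) := by
    intro j hj A
    refine lt_of_le_of_ne (altLevel_mono c t (hSstep j A)) fun heq => ?_
    let h : Finset (Fin n) → Finset (Fin ((t - 1) * n)) := fun B =>
      S j A ∪ B.image (ψ (j + 1) (by omega))
    have hnot : ∀ i, ψ (j + 1) (by omega) i ∉ S j A := by
      intro i hi
      have hin := i.isLt
      rw [hSmem] at hi
      have h0 : n ≤ (j + 1) * n := Nat.le_mul_of_pos_left n (Nat.succ_pos j)
      rcases hi with ⟨k, -, hk⟩ | ⟨-, hk⟩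
      · have := k.isLt
        simp only [ψ] at hk
        omega
      · simp only [ψ] at hk
        omega
    let e := traceEmbedding h (ψ (j + 1) (by omega))
      (fun B C hBC => union_subset_union Subset.rfl (image_subset_image hBC)) (by
        intro B i
        simp only [h, mem_union, hnot, false_or, mem_image]
        constructor
        · rintro ⟨k, hk, hki⟩
          have : k = i := Fin.ext (by simpa [ψ] using congrArg Fin.val hki)
          exact this ▸ hk
        · exact fun hB => ⟨i, hB, rfl⟩)
    obtain ⟨B, hB⟩ := h₂ (c (S j A)) e
    refine hB ?_
    have hsub : h B ⊆ S (j + 1) A := by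
      refine union_subset (hSstep j A) ?_
      intro x hx
      obtain ⟨i, -, rfl⟩ := mem_image.1 hx
      have hin := i.isLt
      have h0 : n ≤ (j + 1) * n := Nat.le_mul_of_pos_left n (Nat.succ_pos j)
      rw [hSmem]
      refine Or.inr ⟨?_, ?_⟩
      · simp only [ψ]; omega
      · simp only [ψ]; rw [Nat.succ_mul (j + 1)]; omega
    have hle₁ := altLevel_mono c t (show S j A ⊆ h B from subset_union_left)
    have hle₂ := altLevel_mono c t hsub
    have : f (h B) = f (S j A) := le_antisymm (hle₂.trans heq.ge) hle₁
    change c (h B) = _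
    rw [hcol, hcol, this]
  have hlow : ∀ A j, j + 1 < t → f (S j A) + (t - 2 - j) ≤ t - 1 := by
    intro A j hj
    have : ∀ k, j + k + 1 < t → f (S j A) + k ≤ f (S (j + k) A) := by
      intro k
      induction k with
      | zero => intro _; exact le_rfl
      | succ k ih =>
        intro hk
        have := ih (by omega)
        have := hstrict (j + k) (by omega) A
        change _ ≤ f (S (j + k + 1) A)
        omega
    have h3 := this (t - 2 - j) (by omega)
    have := hlt (S (j + (t - 2 - j)) A)
    omega
  let g : Finset (Fin n) → Finset (Fin ((t - 1) * n)) := fun A =>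
    if f (S 0 A) = 0 then S 0 A else S 1 A
  let e := traceEmbedding g (ψ 0 (by omega))
    (by
      intro A B hAB
      have hAB' : f (S 0 A) ≤ f (S 0 B) := altLevel_mono c t (hSmono 0 A B hAB)
      simp only [g]
      split_ifs with ha hb hb
      · exact hSmono 0 A B hAB
      · exact (hSmono 0 A B hAB).trans (hSstep 0 B)
      · omega
      · exact hSmono 1 A B hAB)
    (by
      intro A i
      simp only [g]
      split_ifs <;> exact hStrace _ A i)
  obtain ⟨A, hA⟩ := h₂ true e
  refine hA ?_
  change c (g A) = true
  rw [hcol]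
  simp only [g]
  split_ifs with ha
  · simp [ha]
  · have h0 := hstrict 0 (by omega) A
    have h1 := hlow A 1 (by omega)
    have : f (S 1 A) = 2 := by
      simp only [zero_add] at h0
      omega
    simp [this]

theorem Avoids.rbr_of_le {s t n N : ℕ} (hst : s ≤ t) {c : Finset (Fin N) → Bool}
    (hc : Avoids (rbrColor s) n c) : Avoids (rbrColor t) n c := by
  refine ⟨fun e => ?_, hc.2⟩
  obtain ⟨p, hp⟩ := hc.1 ((Fin.castLEOrderEmb hst).trans e)
  exact ⟨Fin.castLE hst p, hp⟩

/-! ### The layered lower bound -/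

theorem avoids_layered {n N : ℕ} (hN : N < 2 * n) :
    Avoids (rbrColor 2) n fun Z : Finset (Fin N) => decide (#Z < n) := by
  constructor
  · intro e
    by_contra! h
    have h0 := h 0
    have h1 := h 1
    have hle := card_le_card (e.monotone (show (0 : Fin 2) ≤ 1 by decide))
    simp [rbrColor] at h0 h1
    omega
  · intro b φ
    by_contra! h
    obtain ⟨ψ, hψ⟩ := exists_trace φ
    have hsub : univ.map ψ ⊆ φ univ := by
      intro x hx
      obtain ⟨i, -, rfl⟩ := mem_map.1 hx
      exact (hψ _ _).2 (mem_univ i)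
    have hdis : Disjoint (univ.map ψ) (φ ∅) := by
      rw [disjoint_left]
      intro x hx
      obtain ⟨i, -, rfl⟩ := mem_map.1 hx
      simp [hψ]
    have hc := card_le_univ ((univ.map ψ) ∪ φ ∅)
    have hle := card_le_card hsub
    rw [card_union_of_disjoint hdis] at hc
    simp only [card_map, card_univ, Fintype.card_fin] at hc hle
    have h0 := (h ∅).trans (h univ).symm
    rw [decide_eq_decide] at h0
    omega

/-! ### The random lower bound -/

/-- The coloring with blue bottom layers, red top layers, and in between a set is red if and only
if it lies below a member of `𝒬`. -/
theorem exists_avoids_of_family {n e m N : ℕ} (hN : N = 2 * n + e) (hm : m ≤ n)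
    (𝒬 : Finset (Finset (Fin N)))
    (h₁ : ∀ X Z : Finset (Fin N), X ⊆ Z → #X = n → #Z = n + e + m →
      ∃ B ⊆ X, #B = m ∧ Z \ B ∈ 𝒬)
    (h₂ : ∀ X W : Finset (Fin N), Disjoint X W → #X = n → #W = n - m →
      ∃ B ⊆ X, #B = m ∧ ∀ Q ∈ 𝒬, ¬ W ∪ B ⊆ Q) :
    ∃ c : Finset (Fin N) → Bool, Avoids (rbrColor 4) n c := by
  classical
  refine ⟨fun Z => decide (#Z < n - m ∨ (#Z ≤ n + e + m ∧ ¬ ∃ Q ∈ 𝒬, Z ⊆ Q)), ?_, ?_⟩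
  · intro φ
    by_contra hcon
    have h := fun p => not_not.1 (not_exists.1 hcon p)
    have h0 := h 0
    have h1 := h 1
    have h2 := h 2
    have h3 := h 3
    have s01 := φ.monotone (show (0 : Fin 4) ≤ 1 by decide)
    have s12 := φ.monotone (show (1 : Fin 4) ≤ 2 by decide)
    have s23 := φ.monotone (show (2 : Fin 4) ≤ 3 by decide)
    have c01 := card_le_card s01
    have c12 := card_le_card s12
    have c23 := card_le_card s23
    have hD : (∃ Q ∈ 𝒬, φ 2 ⊆ Q) → ∃ Q ∈ 𝒬, φ 1 ⊆ Q :=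
      fun ⟨Q, hQ, hs⟩ => ⟨Q, hQ, Subset.trans s12 hs⟩
    simp only [rbrColor, Fin.val_zero, Fin.val_one, Fin.val_two, decide_eq_decide] at h0 h1 h2 h3
    have h3' := h3.2 (by decide)
    have h1' := h1.2 (by decide)
    have h0' := not_or.1 (mt h0.1 (by decide))
    have h2' := not_or.1 (mt h2.1 (by decide))
    rcases h1' with h1' | ⟨-, h1'⟩
    · omega
    · have : ¬ #(φ 2) ≤ n + e + m := fun hle => h2'.2 ⟨hle, fun h => h1' (hD h)⟩
      omega
  · intro b φ
    by_contra hcon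
    have h := fun p => not_not.1 (not_exists.1 hcon p)
    obtain ⟨ψ, hψ⟩ := exists_trace φ
    set X := univ.map ψ with hX
    have hXcard : #X = n := by simp [hX]
    have hsub : X ⊆ φ univ := by
      intro x hx
      obtain ⟨i, -, rfl⟩ := mem_map.1 hx
      exact (hψ _ _).2 (mem_univ i)
    have hdis : ∀ A, Disjoint (univ.map ψ \ A.map ψ) (φ A) := by
      intro A
      rw [disjoint_left]
      intro x hx
      obtain ⟨hx, hxA⟩ := mem_sdiff.1 hx
      obtain ⟨i, -, rfl⟩ := mem_map.1 hx
      rw [hψ]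
      simpa using hxA
    have hmap : ∀ A, A.map ψ ⊆ φ A := by
      intro A x hx
      obtain ⟨i, hi, rfl⟩ := mem_map.1 hx
      exact (hψ _ _).2 hi
    have hcard_ge : ∀ A, #A ≤ #(φ A) := fun A => by simpa using card_le_card (hmap A)
    have hcard_le : ∀ A, #(φ A) + (n - #A) ≤ N := by
      intro A
      have hc := card_le_univ ((univ.map ψ \ A.map ψ) ∪ φ A)
      rw [card_union_of_disjoint (hdis A), card_sdiff_of_subset (map_subset_map.2 (subset_univ A))]
        at hc
      simp only [card_map, card_univ, Fintype.card_fin] at hc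
      omega
    have hpre : ∀ B ⊆ X, ∃ A : Finset (Fin n), A.map ψ = B := fun B hB => by
      obtain ⟨A, -, hA⟩ := subset_map_iff.1 hB
      exact ⟨A, hA.symm⟩
    cases b with
    | true =>
      simp only [decide_eq_true_eq] at h
      have hu := h univ
      have hge := hcard_ge univ
      simp only [card_univ, Fintype.card_fin] at hge
      obtain ⟨Z, hZ, hZcard⟩ := exists_superset_card_eq (s := φ univ) (n := n + e + m)
        (by omega) (by rw [Fintype.card_fin]; omega)
      obtain ⟨B, hBX, hB, hBQ⟩ := h₁ X Z (hsub.trans hZ) hXcard hZcard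
      obtain ⟨A, rfl⟩ := hpre B hBX
      have hA : #Aᶜ = n - m := by
        rw [card_compl, Fintype.card_fin, ← hB, card_map]
      have hsub' : φ Aᶜ ⊆ Z \ A.map ψ := by
        intro x hx
        refine mem_sdiff.2 ⟨hZ (φ.monotone (subset_univ _) hx), fun hxA => ?_⟩
        obtain ⟨i, hi, rfl⟩ := mem_map.1 hxA
        exact mem_compl.1 ((hψ _ _).1 hx) hi
      have := hcard_ge Aᶜ
      rcases h Aᶜ with h' | ⟨-, h'⟩
      · omega
      · exact h' ⟨_, hBQ, hsub'⟩
    | false =>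
      simp only [decide_eq_false_iff_not, not_or, not_and, not_not] at h
      have h0 := (h ∅).1
      obtain ⟨W, hW, hWcard⟩ := exists_subset_card_eq (s := φ ∅) (n := n - m) (by omega)
      have hXW : Disjoint X W := by
        have := hdis ∅
        rw [map_empty, sdiff_empty] at this
        exact this.mono_right hW
      obtain ⟨B, hBX, hB, hBQ⟩ := h₂ X W hXW hXcard hWcard
      obtain ⟨A, rfl⟩ := hpre B hBX
      rw [card_map] at hB
      have := hcard_le A
      obtain ⟨Q, hQ, hAQ⟩ := (h A).2 (by omega)
      exact hBQ Q hQ (Subset.trans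
        (union_subset (hW.trans (φ.monotone (empty_subset A))) (hmap A)) hAQ)

theorem card_filter_forall_mem_mul {α β : Type*} [Fintype α] [DecidableEq α] [Fintype β]
    [DecidableEq β] (s : Finset α) (R : Finset β) :
    #{F : α → β | ∀ a ∈ s, F a ∈ R} * Fintype.card β ^ #s =
      #R ^ #s * Fintype.card β ^ Fintype.card α := by
  have h : ({F : α → β | ∀ a ∈ s, F a ∈ R} : Finset (α → β)) =
      Fintype.piFinset fun a => if a ∈ s then R else univ := by
    ext F
    simp only [mem_filter, mem_univ, true_and, Fintype.mem_piFinset]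
    refine forall_congr' fun a => ?_
    split_ifs with ha <;> simp [ha]
  rw [h, Fintype.card_piFinset]
  have h' : ∀ a, #(if a ∈ s then R else univ) = if a ∈ s then #R else Fintype.card β := by
    intro a
    split_ifs <;> simp
  simp_rw [h']
  rw [prod_ite, prod_const, prod_const, mul_assoc, ← pow_add]
  congr 2
  · simp
  · rw [filter_not, filter_mem_eq_inter, univ_inter, card_sdiff_of_subset (subset_univ s), card_univ]
    exact Nat.sub_add_cancel (card_le_univ s)

/-- A random set hits all members of a small collection of large sets, while missing a member of
each of few disjoint tuples of small sets. -/
theorem exists_hitting_family {α ι₁ ι₂ : Type*} [Fintype α] [DecidableEq α] [Fintype ι₁]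
    [Fintype ι₂] {M J C K L : ℕ} (T : ι₁ → Finset α) (S : ι₂ → Fin K → Finset α)
    (hT : ∀ i, #(T i) = J) (hS : ∀ i k, #(S i k) ≤ C)
    (hdisj : ∀ i k l, k ≠ l → Disjoint (S i k) (S i l))
    (hι₁ : Fintype.card ι₁ ≤ L) (hι₂ : Fintype.card ι₂ ≤ L)
    (h₁ : 2 * L * M ^ J < (M + 1) ^ J) (h₂ : 2 * L * C ^ K ≤ (M + 1) ^ K) :
    ∃ 𝒬 : Finset α, (∀ i, ∃ a ∈ T i, a ∈ 𝒬) ∧ ∀ i, ∃ k, ∀ a ∈ S i k, a ∉ 𝒬 := by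
  classical
  by_contra! hcon
  set P := (M + 1) ^ Fintype.card α with hP
  have hPpos : 0 < P := by positivity
  let bad₁ : ι₁ → Finset (α → Fin (M + 1)) := fun i => {F | ∀ a ∈ T i, F a ∈ ({0}ᶜ : Finset _)}
  let bad₂ : ι₂ → Finset (α → Fin (M + 1)) := fun i => {F | ∀ k, ∃ a ∈ S i k, F a = 0}
  have hb₁ : ∀ i, #(bad₁ i) * (M + 1) ^ J = M ^ J * P := by
    intro i
    have := card_filter_forall_mem_mul (T i) ({0}ᶜ : Finset (Fin (M + 1)))
    rw [hT i, Fintype.card_fin, card_compl, card_singleton, Fintype.card_fin] at this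
    simpa [bad₁] using this
  have hb₂ : ∀ i, #(bad₂ i) * (M + 1) ^ K ≤ C ^ K * P := by
    intro i
    have hsub : bad₂ i ⊆ (Fintype.piFinset (S i)).biUnion fun a =>
        {F | ∀ x ∈ univ.image a, F x ∈ ({0} : Finset (Fin (M + 1)))} := by
      intro F hF
      have hF := (mem_filter.1 hF).2
      choose a ha ha' using hF
      refine mem_biUnion.2 ⟨a, Fintype.mem_piFinset.2 ha, ?_⟩
      simpa using ha'
    have hcard : ∀ a ∈ Fintype.piFinset (S i),
        #{F : α → Fin (M + 1) | ∀ x ∈ univ.image a, F x ∈ ({0} : Finset (Fin (M + 1)))} *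
          (M + 1) ^ K = P := by
      intro a ha
      have hinj : Function.Injective a := by
        intro k l hkl
        by_contra hne
        have hk := Fintype.mem_piFinset.1 ha k
        have hl := Fintype.mem_piFinset.1 ha l
        exact disjoint_left.1 (hdisj i k l hne) hk (hkl ▸ hl)
      have := card_filter_forall_mem_mul (univ.image a) ({0} : Finset (Fin (M + 1)))
      rw [card_image_of_injective _ hinj, card_univ, Fintype.card_fin, Fintype.card_fin,
        card_singleton, one_pow, one_mul] at this
      exact this
    calc #(bad₂ i) * (M + 1) ^ K
        ≤ (∑ a ∈ Fintype.piFinset (S i), #{F : α → Fin (M + 1) |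
            ∀ x ∈ univ.image a, F x ∈ ({0} : Finset (Fin (M + 1)))}) * (M + 1) ^ K :=
          Nat.mul_le_mul_right _ ((card_le_card hsub).trans card_biUnion_le)
      _ = #(Fintype.piFinset (S i)) * P := by
          rw [sum_mul, sum_congr rfl hcard, sum_const, smul_eq_mul]
      _ ≤ C ^ K * P := by
          refine Nat.mul_le_mul_right _ ?_
          rw [Fintype.card_piFinset]
          exact (prod_le_prod' fun k _ => hS i k).trans (by simp)
  have hcover : (univ : Finset (α → Fin (M + 1))) ⊆ univ.biUnion bad₁ ∪ univ.biUnion bad₂ := by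
    intro F _
    by_cases hF : ∀ i, ∃ a ∈ T i, F a = 0
    · obtain ⟨i, hi⟩ := hcon {a | F a = 0} (by simpa using hF)
      refine mem_union_right _ (mem_biUnion.2 ⟨i, mem_univ i, ?_⟩)
      simpa [bad₂] using hi
    · push Not at hF
      obtain ⟨i, hi⟩ := hF
      refine mem_union_left _ (mem_biUnion.2 ⟨i, mem_univ i, ?_⟩)
      simpa [bad₁] using hi
  have htot : P ≤ ∑ i, #(bad₁ i) + ∑ i, #(bad₂ i) := by
    have := (card_le_card hcover).trans (card_union_le _ _)
    rw [card_univ, Fintype.card_fun, Fintype.card_fin] at this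
    exact this.trans (add_le_add card_biUnion_le card_biUnion_le)
  have hs₁ : 2 * (∑ i, #(bad₁ i)) < P := by
    refine lt_of_mul_lt_mul_right (a := (M + 1) ^ J) ?_ (Nat.zero_le _)
    calc 2 * (∑ i, #(bad₁ i)) * (M + 1) ^ J = 2 * (Fintype.card ι₁) * M ^ J * P := by
          rw [mul_assoc, sum_mul, sum_congr rfl fun i _ => hb₁ i, sum_const, card_univ,
            smul_eq_mul]
          ring
      _ ≤ 2 * L * M ^ J * P := by gcongr
      _ < (M + 1) ^ J * P := Nat.mul_lt_mul_of_pos_right h₁ hPpos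
      _ = P * (M + 1) ^ J := mul_comm _ _
  have hs₂ : 2 * (∑ i, #(bad₂ i)) ≤ P := by
    refine le_of_mul_le_mul_right (a := (M + 1) ^ K) ?_ (by positivity)
    calc 2 * (∑ i, #(bad₂ i)) * (M + 1) ^ K ≤ 2 * (∑ _i : ι₂, C ^ K * P) := by
          rw [mul_assoc, sum_mul]
          exact Nat.mul_le_mul_left _ (sum_le_sum fun i _ => hb₂ i)
      _ = 2 * Fintype.card ι₂ * C ^ K * P := by
          rw [sum_const, card_univ, smul_eq_mul]
          ring
      _ ≤ 2 * L * C ^ K * P := by gcongr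
      _ ≤ (M + 1) ^ K * P := by gcongr
      _ = P * (M + 1) ^ K := mul_comm _ _
  omega

/-- Sliding windows give equal-size subsets with large pairwise unions. -/
theorem exists_windows {α : Type*} [DecidableEq α] {n s w K : ℕ} {X : Finset α} (hX : #X = n)
    (hw : 0 < w) (hn : (K + w) * s ≤ n) :
    ∃ B : Fin K → Finset α, (∀ k, B k ⊆ X ∧ #(B k) = w * s) ∧
      ∀ k l, k ≠ l → (w + 1) * s ≤ #(B k ∪ B l) := by
  let f : Fin n ↪ α := (X.equivFinOfCardEq hX).symm.toEmbedding.trans (Function.Embedding.subtype _)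
  have hf : ∀ i, f i ∈ X := fun i => ((X.equivFinOfCardEq hX).symm i).2
  have hbd : ∀ j ≤ K + w, j * s ≤ n := fun j hj => (Nat.mul_le_mul_right s hj).trans hn
  let I : ∀ i j : ℕ, j ≤ K + w → Finset α := fun i j hj =>
    ((Ico (i * s) (j * s)).attachFin fun x hx =>
      (mem_Ico.1 hx).2.trans_le (hbd j hj)).map f
  have hI : ∀ i j hj, #(I i j hj) = (j - i) * s := fun i j hj => by
    simp [I, Nat.sub_mul]
  let B : Fin K → Finset α := fun k => I k (k + w) (by omega)
  have hlt : ∀ k l : Fin K, k < l → (w + 1) * s ≤ #(B k ∪ B l) := by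
    intro k l hkl
    have hkl' : (k : ℕ) + 1 ≤ l := hkl
    have hsub : I k (k + 1) (by omega) ⊆ B k :=
      map_subset_map.2 fun x hx => by
        simp only [mem_attachFin, mem_Ico] at hx ⊢
        exact ⟨hx.1, hx.2.trans_le (Nat.mul_le_mul_right s (by omega))⟩
    have hdis : Disjoint (I k (k + 1) (by omega)) (B l) :=
      (disjoint_map f).2 <| disjoint_left.2 fun x hx hx' => by
        simp only [mem_attachFin, mem_Ico] at hx hx'
        have := Nat.mul_le_mul_right s hkl'
        omega
    refine le_trans ?_ (card_le_card (union_subset_union hsub (Subset.refl (B l))))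
    rw [card_union_of_disjoint hdis, hI _ _ (by omega), hI _ _ (by omega), ← add_mul]
    exact Nat.mul_le_mul_right s (by omega)
  refine ⟨B, fun k => ⟨?_, ?_⟩, fun k l hkl => ?_⟩
  · intro x hx
    obtain ⟨i, -, rfl⟩ := mem_map.1 hx
    exact hf i
  · rw [hI _ _ (by omega), Nat.add_sub_cancel_left]
  · rcases lt_or_gt_of_ne hkl with h | h
    · exact hlt k l h
    · rw [union_comm]
      exact hlt l k h

theorem card_filter_superset_le {N q : ℕ} (V : Finset (Fin N)) {e : ℕ} (hq : #V + e = q) :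
    #{Q : Finset (Fin N) | #Q = q ∧ V ⊆ Q} ≤ (N - #V).choose e := by
  have hV : #Vᶜ = N - #V := by rw [card_compl, Fintype.card_fin]
  rw [← hV, ← card_powersetCard]
  refine card_le_card_of_injOn (fun Q => Q \ V) ?_ ?_
  · intro Q hQ
    obtain ⟨hQ, hVQ⟩ := (mem_filter.1 hQ).2
    refine mem_powersetCard.2 ⟨fun x hx => mem_compl.2 (mem_sdiff.1 hx).2, ?_⟩
    rw [card_sdiff_of_subset hVQ]
    omega
  · intro Q hQ Q' hQ' h
    have h1 := (mem_filter.1 hQ).2.2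
    have h2 := (mem_filter.1 hQ').2.2
    rw [← sdiff_union_of_subset h1, ← sdiff_union_of_subset h2]
    exact congrArg (· ∪ V) h

theorem exists_avoids_of_counting {n e w N K M : ℕ} (hN : N = 2 * n + e) (hw : 0 < w)
    (hn : (K + w) * (e + 1) ≤ n)
    (h₁ : 2 * 4 ^ N * M ^ n.choose (w * (e + 1)) < (M + 1) ^ n.choose (w * (e + 1)))
    (h₂ : 2 * 4 ^ N * (n + e).choose e ^ K ≤ (M + 1) ^ K) :
    ∃ c : Finset (Fin N) → Bool, Avoids (rbrColor 4) n c := by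
  classical
  set m := w * (e + 1) with hm
  have hmn : m ≤ n := le_trans (by rw [add_mul]; omega) hn
  let ι₁ := {p : Finset (Fin N) × Finset (Fin N) // p.1 ⊆ p.2 ∧ #p.1 = n ∧ #p.2 = n + e + m}
  let ι₂ := {p : Finset (Fin N) × Finset (Fin N) // Disjoint p.1 p.2 ∧ #p.1 = n ∧ #p.2 = n - m}
  have hpairs : Fintype.card (Finset (Fin N) × Finset (Fin N)) = 4 ^ N := by
    rw [Fintype.card_prod, Fintype.card_finset, Fintype.card_fin, ← mul_pow]
    norm_num
  choose B hB hBB using fun i : ι₂ => exists_windows (α := Fin N) (X := i.1.1) i.2.2.1 hw hn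
  let T : ι₁ → Finset (Finset (Fin N)) := fun i =>
    (powersetCard m i.1.1).image fun B => i.1.2 \ B
  let S : ι₂ → Fin K → Finset (Finset (Fin N)) := fun i k =>
    {Q : Finset (Fin N) | #Q = n + e ∧ i.1.2 ∪ B i k ⊆ Q}
  have hT : ∀ i, #(T i) = n.choose m := by
    rintro ⟨⟨X, Z⟩, hXZ, hX, hZ⟩
    dsimp only at hXZ hX hZ
    dsimp only [T]
    rw [card_image_of_injOn, card_powersetCard, hX]
    intro B hB B' hB' h
    have h1 := (mem_powersetCard.1 hB).1.trans hXZ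
    have h2 := (mem_powersetCard.1 hB').1.trans hXZ
    rw [← Finset.sdiff_sdiff_eq_self h1, ← Finset.sdiff_sdiff_eq_self h2]
    exact congrArg (Z \ ·) h
  have hS : ∀ i k, #(S i k) ≤ (n + e).choose e := by
    intro i k
    have hdis : Disjoint i.1.2 (B i k) := (i.2.1.mono_left (hB i k).1).symm
    have hc : #(i.1.2 ∪ B i k) = n := by
      rw [card_union_of_disjoint hdis, i.2.2.2, (hB i k).2]
      omega
    have := card_filter_superset_le (i.1.2 ∪ B i k) (e := e) (q := n + e) (by rw [hc])
    rw [hc] at this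
    exact this.trans_eq (by congr 1; omega)
  have hdisj : ∀ i k l, k ≠ l → Disjoint (S i k) (S i l) := by
    intro i k l hkl
    rw [disjoint_left]
    intro Q hQk hQl
    obtain ⟨hQ, hk⟩ := (mem_filter.1 hQk).2
    obtain ⟨-, hl⟩ := (mem_filter.1 hQl).2
    have hsub : i.1.2 ∪ (B i k ∪ B i l) ⊆ Q :=
      union_subset (subset_union_left.trans hk)
        (union_subset (subset_union_right.trans hk) (subset_union_right.trans hl))
    have hdis : Disjoint i.1.2 (B i k ∪ B i l) :=
      (i.2.1.mono_left (union_subset (hB i k).1 (hB i l).1)).symm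
    have hc := card_le_card hsub
    have hbb := hBB i k l hkl
    rw [card_union_of_disjoint hdis, i.2.2.2, hQ] at hc
    rw [add_mul] at hbb
    omega
  obtain ⟨𝒬, hQ₁, hQ₂⟩ := exists_hitting_family T S hT hS hdisj
    ((Fintype.card_subtype_le _).trans hpairs.le) ((Fintype.card_subtype_le _).trans hpairs.le)
    h₁ h₂
  refine exists_avoids_of_family hN hmn {Q ∈ 𝒬 | #Q = n + e} ?_ ?_
  · intro X Z hXZ hX hZ
    obtain ⟨Q, hQ, hQ𝒬⟩ := hQ₁ ⟨(X, Z), hXZ, hX, hZ⟩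
    obtain ⟨B, hB, rfl⟩ := mem_image.1 hQ
    obtain ⟨hBX, hBc⟩ := mem_powersetCard.1 hB
    refine ⟨B, hBX, hBc, mem_filter.2 ⟨hQ𝒬, ?_⟩⟩
    rw [card_sdiff_of_subset (hBX.trans hXZ)]
    omega
  · intro X W hXW hX hW
    obtain ⟨k, hk⟩ := hQ₂ ⟨(X, W), hXW, hX, hW⟩
    refine ⟨B ⟨(X, W), hXW, hX, hW⟩ k, (hB ⟨(X, W), hXW, hX, hW⟩ k).1,
      (hB ⟨(X, W), hXW, hX, hW⟩ k).2, fun Q hQ hsub => ?_⟩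
    obtain ⟨hQ, hQc⟩ := mem_filter.1 hQ
    exact hk Q (mem_filter.2 ⟨mem_univ Q, hQc, hsub⟩) hQ

/-! ### Numerical estimates -/

theorem pow_add_mul_pow_le (a k : ℕ) : a ^ (k + 1) + (k + 1) * a ^ k ≤ (a + 1) ^ (k + 1) := by
  induction k with
  | zero => simp
  | succ k ih =>
    have h := Nat.mul_le_mul_right (a + 1) ih
    rw [← pow_succ] at h
    refine le_trans ?_ h
    have : (a ^ (k + 1) + (k + 1) * a ^ k) * (a + 1) =
        a ^ (k + 1 + 1) + (k + 1 + 1) * a ^ (k + 1) + (k + 1) * a ^ k := by ring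
    omega

theorem two_mul_pow_self_le (a : ℕ) : 2 * a ^ (a + 1) ≤ (a + 1) ^ (a + 1) := by
  have h := pow_add_mul_pow_le a a
  have : (a + 1) * a ^ a = a ^ (a + 1) + a ^ a := by ring
  omega

theorem two_pow_mul_pow_le {a r J : ℕ} (h : (a + 1) * r ≤ J) : 2 ^ r * a ^ J ≤ (a + 1) ^ J := by
  obtain ⟨d, rfl⟩ := Nat.exists_eq_add_of_le h
  calc 2 ^ r * a ^ ((a + 1) * r + d) = (2 * a ^ (a + 1)) ^ r * a ^ d := by
        rw [pow_add, pow_mul, mul_pow, mul_assoc]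
    _ ≤ ((a + 1) ^ (a + 1)) ^ r * (a + 1) ^ d :=
        Nat.mul_le_mul (Nat.pow_le_pow_left (two_mul_pow_self_le a) r)
          (Nat.pow_le_pow_left (Nat.le_succ a) d)
    _ = (a + 1) ^ ((a + 1) * r + d) := by rw [pow_add _ ((a + 1) * r), pow_mul]

theorem counting_hitting {s n N : ℕ} (hs : 14 ≤ s) (hn : 48 * s ≤ n) (hN : N ≤ 101 * s) :
    2 * 4 ^ N * (2 ^ (40 * s) - 1) ^ n.choose (24 * s) <
      (2 ^ (40 * s) - 1 + 1) ^ n.choose (24 * s) := by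
  have hP : 2 ^ (40 * s) - 1 + 1 = 2 ^ (40 * s) := Nat.sub_add_cancel Nat.one_le_two_pow
  have hchoose : (2 ^ (40 * s) - 1 + 1) * (203 * s) ≤ n.choose (24 * s) := by
    have h1 := Nat.four_pow_le_two_mul_self_mul_centralBinom (24 * s) (by omega)
    have h2 : (24 * s).centralBinom ≤ n.choose (24 * s) := by
      rw [Nat.centralBinom_eq_two_mul_choose]
      exact Nat.choose_le_choose _ (by omega)
    have h3 : (4 : ℕ) ^ (24 * s) = 2 ^ (40 * s) * (2 ^ s * 2 ^ s) * 2 ^ (6 * s) := by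
      rw [show (4 : ℕ) = 2 ^ 2 by norm_num, ← pow_mul, ← pow_add, ← pow_add, ← pow_add]
      congr 1
      ring
    have h4 : s ≤ 2 ^ s := Nat.lt_two_pow_self.le
    have h5 : 48 * 203 ≤ 2 ^ (6 * s) :=
      le_trans (by norm_num) (Nat.pow_le_pow_right (n := 2) (by norm_num)
        (show 14 ≤ 6 * s by omega))
    rw [hP]
    refine le_of_mul_le_mul_left (a := 48 * s) ?_ (by omega)
    calc 48 * s * (2 ^ (40 * s) * (203 * s)) = 2 ^ (40 * s) * (s * s) * (48 * 203) := by ring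
      _ ≤ 2 ^ (40 * s) * (2 ^ s * 2 ^ s) * 2 ^ (6 * s) := by gcongr
      _ = 4 ^ (24 * s) := h3.symm
      _ ≤ 2 * (24 * s) * (24 * s).centralBinom := h1
      _ ≤ 2 * (24 * s) * n.choose (24 * s) := Nat.mul_le_mul_left _ h2
      _ = 48 * s * n.choose (24 * s) := by ring
  refine lt_of_lt_of_le ?_ (two_pow_mul_pow_le hchoose)
  have hpos : 0 < 2 ^ (40 * s) - 1 :=
    Nat.sub_pos_of_lt (Nat.one_lt_two_pow (by omega))
  refine Nat.mul_lt_mul_of_pos_right ?_ (Nat.pow_pos hpos)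
  rw [show (4 : ℕ) = 2 ^ 2 by norm_num, ← pow_mul, ← pow_succ']
  exact Nat.pow_lt_pow_right (by norm_num) (by omega)

theorem counting_missing {s e n N : ℕ} (hs : 14 ≤ s) (hn : 50 * s ≤ n + 50)
    (hn' : n + e ≤ 51 * s) (hN : N ≤ 101 * s) :
    2 * 4 ^ N * (n + e).choose e ^ 20 ≤ (2 ^ (40 * s) - 1 + 1) ^ 20 := by
  rw [Nat.sub_add_cancel Nat.one_le_two_pow]
  have h1 : 3 ^ n * (n + e).choose e ≤ 4 ^ (n + e) := by
    have h := add_pow (3 : ℕ) 1 (n + e)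
    push_cast at h
    have h' := single_le_sum (f := fun i => (3 : ℕ) ^ i * 1 ^ (n + e - i) * (n + e).choose i)
      (fun _ _ => Nat.zero_le _) (mem_range.2 (show n < n + e + 1 by omega))
    rw [← h] at h'
    simpa [Nat.choose_symm_add] using h'
  have h2 : (2 : ℕ) ^ (79 * s) ≤ 3 ^ n * 3 ^ 50 := by
    rw [← pow_add, pow_mul]
    calc ((2 : ℕ) ^ 79) ^ s ≤ (3 ^ 50) ^ s := Nat.pow_le_pow_left (by norm_num) s
      _ = 3 ^ (50 * s) := (pow_mul _ _ _).symm
      _ ≤ 3 ^ (n + 50) := Nat.pow_le_pow_right (by norm_num) hn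
  have h3 : (n + e).choose e ≤ 2 ^ (29 * s) := by
    refine le_of_mul_le_mul_left (a := 2 ^ (79 * s)) ?_ (by positivity)
    calc 2 ^ (79 * s) * (n + e).choose e ≤ 3 ^ n * 3 ^ 50 * (n + e).choose e :=
          Nat.mul_le_mul_right _ h2
      _ = 3 ^ n * (n + e).choose e * 3 ^ 50 := by ring
      _ ≤ 4 ^ (51 * s) * 2 ^ (6 * s) := by
          refine Nat.mul_le_mul (h1.trans (Nat.pow_le_pow_right (by norm_num) hn')) ?_
          exact le_trans (b := 2 ^ 84) (by norm_num) (Nat.pow_le_pow_right (by norm_num) (by omega))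
      _ = 2 ^ (79 * s) * 2 ^ (29 * s) := by
          rw [show (4 : ℕ) = 2 ^ 2 by norm_num, ← pow_mul, ← pow_add, ← pow_add]
          congr 1
          ring
  calc 2 * 4 ^ N * (n + e).choose e ^ 20 ≤ 2 * 4 ^ N * (2 ^ (29 * s)) ^ 20 := by gcongr
    _ = 2 ^ (2 * N + 1 + 29 * s * 20) := by
        rw [show (4 : ℕ) = 2 ^ 2 by norm_num, ← pow_mul, ← pow_mul, ← pow_succ', ← pow_add]
    _ ≤ 2 ^ (40 * s * 20) := Nat.pow_le_pow_right (by norm_num) (by omega)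
    _ = (2 ^ (40 * s)) ^ 20 := pow_mul _ _ _

theorem exists_avoids_rbr_four {n : ℕ} (hn : 1250 ≤ n) :
    ∃ c : Finset (Fin (2 * n + n / 50)) → Bool, Avoids (rbrColor 4) n c := by
  have hdiv := Nat.div_add_mod n 50
  have hmod := Nat.mod_lt n (show 50 > 0 by decide)
  exact exists_avoids_of_counting (e := n / 50) (w := 24) (K := 20)
    (M := 2 ^ (40 * (n / 50 + 1)) - 1) rfl
    (by decide) (by omega) (counting_hitting (by omega) (by omega) (by omega))
    (counting_missing (by omega) (by omega) (by omega) (by omega))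

/-- For every `n ∈ ℕ`, `R̃(Ċ₂^{(rbr)}, Q_n) = R̃(Ċ₃^{(rbr)}, Q_n) = 2n`.
Moreover for every `t ≥ 4` there is `n₀` such that for all `n ≥ n₀`,
`2.02·n < R̃(Ċ_t^{(rbr)}, Q_n) ≤ (t − 1)·n`. -/
theorem alternating_chain_EH :
    (∀ n : ℕ, posetEH (rbrColor 2) n = 2 * n ∧ posetEH (rbrColor 3) n = 2 * n) ∧
    (∀ t : ℕ, 4 ≤ t → ∃ n₀ : ℕ, ∀ n : ℕ, n₀ ≤ n →
      (2.02 : ℝ) * (n : ℝ) < (posetEH (rbrColor t) n : ℝ) ∧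
      posetEH (rbrColor t) n ≤ (t - 1) * n) := by
  have hthree : ∀ n (c : Finset (Fin (2 * n)) → Bool), ¬ Avoids (rbrColor 3) n c :=
    fun n c => not_avoids_rbr le_rfl n c
  have htwo : ∀ n (c : Finset (Fin (2 * n)) → Bool), ¬ Avoids (rbrColor 2) n c :=
    fun n c h => hthree n c (h.rbr_of_le (by decide))
  refine ⟨fun n => ?_, fun t ht => ⟨2500, fun n hn =>
    ⟨?_, posetEH_le (not_avoids_rbr (by omega) n)⟩⟩⟩
  · rcases Nat.eq_zero_or_pos n with rfl | hn
    · exact ⟨Nat.le_zero.1 (posetEH_le (htwo 0)), Nat.le_zero.1 (posetEH_le (hthree 0))⟩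
    · have h2 : 2 * n - 1 < posetEH (rbrColor 2) n :=
        lt_posetEH (fun N' hN' => ⟨_, avoids_layered (by omega)⟩) (htwo n)
      have h3 : 2 * n - 1 < posetEH (rbrColor 3) n :=
        lt_posetEH (fun N' hN' => ⟨_, (avoids_layered (by omega)).rbr_of_le (by decide)⟩) (hthree n)
      have h2' := posetEH_le (htwo n)
      have h3' := posetEH_le (hthree n)
      omega
  · obtain ⟨c, hc⟩ := exists_avoids_rbr_four (n := n) (by omega)
    have hlt : 2 * n + n / 50 < posetEH (rbrColor t) n :=
      lt_posetEH (fun N' hN' => ⟨_, (hc.rbr_of_le ht).restrict hN'⟩) (not_avoids_rbr (by omega) n)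
    have hnat : 101 * n < 50 * posetEH (rbrColor t) n := by omega
    have hreal : (101 : ℝ) * n < 50 * posetEH (rbrColor t) n := by exact_mod_cast hnat
    linarith
end
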